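/- Let d ≥ 5 and ℓ ≥ 2 be integers, and let p_1, …, p_ℓ, r be exponents with 1 < p_i < ∞ for 1 ≤ i ≤ ℓ-1, d/(d-2) < p_ℓ < ∞, and 1/r ≤ 1/p_1 + … + 1/p_ℓ (so in particular r > d/(ℓd-2)). Then the ℓ-linear discrete spherical maximal operator T* is bounded from ℓ^{p_1}(ℤ^d) × … × ℓ^{p_ℓ}(ℤ^d) to ℓ^r(ℤ^d): there exists C > 0 such that for all f_1, …, f_ℓ : ℤ^d → ℂ, ‖T*(f_1,…,f_ℓ)‖_{ℓ^r(ℤ^d)} ≤ C ∏_{i=1}^ℓ ‖f_i‖_{ℓ^{p_i}(ℤ^d)}. -/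

import Mathlib

open scoped ENNReal NNReal BigOperators

noncomputable section

/-- `|u|² = ∑ i, u i ^ 2` for `u ∈ ℤ^d`. -/
def normSq {d : ℕ} (u : Fin d → ℤ) : ℤ := ∑ i, u i ^ 2

/-- The `ℓ`-linear discrete spherical average
`T_λ(f_1,…,f_ℓ)(x) = λ^{-(ℓd/2-1)} ∑_{|u_1|²+⋯+|u_ℓ|²=λ} f_1(x-u_1)⋯f_ℓ(x-u_ℓ)`
(a finite sum). -/
def multAvg (d l : ℕ) (f : Fin l → (Fin d → ℤ) → ℂ) (lam : ℕ) (x : Fin d → ℤ) : ℂ :=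
  ((((lam : ℝ) ^ (((l * d : ℕ) : ℝ) / 2 - 1))⁻¹ : ℝ) : ℂ) *
    ∑ᶠ (u : Fin l → (Fin d → ℤ)) (_ : ∑ i, normSq (u i) = (lam : ℤ)),
      ∏ i, f i (x - u i)

/-- The `ℓ`-linear discrete spherical maximal operator
`T*(f_1,…,f_ℓ)(x) = sup_{λ ≥ 1} |T_λ(f_1,…,f_ℓ)(x)|`, valued in `ℝ≥0∞`. -/
def multMax (d l : ℕ) (f : Fin l → (Fin d → ℤ) → ℂ) (x : Fin d → ℤ) : ℝ≥0∞ :=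
  ⨆ (lam : ℕ) (_ : 1 ≤ lam), (‖multAvg d l f lam x‖₊ : ℝ≥0∞)

/-- The `ℓ^p(ℤ^d)` norm of a complex-valued function. -/
def lpNorm (d : ℕ) (p : ℝ) (f : (Fin d → ℤ) → ℂ) : ℝ≥0∞ :=
  (∑' x : Fin d → ℤ, (‖f x‖₊ : ℝ≥0∞) ^ p) ^ (1 / p)

/-- The `ℓ^r(ℤ^d)` norm of an `ℝ≥0∞`-valued function. -/
def lpNormE (d : ℕ) (r : ℝ) (F : (Fin d → ℤ) → ℝ≥0∞) : ℝ≥0∞ :=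
  (∑' x : Fin d → ℤ, F x ^ r) ^ (1 / r)

/-- The number of points where `g` exceeds `α`. -/
def levelCount {ι : Type*} (g : ι → ℝ≥0∞) (α : ℝ≥0∞) : ℝ≥0∞ :=
  ∑' x, Set.indicator {x | α < g x} 1 x

lemma levelCount_mono {ι : Type*} {g h : ι → ℝ≥0∞} (hgh : ∀ x, g x ≤ h x) (α : ℝ≥0∞) :
    levelCount g α ≤ levelCount h α := by
  refine ENNReal.tsum_le_tsum fun x => ?_
  exact Set.indicator_le_indicator_of_subset (fun y hy => lt_of_lt_of_le hy (hgh y))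
    (fun _ => zero_le) x

lemma levelCount_le_of_finset {ι : Type*} {g : ι → ℝ≥0∞} {α B : ℝ≥0∞}
    (h : ∀ X : Finset ι, (∀ x ∈ X, α < g x) → (X.card : ℝ≥0∞) ≤ B) : levelCount g α ≤ B := by
  classical
  rw [levelCount, ENNReal.tsum_eq_iSup_sum]
  refine iSup_le fun X => ?_
  have := h (X.filter fun x => α < g x) (by simp)
  refine le_trans (le_of_eq ?_) this
  rw [Finset.card_filter]
  push_cast
  refine Finset.sum_congr rfl fun x _ => ?_
  simp [Set.indicator_apply]

/-- The cube of side length `2 R + 1` in `ℤ^d` with centre `x`. -/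
def cube {d : ℕ} (x : Fin d → ℤ) (R : ℕ) : Finset (Fin d → ℤ) :=
  Finset.Icc (fun i => x i - R) (fun i => x i + R)

lemma mem_cube {d : ℕ} {x y : Fin d → ℤ} {R : ℕ} : y ∈ cube x R ↔ ∀ i, |y i - x i| ≤ R := by
  simp only [cube, Finset.mem_Icc, Pi.le_def, abs_le]
  exact ⟨fun h i => ⟨by linarith [h.1 i], by linarith [h.2 i]⟩,
    fun h => ⟨fun i => by linarith [(h i).1], fun i => by linarith [(h i).2]⟩⟩

lemma card_cube {d : ℕ} (x : Fin d → ℤ) (R : ℕ) : (cube x R).card = (2 * R + 1) ^ d := by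
  rw [cube, Pi.card_Icc]
  simp only [Int.card_Icc]
  rw [Finset.prod_congr rfl (fun i _ => show _ = 2 * R + 1 by omega)]
  simp

lemma mem_cube_iff_mem_closedBall {d : ℕ} {x y : Fin d → ℤ} {R : ℕ} :
    y ∈ cube x R ↔ y ∈ Metric.closedBall x (R : ℝ) := by
  rw [mem_cube, Metric.mem_closedBall, dist_pi_le_iff (by positivity)]
  refine forall_congr' fun i => ?_
  rw [Int.dist_eq]
  exact_mod_cast Iff.rfl

/-- The (centred) Hardy-Littlewood maximal function over cubes. -/
def cubeMax {d : ℕ} (f : (Fin d → ℤ) → ℝ≥0∞) (x : Fin d → ℤ) : ℝ≥0∞ :=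
  ⨆ R : ℕ, (((2 * R + 1) ^ d : ℕ) : ℝ≥0∞)⁻¹ * ∑ y ∈ cube x R, f y

lemma cube_sum_le {d : ℕ} (f : (Fin d → ℤ) → ℝ≥0∞) (x : Fin d → ℤ) (R : ℕ) :
    ∑ y ∈ cube x R, f y ≤ (((2 * R + 1) ^ d : ℕ) : ℝ≥0∞) * cubeMax f x := by
  have h : (((2 * R + 1) ^ d : ℕ) : ℝ≥0∞)⁻¹ * ∑ y ∈ cube x R, f y ≤ cubeMax f x :=
    le_iSup (fun R : ℕ => (((2 * R + 1) ^ d : ℕ) : ℝ≥0∞)⁻¹ * ∑ y ∈ cube x R, f y) R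
  rw [mul_comm, ← div_eq_mul_inv] at h
  rw [mul_comm]
  refine (ENNReal.div_le_iff_le_mul (Or.inl ?_) (Or.inl (ENNReal.natCast_ne_top _))).1 h
  exact_mod_cast (by positivity : (2 * R + 1) ^ d ≠ 0)

/-- The weak-type `(1,1)` inequality for the maximal function over cubes. -/
lemma cubeMax_weak {d : ℕ} (f : (Fin d → ℤ) → ℝ≥0∞) (α : ℝ≥0∞) (hα : α ≠ 0) (hα' : α ≠ ∞) :
    levelCount (cubeMax f) α ≤ 9 ^ d * α⁻¹ * ∑' y, f y := by
  classical
  refine levelCount_le_of_finset fun X hX => ?_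
  have h1 : ∀ x ∈ X, ∃ R : ℕ, α * (((2 * R + 1) ^ d : ℕ) : ℝ≥0∞) ≤ ∑ y ∈ cube x R, f y := by
    intro x hx
    obtain ⟨R, hR⟩ := lt_iSup_iff.1 (hX x hx)
    refine ⟨R, ?_⟩
    rw [mul_comm _ (∑ y ∈ cube x R, f y), ← div_eq_mul_inv] at hR
    refine (ENNReal.le_div_iff_mul_le (Or.inl ?_) (Or.inl (ENNReal.natCast_ne_top _))).1 hR.le
    exact_mod_cast (by positivity : (2 * R + 1) ^ d ≠ 0)
  choose! R hR using h1
  obtain ⟨u, huX, hdisj, hcov⟩ := Vitali.exists_disjoint_subfamily_covering_enlargement_closedBall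
    (X : Set (Fin d → ℤ)) (fun x => x) (fun x => (R x : ℝ)) (X.sup R : ℕ)
    (fun a ha => by exact_mod_cast Finset.le_sup (f := R) ha) 4 (by norm_num)
  have hufin : u.Finite := X.finite_toSet.subset huX
  obtain ⟨U, rfl⟩ := hufin.exists_finset_coe
  have hsub : X ⊆ U.biUnion fun b => cube b (4 * R b) := by
    intro x hx
    obtain ⟨b, hb, hxb⟩ := hcov x hx
    refine Finset.mem_biUnion.2 ⟨b, hb, ?_⟩
    rw [mem_cube_iff_mem_closedBall]
    push_cast
    exact hxb (Metric.mem_closedBall_self (by positivity))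
  have hcard : X.card ≤ ∑ b ∈ U, 9 ^ d * (2 * R b + 1) ^ d := by
    refine (Finset.card_le_card hsub).trans (Finset.card_biUnion_le.trans ?_)
    refine Finset.sum_le_sum fun b _ => ?_
    rw [card_cube, ← mul_pow]
    exact Nat.pow_le_pow_left (by omega) d
  have hsum : ∑ b ∈ U, ∑ y ∈ cube b (R b), f y ≤ ∑' y, f y := by
    rw [← Finset.sum_biUnion]
    · exact ENNReal.sum_le_tsum _
    · intro a ha b hb hab
      rw [Function.onFun, Finset.disjoint_left]
      intro y hya hyb
      exact Set.disjoint_left.1 (hdisj ha hb hab) (mem_cube_iff_mem_closedBall.1 hya)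
        (mem_cube_iff_mem_closedBall.1 hyb)
  calc (X.card : ℝ≥0∞) ≤ ((∑ b ∈ U, 9 ^ d * (2 * R b + 1) ^ d : ℕ) : ℝ≥0∞) := by
        exact_mod_cast hcard
    _ = 9 ^ d * α⁻¹ * ∑ b ∈ U, α * (((2 * R b + 1) ^ d : ℕ) : ℝ≥0∞) := by
        rw [← Finset.mul_sum (a := α), ← mul_assoc, mul_assoc (9 ^ d),
          ENNReal.inv_mul_cancel hα hα']
        push_cast
        rw [← Finset.mul_sum, mul_one]
    _ ≤ 9 ^ d * α⁻¹ * ∑' y, f y := by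
        gcongr
        exact (Finset.sum_le_sum fun b hb => hR b (huX hb)).trans hsum

/-- The Gaussian average of `f` at scale `M`. -/
def gaussAvg {d : ℕ} (M : ℝ) (f : (Fin d → ℤ) → ℝ≥0∞) (x : Fin d → ℤ) : ℝ≥0∞ :=
  ∑' u, ENNReal.ofReal ((M ^ d)⁻¹ * Real.exp (-Real.pi * (normSq u : ℝ) / M ^ 2)) * f (x - u)

/-- The maximal function over Gaussian averages at scales at least `1`. -/
def gaussMax {d : ℕ} (f : (Fin d → ℤ) → ℝ≥0∞) (x : Fin d → ℤ) : ℝ≥0∞ :=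
  ⨆ (M : ℝ) (_ : 1 ≤ M), gaussAvg M f x

lemma normSq_nonneg {d : ℕ} (u : Fin d → ℤ) : 0 ≤ normSq u :=
  Finset.sum_nonneg fun _ _ => sq_nonneg _

lemma sq_le_normSq {d : ℕ} (u : Fin d → ℤ) (i : Fin d) : u i ^ 2 ≤ normSq u :=
  Finset.single_le_sum (f := fun i => u i ^ 2) (fun _ _ => sq_nonneg _) (Finset.mem_univ i)

lemma exp_gauss_le {d : ℕ} (M : ℝ) (hM : 1 ≤ M) (u : Fin d → ℤ) :
    ENNReal.ofReal (Real.exp (-Real.pi * (normSq u : ℝ) / M ^ 2)) ≤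
      ∑' j : ℕ, ENNReal.ofReal (Real.exp (2 - j)) *
        Set.indicator {u | u ∈ cube 0 (j * ⌈M⌉₊)} 1 u := by
  have hM0 : 0 < M := by linarith
  have hpos : 0 < ⌈M⌉₊ := Nat.ceil_pos.2 hM0
  classical
  by_cases h0 : u = 0
  · refine le_trans ?_ (ENNReal.le_tsum 0)
    have : u ∈ cube (0 : Fin d → ℤ) (0 * ⌈M⌉₊) := by simp [mem_cube, h0]
    rw [Set.indicator_of_mem (show u ∈ {u | u ∈ cube 0 (0 * ⌈M⌉₊)} from this)]
    simp only [Pi.one_apply, mul_one]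
    apply ENNReal.ofReal_le_ofReal
    apply Real.exp_le_exp.2
    have : 0 ≤ Real.pi * (normSq u : ℝ) / M ^ 2 := by
      have := normSq_nonneg u
      have : (0 : ℝ) ≤ normSq u := by exact_mod_cast this
      positivity
    have h2 : -Real.pi * (normSq u : ℝ) / M ^ 2 = -(Real.pi * (normSq u : ℝ) / M ^ 2) := by ring
    rw [h2]; push_cast; linarith
  · obtain ⟨i0, hi0⟩ := Function.ne_iff.1 h0
    obtain ⟨i, -, hi⟩ := Finset.exists_max_image Finset.univ (fun i => (u i).natAbs)
      ⟨i0, Finset.mem_univ _⟩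
    set r := (u i).natAbs with hr
    have hrpos : 0 < r := lt_of_lt_of_le (Int.natAbs_pos.2 hi0) (hi i0 (Finset.mem_univ _))
    set j := (r - 1) / ⌈M⌉₊ + 1 with hj
    have hj0 : 1 ≤ j := Nat.le_add_left 1 _
    have hj1 : r ≤ j * ⌈M⌉₊ := by
      have := Nat.div_add_mod (r - 1) ⌈M⌉₊
      have h3 := Nat.mod_lt (r - 1) hpos
      rw [hj, add_mul, one_mul, mul_comm]
      omega
    have hj2 : (j - 1) * ⌈M⌉₊ ≤ r := by
      have := Nat.div_mul_le_self (r - 1) ⌈M⌉₊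
      rw [hj, Nat.add_sub_cancel]
      omega
    refine le_trans ?_ (ENNReal.le_tsum j)
    have hmem : u ∈ cube (0 : Fin d → ℤ) (j * ⌈M⌉₊) := by
      rw [mem_cube]
      intro k
      have := hi k (Finset.mem_univ _)
      simp only [Pi.zero_apply, sub_zero]
      have h4 : |u k| = ((u k).natAbs : ℤ) := Int.abs_eq_natAbs _
      rw [h4]
      exact_mod_cast this.trans hj1
    rw [Set.indicator_of_mem (show u ∈ {u | u ∈ cube 0 (j * ⌈M⌉₊)} from hmem)]
    simp only [Pi.one_apply, mul_one]
    apply ENNReal.ofReal_le_ofReal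
    apply Real.exp_le_exp.2
    have h5 : ((j : ℝ) - 1) * M ≤ r := by
      have h6 : ((j : ℝ) - 1) * ⌈M⌉₊ ≤ r := by
        have : (((j - 1 : ℕ) : ℝ)) * ⌈M⌉₊ ≤ r := by exact_mod_cast hj2
        rwa [Nat.cast_sub hj0, Nat.cast_one] at this
      have h7 : 0 ≤ (j : ℝ) - 1 := by
        have : (1 : ℝ) ≤ j := by exact_mod_cast hj0
        linarith
      exact (mul_le_mul_of_nonneg_left (Nat.le_ceil M) h7).trans h6
    have h8 : (r : ℝ) ^ 2 ≤ normSq u := by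
      have := sq_le_normSq u i
      have h9 : ((r : ℤ)) ^ 2 = u i ^ 2 := by rw [hr]; simp
      rw [← h9] at this
      exact_mod_cast this
    have h10 : (j : ℝ) - 1 ≤ r / M := (le_div_iff₀ hM0).2 h5
    have h11 : (r / M) ^ 2 ≤ (normSq u : ℝ) / M ^ 2 := by
      rw [div_pow]; gcongr
    have h12 : (normSq u : ℝ) / M ^ 2 ≤ Real.pi * ((normSq u : ℝ) / M ^ 2) := by
      have : 0 ≤ (normSq u : ℝ) / M ^ 2 := le_trans (sq_nonneg _) h11
      nlinarith [Real.pi_gt_three]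
    have h13 : -Real.pi * (normSq u : ℝ) / M ^ 2 = -(Real.pi * ((normSq u : ℝ) / M ^ 2)) := by ring
    rw [h13]
    nlinarith [sq_nonneg (r / M - 1)]

lemma exists_gaussMax_le (d : ℕ) : ∃ C : ℝ≥0, ∀ (f : (Fin d → ℤ) → ℝ≥0∞) (x : Fin d → ℤ),
    gaussMax f x ≤ C * cubeMax f x := by
  have hs : Summable fun j : ℕ => Real.exp (2 - j) * (4 * (j : ℝ) + 1) ^ d := by
    have h1 := (Real.summable_pow_mul_exp_neg_nat_mul d (r := 1) one_pos).mul_left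
      (Real.exp 2 * 5 ^ d)
    have h0 : Summable fun j : ℕ => Real.exp (2 - j) := by
      have := (Real.summable_pow_mul_exp_neg_nat_mul 0 (r := 1) one_pos).mul_left (Real.exp 2)
      refine this.congr fun j => ?_
      simp [sub_eq_add_neg, Real.exp_add]
    refine Summable.of_nonneg_of_le (fun j => by positivity) (fun j => ?_) (h0.add h1)
    have hexp : Real.exp (2 - j) = Real.exp 2 * Real.exp (-1 * j) := by
      rw [← Real.exp_add]; congr 1; ring
    rcases Nat.eq_zero_or_pos j with rfl | hj
    · have : 0 ≤ Real.exp 2 * 5 ^ d * ((((0 : ℕ) : ℝ)) ^ d * Real.exp (-1 * ((0 : ℕ) : ℝ))) := by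
        positivity
      simpa using this
    · have hj' : (1 : ℝ) ≤ j := by exact_mod_cast hj
      have h2 : (4 * (j : ℝ) + 1) ^ d ≤ (5 * j) ^ d := by gcongr; linarith
      calc Real.exp (2 - j) * (4 * (j : ℝ) + 1) ^ d ≤ Real.exp (2 - j) * (5 * j) ^ d := by gcongr
        _ = Real.exp 2 * 5 ^ d * ((j : ℝ) ^ d * Real.exp (-1 * j)) := by
          rw [hexp, mul_pow]; ring
        _ ≤ _ := by linarith [Real.exp_pos (2 - (j : ℝ))]
  refine ⟨(∑' j : ℕ, Real.exp (2 - j) * (4 * (j : ℝ) + 1) ^ d).toNNReal, fun f x => ?_⟩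
  refine iSup₂_le fun M hM => ?_
  have hM0 : 0 < M := by linarith
  have hceil : (⌈M⌉₊ : ℝ) ≤ 2 * M := by linarith [Nat.ceil_lt_add_one hM0.le]
  have hC : ((∑' j : ℕ, Real.exp (2 - j) * (4 * (j : ℝ) + 1) ^ d).toNNReal : ℝ≥0∞) =
      ∑' j : ℕ, ENNReal.ofReal (Real.exp (2 - j) * (4 * (j : ℝ) + 1) ^ d) :=
    ENNReal.ofReal_tsum_of_nonneg (fun j => by positivity) hs
  rw [hC, ← ENNReal.tsum_mul_right]
  classical
  calc gaussAvg M f x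
      ≤ ∑' u : Fin d → ℤ, ∑' j : ℕ, ENNReal.ofReal ((M ^ d)⁻¹) *
          (ENNReal.ofReal (Real.exp (2 - j)) *
            Set.indicator {u | u ∈ cube 0 (j * ⌈M⌉₊)} 1 u * f (x - u)) := by
        refine ENNReal.tsum_le_tsum fun u => ?_
        rw [ENNReal.tsum_mul_left, ENNReal.tsum_mul_right, ENNReal.ofReal_mul (by positivity),
          mul_assoc]
        gcongr
        exact exp_gauss_le M hM u
    _ = ∑' j : ℕ, ∑' u : Fin d → ℤ, ENNReal.ofReal ((M ^ d)⁻¹) *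
          (ENNReal.ofReal (Real.exp (2 - j)) *
            Set.indicator {u | u ∈ cube 0 (j * ⌈M⌉₊)} 1 u * f (x - u)) := ENNReal.tsum_comm
    _ ≤ _ := by
        refine ENNReal.tsum_le_tsum fun j => ?_
        simp_rw [mul_assoc (ENNReal.ofReal (Real.exp (2 - j)))]
        rw [ENNReal.tsum_mul_left, ENNReal.tsum_mul_left]
        have h1 : ∑' u : Fin d → ℤ, Set.indicator {u | u ∈ cube 0 (j * ⌈M⌉₊)} 1 u * f (x - u) =
            ∑ y ∈ cube x (j * ⌈M⌉₊), f y := by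
          rw [← (Equiv.subLeft x).tsum_eq]
          rw [tsum_eq_sum (s := cube x (j * ⌈M⌉₊))]
          · refine Finset.sum_congr rfl fun y hy => ?_
            rw [Set.indicator_of_mem]
            · simp
            · simp only [Set.mem_ofPred_eq, mem_cube, Equiv.subLeft_apply, Pi.sub_apply,
                Pi.zero_apply, sub_zero]
              intro i
              rw [abs_sub_comm]
              exact mem_cube.1 hy i
          · intro y hy
            rw [Set.indicator_of_notMem, zero_mul]
            simp only [Set.mem_ofPred_eq, mem_cube, Equiv.subLeft_apply, Pi.sub_apply,
                Pi.zero_apply, sub_zero]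
            intro h
            exact hy (mem_cube.2 fun i => by rw [abs_sub_comm]; exact h i)
        rw [h1]
        calc ENNReal.ofReal ((M ^ d)⁻¹) * (ENNReal.ofReal (Real.exp (2 - j)) *
              ∑ y ∈ cube x (j * ⌈M⌉₊), f y)
            ≤ ENNReal.ofReal ((M ^ d)⁻¹) * (ENNReal.ofReal (Real.exp (2 - j)) *
              ((((2 * (j * ⌈M⌉₊) + 1) ^ d : ℕ) : ℝ≥0∞) * cubeMax f x)) := by
              gcongr; exact cube_sum_le f x _
          _ = ENNReal.ofReal ((M ^ d)⁻¹ * (Real.exp (2 - j) *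
              (((2 * (j * ⌈M⌉₊) + 1) ^ d : ℕ) : ℝ))) * cubeMax f x := by
              rw [ENNReal.ofReal_mul (by positivity), ENNReal.ofReal_mul (by positivity),
                ENNReal.ofReal_natCast]
              ring
          _ ≤ _ := by
              gcongr ENNReal.ofReal ?_ * _
              push_cast
              have h2 : (2 * ((j : ℝ) * ⌈M⌉₊) + 1) ^ d ≤ (M * (4 * j + 1)) ^ d := by
                gcongr
                nlinarith [mul_le_mul_of_nonneg_left hceil (Nat.cast_nonneg (α := ℝ) j)]
              calc (M ^ d)⁻¹ * (Real.exp (2 - j) * (2 * ((j : ℝ) * ⌈M⌉₊) + 1) ^ d)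
                  ≤ (M ^ d)⁻¹ * (Real.exp (2 - j) * (M * (4 * j + 1)) ^ d) := by gcongr
                _ = _ := by rw [mul_pow]; field_simp

/-- The weak-type `(1,1)` inequality for the Gaussian maximal function. -/
lemma exists_gaussMax_weak (d : ℕ) : ∃ C : ℝ≥0, ∀ (f : (Fin d → ℤ) → ℝ≥0∞) (α : ℝ),
    0 < α → levelCount (gaussMax f) (ENNReal.ofReal α) ≤
      C * (ENNReal.ofReal α)⁻¹ * ∑' y, f y := by
  obtain ⟨C, hC⟩ := exists_gaussMax_le d
  refine ⟨9 ^ d * (C + 1), fun f α hα => ?_⟩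
  have hα0 : ENNReal.ofReal α ≠ 0 := by simpa using hα
  have hC0 : ((C + 1 : ℝ≥0) : ℝ≥0∞) ≠ 0 := by
    exact_mod_cast (by positivity : (C + 1 : ℝ≥0) ≠ 0)
  have hβ0 : ENNReal.ofReal α / (C + 1 : ℝ≥0) ≠ 0 := ENNReal.div_ne_zero.2
    ⟨hα0, ENNReal.coe_ne_top⟩
  have hβ1 : ENNReal.ofReal α / (C + 1 : ℝ≥0) ≠ ∞ := ENNReal.div_ne_top ENNReal.ofReal_ne_top hC0
  have := cubeMax_weak f _ hβ0 hβ1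
  refine le_trans ?_ (this.trans (le_of_eq ?_))
  · refine ENNReal.tsum_le_tsum fun x => ?_
    refine Set.indicator_le_indicator_of_subset (fun y hy => ?_) (fun _ => zero_le) x
    simp only [Set.mem_ofPred_eq] at hy ⊢
    refine (ENNReal.div_lt_iff (Or.inl hC0) (Or.inl ENNReal.coe_ne_top)).2 ?_
    refine hy.trans_le ((hC f y).trans ?_)
    rw [mul_comm]
    gcongr
    exact_mod_cast (le_add_of_nonneg_right zero_le_one)
  · rw [ENNReal.inv_div (Or.inl ENNReal.coe_ne_top) (Or.inl hC0), div_eq_mul_inv]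
    push_cast
    ring

section

open MeasureTheory Set

lemma lintegral_Ioo_rpow {p b : ℝ} (hp : 0 < p) (hb : 0 ≤ b) :
    ∫⁻ α in Ioo 0 b, ENNReal.ofReal (p * α ^ (p - 1)) = ENNReal.ofReal b ^ p := by
  have hint : IntervalIntegrable (fun α : ℝ => p * α ^ (p - 1)) volume 0 b :=
    (intervalIntegral.intervalIntegrable_rpow' (by linarith)).const_mul p
  rw [intervalIntegrable_iff_integrableOn_Ioo_of_le hb] at hint
  rw [← ofReal_integral_eq_lintegral_ofReal hint]
  · rw [← integral_Ioc_eq_integral_Ioo, ← intervalIntegral.integral_of_le hb,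
      intervalIntegral.integral_const_mul, integral_rpow (Or.inl (by linarith)),
      ENNReal.ofReal_rpow_of_nonneg hb hp.le]
    congr 1
    have : p - 1 + 1 = p := by ring
    rw [this, Real.zero_rpow hp.ne', sub_zero]
    field_simp
  · refine (ae_restrict_iff' measurableSet_Ioo).2 (Filter.Eventually.of_forall fun α hα => ?_)
    have := Real.rpow_nonneg hα.1.le (p - 1)
    simp only [Pi.zero_apply]
    positivity

/-- The layer cake representation of a power. -/
lemma rpow_eq_lintegral {p : ℝ} (hp : 0 < p) (a : ℝ≥0∞) :
    a ^ p = ∫⁻ α in Ioi (0 : ℝ), ENNReal.ofReal (p * α ^ (p - 1)) *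
      indicator {α : ℝ | ENNReal.ofReal α < a} 1 α := by
  have key : ∀ b : ℝ, 0 ≤ b → ENNReal.ofReal b ≤ a →
      ENNReal.ofReal b ^ p ≤ ∫⁻ α in Ioi (0 : ℝ), ENNReal.ofReal (p * α ^ (p - 1)) *
        indicator {α : ℝ | ENNReal.ofReal α < a} 1 α := by
    intro b hb hba
    rw [← lintegral_Ioo_rpow hp hb]
    calc ∫⁻ α in Ioo 0 b, ENNReal.ofReal (p * α ^ (p - 1))
        = ∫⁻ α in Ioo 0 b, ENNReal.ofReal (p * α ^ (p - 1)) *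
            indicator {α : ℝ | ENNReal.ofReal α < a} 1 α := by
          refine setLIntegral_congr_fun measurableSet_Ioo fun α hα => ?_
          have : α ∈ {α : ℝ | ENNReal.ofReal α < a} :=
            lt_of_lt_of_le ((ENNReal.ofReal_lt_ofReal_iff (hα.1.trans hα.2)).2 hα.2) hba
          simp [indicator_of_mem this]
      _ ≤ _ := lintegral_mono_set Ioo_subset_Ioi_self
  rcases eq_or_ne a ∞ with rfl | ha
  · rw [ENNReal.top_rpow_of_pos hp]
    refine (top_le_iff.1 ?_).symm
    refine ENNReal.le_of_forall_nnreal_lt fun r _ => ?_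
    have := key ((r : ℝ) ^ (1 / p)) (by positivity) le_top
    refine le_trans (le_of_eq ?_) this
    rw [ENNReal.ofReal_rpow_of_nonneg (by positivity) hp.le, ← Real.rpow_mul (NNReal.coe_nonneg _),
      one_div_mul_cancel hp.ne', Real.rpow_one, ENNReal.ofReal_coe_nnreal]
  · refine le_antisymm ?_ ?_
    · have := key a.toReal ENNReal.toReal_nonneg (by rw [ENNReal.ofReal_toReal ha])
      rwa [ENNReal.ofReal_toReal ha] at this
    · conv_rhs => rw [← ENNReal.ofReal_toReal ha, ← lintegral_Ioo_rpow hp ENNReal.toReal_nonneg]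
      rw [← lintegral_indicator measurableSet_Ioi, ← lintegral_indicator measurableSet_Ioo]
      refine lintegral_mono fun α => ?_
      by_cases h0 : α ∈ Ioi (0 : ℝ)
      · rw [indicator_of_mem h0]
        by_cases h1 : ENNReal.ofReal α < a
        · have h2 : α ∈ Ioo 0 a.toReal := ⟨h0, (ENNReal.ofReal_lt_iff_lt_toReal (le_of_lt h0) ha).1 h1⟩
          rw [indicator_of_mem h2, indicator_of_mem (show α ∈ {α : ℝ | ENNReal.ofReal α < a} from h1)]
          simp
        · rw [indicator_of_notMem (show α ∉ {α : ℝ | ENNReal.ofReal α < a} from h1)]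
          simp
      · rw [indicator_of_notMem h0]
        exact zero_le

lemma measurable_ofReal_rpow (p : ℝ) : Measurable fun α : ℝ => ENNReal.ofReal (p * α ^ (p - 1)) := by
  fun_prop

lemma tsum_rpow_eq_lintegral_levelCount {ι : Type*} [Countable ι] {p : ℝ} (hp : 0 < p)
    (g : ι → ℝ≥0∞) :
    ∑' x, g x ^ p = ∫⁻ α in Ioi (0 : ℝ), ENNReal.ofReal (p * α ^ (p - 1)) *
      levelCount g (ENNReal.ofReal α) := by
  simp_rw [levelCount, ← ENNReal.tsum_mul_left]
  rw [lintegral_tsum]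
  · refine tsum_congr fun x => ?_
    rw [rpow_eq_lintegral hp]
    rfl
  · intro x
    refine Measurable.aemeasurable ?_
    refine (measurable_ofReal_rpow p).mul ?_
    have : (fun α : ℝ => indicator {x | ENNReal.ofReal α < g x} (1 : ι → ℝ≥0∞) x) =
        indicator {α : ℝ | ENNReal.ofReal α < g x} 1 := by
      ext α; rfl
    rw [this]
    exact measurable_one.indicator (measurableSet_lt ENNReal.measurable_ofReal measurable_const)

/-- The part of `f` where it is large. -/
def largePart {ι : Type*} (f : ι → ℝ≥0) (s : ℝ) : ι → ℝ≥0 := indicator {x | s < f x} f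

/-- The part of `f` where it is small. -/
def smallPart {ι : Type*} (f : ι → ℝ≥0) (s : ℝ) : ι → ℝ≥0 := indicator {x | s < f x}ᶜ f

lemma largePart_add_smallPart {ι : Type*} (f : ι → ℝ≥0) (s : ℝ) :
    largePart f s + smallPart f s = f := indicator_self_add_compl _ _

lemma lintegral_largePart {p γ : ℝ} (hp : 1 < p) (hγ : 0 < γ) (v : ℝ≥0) :
    ∫⁻ α in Ioi (0 : ℝ), ENNReal.ofReal (p * α ^ (p - 1)) *
      ((ENNReal.ofReal α)⁻¹ * indicator {α : ℝ | γ * α < v} (fun _ => (v : ℝ≥0∞)) α) =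
    ENNReal.ofReal (p / (p - 1) * γ ^ (1 - p)) * (v : ℝ≥0∞) ^ p := by
  have h1 := rpow_eq_lintegral (p := p - 1) (by linarith) (ENNReal.ofReal (v / γ))
  have hp1 : 0 < p - 1 := by linarith
  have h2 : ∫⁻ α in Ioi (0 : ℝ), ENNReal.ofReal (p * α ^ (p - 1)) *
      ((ENNReal.ofReal α)⁻¹ * indicator {α : ℝ | γ * α < v} (fun _ => (v : ℝ≥0∞)) α) =
      ∫⁻ α in Ioi (0 : ℝ), (ENNReal.ofReal (p / (p - 1)) * v) *
        (ENNReal.ofReal ((p - 1) * α ^ (p - 1 - 1)) *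
        indicator {α : ℝ | ENNReal.ofReal α < ENNReal.ofReal (v / γ)} 1 α) := by
    refine setLIntegral_congr_fun measurableSet_Ioi fun α (hα : 0 < α) => ?_
    have hiff : α ∈ {α : ℝ | γ * α < v} ↔ α ∈ {α : ℝ | ENNReal.ofReal α < ENNReal.ofReal (v / γ)} := by
      simp only [mem_ofPred_eq]
      rw [ENNReal.ofReal_lt_ofReal_iff_of_nonneg hα.le, lt_div_iff₀ hγ, mul_comm]
    by_cases h : α ∈ {α : ℝ | γ * α < v}
    · rw [indicator_of_mem h, indicator_of_mem (hiff.1 h), Pi.one_apply, mul_one,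
        ← ENNReal.ofReal_inv_of_pos hα, ← mul_assoc, ← ENNReal.ofReal_mul (by positivity),
        mul_comm (ENNReal.ofReal (p / (p - 1))), mul_assoc (v : ℝ≥0∞),
        ← ENNReal.ofReal_mul (by positivity), mul_comm]
      congr 2
      rw [Real.rpow_sub_one hα.ne' (p - 1)]
      field_simp
    · rw [indicator_of_notMem h, indicator_of_notMem (fun h' => h (hiff.2 h'))]
      simp
  rw [h2, lintegral_const_mul', ← h1]
  · have hv : (v : ℝ≥0∞) = ENNReal.ofReal v := by simp
    rcases eq_or_ne v 0 with rfl | hv0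
    · simp [ENNReal.zero_rpow_of_pos (show 0 < p by linarith)]
    · have hv0' : (0 : ℝ) < v := by positivity
      rw [hv, ENNReal.ofReal_rpow_of_nonneg (by positivity) hp1.le,
        ENNReal.ofReal_rpow_of_nonneg (NNReal.coe_nonneg _) (by linarith), ← ENNReal.ofReal_mul (by positivity),
        ← ENNReal.ofReal_mul (by positivity), ← ENNReal.ofReal_mul (by positivity)]
      congr 1
      rw [Real.div_rpow (NNReal.coe_nonneg v) hγ.le, show 1 - p = -(p - 1) by ring, Real.rpow_neg hγ.le,
        Real.rpow_sub_one hv0'.ne' p]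
      field_simp
  · exact ENNReal.mul_ne_top ENNReal.ofReal_ne_top ENNReal.coe_ne_top

lemma lintegral_smallPart {p γ : ℝ} (hp : 1 < p) (hp2 : p < 2) (hγ : 0 < γ) (v : ℝ≥0) :
    ∫⁻ α in Ioi (0 : ℝ), ENNReal.ofReal (p * α ^ (p - 1)) *
      (((ENNReal.ofReal α)⁻¹) ^ 2 * indicator {α : ℝ | γ * α < v}ᶜ (fun _ => (v : ℝ≥0∞) ^ 2) α) ≤
    ENNReal.ofReal (p / (2 - p) * γ ^ (2 - p)) * (v : ℝ≥0∞) ^ p := by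
  rcases eq_or_ne v 0 with rfl | hv0
  · simp
  have hv0' : (0 : ℝ) < v := by positivity
  have hb : 0 < v / γ := by positivity
  have hae : ∀ᵐ α : ℝ ∂(volume.restrict (Ioi (0:ℝ))), α ≠ v / γ := by
    refine ae_restrict_of_ae ?_
    exact Measure.ae_ne volume _
  have h2 : ∫⁻ α in Ioi (0 : ℝ), ENNReal.ofReal (p * α ^ (p - 1)) *
      (((ENNReal.ofReal α)⁻¹) ^ 2 * indicator {α : ℝ | γ * α < v}ᶜ (fun _ => (v : ℝ≥0∞) ^ 2) α) ≤
      ∫⁻ α in Ioi (v / γ : ℝ), ENNReal.ofReal (p * v ^ 2 * α ^ (p - 3)) := by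
    rw [← lintegral_indicator measurableSet_Ioi (fun α => ENNReal.ofReal (p * v ^ 2 * α ^ (p - 3)))]
    refine le_trans (lintegral_mono_ae ?_) (setLIntegral_le_lintegral (Ioi 0) _)
    filter_upwards [hae, ae_restrict_mem measurableSet_Ioi] with α hne (hα : 0 < α)
    by_cases h : α ∈ {α : ℝ | γ * α < v}ᶜ
    · have h' : α ∈ Ioi (v / γ : ℝ) := by
        have : v / γ ≤ α := by
          simp only [mem_compl_iff, mem_ofPred_eq, not_lt] at h
          rw [div_le_iff₀ hγ, mul_comm]; exact h
        exact lt_of_le_of_ne this hne.symm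
      rw [indicator_of_mem h, indicator_of_mem h', ← ENNReal.ofReal_inv_of_pos hα,
        ← ENNReal.ofReal_pow (by positivity)]
      have hv : (v : ℝ≥0∞) = ENNReal.ofReal v := by simp
      rw [hv, ← ENNReal.ofReal_pow (NNReal.coe_nonneg _), ← ENNReal.ofReal_mul (by positivity),
        ← ENNReal.ofReal_mul (by positivity)]
      apply le_of_eq
      congr 1
      rw [show p - 3 = (p - 1) - (2 : ℕ) by push_cast; ring, Real.rpow_sub_natCast hα.ne']
      field_simp
    · rw [indicator_of_notMem h]; simp
  refine h2.trans (le_of_eq ?_)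
  have hint : IntegrableOn (fun α : ℝ => p * v ^ 2 * α ^ (p - 3)) (Ioi (v / γ : ℝ)) :=
    (integrableOn_Ioi_rpow_of_lt (by linarith) hb).const_mul _
  rw [← ofReal_integral_eq_lintegral_ofReal hint]
  · rw [integral_const_mul, integral_Ioi_rpow_of_lt (by linarith) hb]
    have hv : (v : ℝ≥0∞) = ENNReal.ofReal v := by simp
    have h2p : 0 < 2 - p := by linarith
    rw [hv, ENNReal.ofReal_rpow_of_nonneg (NNReal.coe_nonneg _) (by linarith), ← ENNReal.ofReal_mul (by positivity)]
    congr 1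
    rw [show p - 3 + 1 = -(2 - p) by ring, Real.rpow_neg hb.le, Real.div_rpow (NNReal.coe_nonneg v) hγ.le,
      Real.rpow_sub hv0', Real.rpow_two]
    have h3 : (v : ℝ) ^ p ≠ 0 := (Real.rpow_pos_of_pos hv0' p).ne'
    have h4 : (γ : ℝ) ^ (2 - p) ≠ 0 := (Real.rpow_pos_of_pos hγ _).ne'
    field_simp
  · refine (ae_restrict_iff' measurableSet_Ioi).2 (Filter.Eventually.of_forall fun α hα => ?_)
    have : 0 < α := hb.trans hα
    simp only [Pi.zero_apply]
    positivity

lemma lintegral_tsum_largePart {ι : Type*} [Countable ι] {p γ : ℝ} (hp : 1 < p) (hγ : 0 < γ)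
    (f : ι → ℝ≥0) :
    ∫⁻ α in Ioi (0 : ℝ), ENNReal.ofReal (p * α ^ (p - 1)) *
      ((ENNReal.ofReal α)⁻¹ * ∑' x, (largePart f (γ * α) x : ℝ≥0∞)) =
    ENNReal.ofReal (p / (p - 1) * γ ^ (1 - p)) * ∑' x, (f x : ℝ≥0∞) ^ p := by
  simp_rw [← ENNReal.tsum_mul_left]
  have hind : ∀ (x : ι), (fun α : ℝ => (largePart f (γ * α) x : ℝ≥0∞)) =
      indicator {α : ℝ | γ * α < f x} (fun _ => (f x : ℝ≥0∞)) := by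
    intro x; ext α
    simp only [largePart, indicator_apply, mem_ofPred_eq]
    split_ifs <;> simp
  rw [lintegral_tsum]
  · refine tsum_congr fun x => ?_
    rw [← lintegral_largePart hp hγ]
    refine lintegral_congr fun α => ?_
    rw [← hind x]
  · intro x
    refine Measurable.aemeasurable ?_
    refine (measurable_ofReal_rpow p).mul (Measurable.mul (by fun_prop) ?_)
    rw [hind x]
    exact measurable_const.indicator (measurableSet_lt (by fun_prop) measurable_const)

lemma lintegral_tsum_smallPart {ι : Type*} [Countable ι] {p γ : ℝ} (hp : 1 < p) (hp2 : p < 2)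
    (hγ : 0 < γ) (f : ι → ℝ≥0) :
    ∫⁻ α in Ioi (0 : ℝ), ENNReal.ofReal (p * α ^ (p - 1)) *
      (((ENNReal.ofReal α)⁻¹) ^ 2 * ∑' x, (smallPart f (γ * α) x : ℝ≥0∞) ^ 2) ≤
    ENNReal.ofReal (p / (2 - p) * γ ^ (2 - p)) * ∑' x, (f x : ℝ≥0∞) ^ p := by
  simp_rw [← ENNReal.tsum_mul_left]
  have hind : ∀ (x : ι), (fun α : ℝ => (smallPart f (γ * α) x : ℝ≥0∞) ^ 2) =
      indicator {α : ℝ | γ * α < f x}ᶜ (fun _ => (f x : ℝ≥0∞) ^ 2) := by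
    intro x; ext α
    simp only [smallPart, indicator_apply, mem_compl_iff, mem_ofPred_eq]
    split_ifs <;> simp
  rw [lintegral_tsum]
  · refine ENNReal.tsum_le_tsum fun x => ?_
    refine le_trans (le_of_eq ?_) (lintegral_smallPart hp hp2 hγ (f x))
    refine lintegral_congr fun α => ?_
    rw [← hind x]
  · intro x
    refine Measurable.aemeasurable ?_
    refine (measurable_ofReal_rpow p).mul (Measurable.mul (by fun_prop) ?_)
    rw [hind x]
    exact measurable_const.indicator (measurableSet_lt (by fun_prop) measurable_const).compl

/-- Marcinkiewicz interpolation between weak type `(1,1)` and strong type `(∞,∞)`. -/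
lemma tsum_rpow_le_of_weak_one_top {ι : Type*} [Countable ι] {p γ : ℝ} (hp : 1 < p) (hγ : 0 < γ)
    (g : ι → ℝ≥0∞) (f : ι → ℝ≥0) (c : ℝ≥0)
    (h : ∀ α : ℝ, 0 < α → levelCount g (ENNReal.ofReal α) ≤
      c * (ENNReal.ofReal α)⁻¹ * ∑' x, (largePart f (γ * α) x : ℝ≥0∞)) :
    ∑' x, g x ^ p ≤
      c * ENNReal.ofReal (p / (p - 1) * γ ^ (1 - p)) * ∑' x, (f x : ℝ≥0∞) ^ p := by
  rw [tsum_rpow_eq_lintegral_levelCount (by linarith), mul_assoc,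
    ← lintegral_tsum_largePart hp hγ, ← lintegral_const_mul' _ _ ENNReal.coe_ne_top]
  refine setLIntegral_mono' measurableSet_Ioi fun α hα => ?_
  calc _ ≤ ENNReal.ofReal (p * α ^ (p - 1)) *
        (c * (ENNReal.ofReal α)⁻¹ * ∑' x, (largePart f (γ * α) x : ℝ≥0∞)) := by
        gcongr; exact h α hα
    _ = _ := by ring

/-- Marcinkiewicz interpolation between weak type `(1,1)` and weak type `(2,2)`. -/
lemma tsum_rpow_le_of_weak_one_two {ι : Type*} [Countable ι] {p γ : ℝ} (hp : 1 < p) (hp2 : p < 2)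
    (hγ : 0 < γ) (g : ι → ℝ≥0∞) (f : ι → ℝ≥0) (c₁ c₂ : ℝ≥0)
    (h : ∀ α : ℝ, 0 < α → levelCount g (ENNReal.ofReal α) ≤
      c₁ * (ENNReal.ofReal α)⁻¹ * ∑' x, (largePart f (γ * α) x : ℝ≥0∞) +
      c₂ * ((ENNReal.ofReal α)⁻¹) ^ 2 * ∑' x, (smallPart f (γ * α) x : ℝ≥0∞) ^ 2) :
    ∑' x, g x ^ p ≤
      (c₁ * ENNReal.ofReal (p / (p - 1) * γ ^ (1 - p)) +
        c₂ * ENNReal.ofReal (p / (2 - p) * γ ^ (2 - p))) * ∑' x, (f x : ℝ≥0∞) ^ p := by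
  rw [tsum_rpow_eq_lintegral_levelCount (by linarith), add_mul]
  have h1 : ∀ α ∈ Ioi (0 : ℝ), ENNReal.ofReal (p * α ^ (p - 1)) *
      levelCount g (ENNReal.ofReal α) ≤
      c₁ * (ENNReal.ofReal (p * α ^ (p - 1)) *
        ((ENNReal.ofReal α)⁻¹ * ∑' x, (largePart f (γ * α) x : ℝ≥0∞))) +
      c₂ * (ENNReal.ofReal (p * α ^ (p - 1)) *
        (((ENNReal.ofReal α)⁻¹) ^ 2 * ∑' x, (smallPart f (γ * α) x : ℝ≥0∞) ^ 2)) := by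
    intro α hα
    refine (mul_le_mul_right (h α hα) _).trans (le_of_eq ?_)
    ring
  refine (setLIntegral_mono' measurableSet_Ioi h1).trans ?_
  rw [lintegral_add_left]
  · refine add_le_add ?_ ?_
    · rw [mul_assoc, ← lintegral_tsum_largePart hp hγ, lintegral_const_mul' _ _ ENNReal.coe_ne_top]
    · rw [mul_assoc, lintegral_const_mul' _ _ ENNReal.coe_ne_top]
      gcongr
      exact lintegral_tsum_smallPart hp hp2 hγ f
  · refine Measurable.const_mul ((measurable_ofReal_rpow p).mul (Measurable.mul (by fun_prop) ?_)) _
    refine Measurable.tsum fun x => ?_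
    have : (fun α : ℝ => (largePart f (γ * α) x : ℝ≥0∞)) =
        indicator {α : ℝ | γ * α < f x} (fun _ => (f x : ℝ≥0∞)) := by
      ext α
      simp only [largePart, indicator_apply, mem_ofPred_eq]
      split_ifs <;> simp
    rw [this]
    exact measurable_const.indicator (measurableSet_lt (by fun_prop) measurable_const)

lemma gaussMax_add_le {d : ℕ} (f g : (Fin d → ℤ) → ℝ≥0∞) (x : Fin d → ℤ) :
    gaussMax (f + g) x ≤ gaussMax f x + gaussMax g x := by
  refine iSup₂_le fun M hM => ?_
  have : gaussAvg M (f + g) x = gaussAvg M f x + gaussAvg M g x := by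
    simp only [gaussAvg, Pi.add_apply, mul_add]
    rw [ENNReal.tsum_add]
  rw [this]
  exact add_le_add (le_iSup₂ (f := fun (M : ℝ) (_ : 1 ≤ M) => gaussAvg M f x) M hM)
    (le_iSup₂ (f := fun (M : ℝ) (_ : 1 ≤ M) => gaussAvg M g x) M hM)

lemma gaussMax_const_le {d : ℕ} (c : ℝ≥0∞) (f : (Fin d → ℤ) → ℝ≥0∞) (hf : ∀ y, f y ≤ c)
    {C : ℝ≥0} (hC : ∀ (f : (Fin d → ℤ) → ℝ≥0∞) (x : Fin d → ℤ), gaussMax f x ≤ C * cubeMax f x)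
    (x : Fin d → ℤ) : gaussMax f x ≤ C * c := by
  refine (hC f x).trans ?_
  gcongr
  refine iSup_le fun R => ?_
  have hne : (((2 * R + 1) ^ d : ℕ) : ℝ≥0∞) ≠ 0 := by
    exact_mod_cast (by positivity : (2 * R + 1) ^ d ≠ 0)
  calc (((2 * R + 1) ^ d : ℕ) : ℝ≥0∞)⁻¹ * ∑ y ∈ cube x R, f y
      ≤ (((2 * R + 1) ^ d : ℕ) : ℝ≥0∞)⁻¹ * ((((2 * R + 1) ^ d : ℕ) : ℝ≥0∞) * c) := by
        gcongr
        refine (Finset.sum_le_card_nsmul _ _ c fun y _ => hf y).trans (le_of_eq ?_)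
        rw [card_cube, nsmul_eq_mul]
    _ = c := by
        rw [← mul_assoc, ENNReal.inv_mul_cancel hne (ENNReal.natCast_ne_top _), one_mul]

/-- The Gaussian maximal function is bounded on `ℓ^p` for `p > 1`. -/
theorem exists_gaussMax_strong (d : ℕ) {p : ℝ} (hp : 1 < p) :
    ∃ C : ℝ≥0, ∀ f : (Fin d → ℤ) → ℝ≥0∞, ∑' x, gaussMax f x ^ p ≤ C * ∑' x, f x ^ p := by
  obtain ⟨C₀, hC₀⟩ := exists_gaussMax_le d
  obtain ⟨C₁, hC₁⟩ := exists_gaussMax_weak d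
  set γ : ℝ := 1 / (2 * (C₀ + 1)) with hγdef
  have hγ : 0 < γ := by positivity
  refine ⟨2 * C₁ * (p / (p - 1) * γ ^ (1 - p)).toNNReal + 1, fun f => ?_⟩
  by_cases htop : ∃ x, f x = ∞
  · obtain ⟨x, hx⟩ := htop
    have h1 : ∑' x, f x ^ p = ∞ := by
      refine top_le_iff.1 (le_trans (le_of_eq ?_) (ENNReal.le_tsum x))
      rw [hx, ENNReal.top_rpow_of_pos (by linarith)]
    rw [h1, ENNReal.mul_top]
    · exact le_top
    · exact_mod_cast (by positivity : 2 * C₁ * (p / (p - 1) * γ ^ (1 - p)).toNNReal + 1 ≠ 0)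
  push Not at htop
  lift f to (Fin d → ℤ) → ℝ≥0 using htop
  refine (tsum_rpow_le_of_weak_one_top hp hγ (gaussMax fun x => (f x : ℝ≥0∞)) f (2 * C₁)
    fun α hα => ?_).trans ?_
  · have hsub : levelCount (gaussMax fun x => (f x : ℝ≥0∞)) (ENNReal.ofReal α) ≤
        levelCount (gaussMax fun x => (largePart f (γ * α) x : ℝ≥0∞)) (ENNReal.ofReal (α / 2)) := by
      refine ENNReal.tsum_le_tsum fun x => ?_
      refine indicator_le_indicator_of_subset (fun y hy => ?_) (fun _ => zero_le) x
      simp only [mem_ofPred_eq] at hy ⊢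
      by_contra hcon
      rw [not_lt] at hcon
      refine absurd hy (not_lt.2 ?_)
      have h1 : (fun x => (f x : ℝ≥0∞)) = (fun x => (largePart f (γ * α) x : ℝ≥0∞)) +
          fun x => (smallPart f (γ * α) x : ℝ≥0∞) := by
        ext x
        rw [Pi.add_apply, ← ENNReal.coe_add, ← Pi.add_apply, largePart_add_smallPart]
      rw [h1]
      refine (gaussMax_add_le _ _ y).trans ?_
      have h2 : gaussMax (fun x => (smallPart f (γ * α) x : ℝ≥0∞)) y ≤ ENNReal.ofReal (α / 2) := by
        refine (gaussMax_const_le (ENNReal.ofReal (γ * α)) _ (fun x => ?_) hC₀ y).trans ?_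
        · simp only [smallPart, indicator_apply, mem_compl_iff, mem_ofPred_eq]
          split_ifs with h
          · simp
          · rw [← ENNReal.ofReal_coe_nnreal]
            exact ENNReal.ofReal_le_ofReal (not_lt.1 h)
        · rw [← ENNReal.ofReal_coe_nnreal, ← ENNReal.ofReal_mul (NNReal.coe_nonneg _)]
          refine ENNReal.ofReal_le_ofReal ?_
          rw [hγdef, one_div, ← div_eq_inv_mul, ← mul_div_assoc,
            div_le_div_iff₀ (by positivity) (by positivity)]
          nlinarith [C₀.2]
      refine (add_le_add hcon h2).trans ?_
      rw [← ENNReal.ofReal_add (by positivity) (by positivity), add_halves]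
    refine hsub.trans ((hC₁ _ (α / 2) (by positivity)).trans (le_of_eq ?_))
    congr 1
    rw [ENNReal.ofReal_div_of_pos (by norm_num), ENNReal.inv_div (by simp) (by simp)]
    rw [div_eq_mul_inv]
    push_cast
    simp only [ENNReal.ofReal_ofNat]
    ring
  · gcongr
    push_cast
    rw [ENNReal.ofReal]
    exact le_add_of_nonneg_right zero_le

end

/-- The normalized quadratic Gauss sum with frequency `l`. -/
def gaussSum2 (q a : ℕ) [NeZero q] (l : ZMod q) : ℂ :=
  (q : ℂ)⁻¹ * ∑ r : ZMod q, ZMod.stdAddChar ((a : ZMod q) * r ^ 2 + r * l)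

lemma card_two_mul_eq_zero_le (q : ℕ) [NeZero q] :
    (Finset.univ.filter fun h : ZMod q => 2 * h = 0).card ≤ 2 := by
  classical
  have hsub : (Finset.univ.filter fun h : ZMod q => 2 * h = 0) ⊆
      {0, ((q / 2 : ℕ) : ZMod q)} := by
    intro h hh
    simp only [Finset.mem_filter, Finset.mem_univ, true_and] at hh
    have h1 : ((2 * h.val : ℕ) : ZMod q) = 0 := by
      push_cast; rw [ZMod.natCast_zmod_val]; exact hh
    rw [ZMod.natCast_eq_zero_iff] at h1
    have h2 := ZMod.val_lt h
    obtain ⟨c, hc⟩ := h1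
    have h3 : h.val = 0 ∨ h.val = q / 2 := by
      have : c < 2 := by
        by_contra hcon
        push Not at hcon
        nlinarith
      interval_cases c
      · left; omega
      · right; omega
    simp only [Finset.mem_insert, Finset.mem_singleton]
    rcases h3 with h3 | h3
    · left; exact (ZMod.val_eq_zero h).1 h3
    · right; rw [← h3, ZMod.natCast_zmod_val]
  exact (Finset.card_le_card hsub).trans Finset.card_le_two

lemma norm_gaussSum2_sq_le {q a : ℕ} [NeZero q] (ha : a.Coprime q) (l : ZMod q) :
    ‖gaussSum2 q a l‖ ^ 2 ≤ 2 / q := by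
  classical
  have hq : (0 : ℝ) < q := by exact_mod_cast Nat.pos_of_ne_zero (NeZero.ne q)
  set ψ : AddChar (ZMod q) ℂ := ZMod.stdAddChar with hψ
  have hu : IsUnit (a : ZMod q) := (ZMod.isUnit_iff_coprime a q).2 ha
  set G : ℂ := ∑ r : ZMod q, ψ ((a : ZMod q) * r ^ 2 + r * l) with hG
  have h1 : G * (starRingEnd ℂ) G =
      ∑ h : ZMod q, ψ (a * h ^ 2 + h * l) * (if 2 * h = 0 then (q : ℂ) else 0) := by
    have e1 : ∀ s h : ZMod q, ψ ((a : ZMod q) * (h + s) ^ 2 + (h + s) * l) *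
        (starRingEnd ℂ) (ψ ((a : ZMod q) * s ^ 2 + s * l)) =
        ψ (a * h ^ 2 + h * l) * ψ (s * (a * (2 * h))) := by
      intro s h
      rw [← AddChar.map_neg_eq_conj, ← AddChar.map_add_eq_mul, ← AddChar.map_add_eq_mul]
      congr 1; ring
    calc G * (starRingEnd ℂ) G
        = ∑ s : ZMod q, ∑ r : ZMod q, ψ ((a : ZMod q) * r ^ 2 + r * l) *
            (starRingEnd ℂ) (ψ ((a : ZMod q) * s ^ 2 + s * l)) := by
          rw [hG, map_sum, Finset.sum_mul_sum, Finset.sum_comm]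
      _ = ∑ s : ZMod q, ∑ h : ZMod q, ψ (a * h ^ 2 + h * l) * ψ (s * (a * (2 * h))) := by
          refine Finset.sum_congr rfl fun s _ => ?_
          rw [← Equiv.sum_comp (Equiv.addRight s)]
          exact Finset.sum_congr rfl fun h _ => e1 s h
      _ = _ := by
          rw [Finset.sum_comm]
          refine Finset.sum_congr rfl fun h _ => ?_
          rw [← Finset.mul_sum, AddChar.sum_mulShift _ (ZMod.isPrimitive_stdAddChar q), ZMod.card]
          simp only [hu.mul_right_eq_zero, Nat.cast_ite, Nat.cast_zero]
  have h2 : ‖G‖ ^ 2 ≤ 2 * q := by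
    have h3 : ‖G‖ ^ 2 = ‖G * (starRingEnd ℂ) G‖ := by rw [norm_mul, RCLike.norm_conj, sq]
    rw [h3, h1]
    refine (norm_sum_le _ _).trans ?_
    have h4 : ∀ h : ZMod q, ‖ψ (a * h ^ 2 + h * l) * (if 2 * h = 0 then (q : ℂ) else 0)‖ =
        if 2 * h = 0 then (q : ℝ) else 0 := by
      intro h
      rw [norm_mul, AddChar.norm_apply, one_mul]
      split_ifs <;> simp
    simp only [h4]
    rw [← Finset.sum_filter, Finset.sum_const, nsmul_eq_mul]
    gcongr
    exact_mod_cast card_two_mul_eq_zero_le q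
  rw [gaussSum2, norm_mul, mul_pow, norm_inv, Complex.norm_natCast]
  calc ((q : ℝ)⁻¹) ^ 2 * ‖G‖ ^ 2 ≤ ((q : ℝ)⁻¹) ^ 2 * (2 * q) := by gcongr
    _ = (2 : ℝ) / q := by field_simp

lemma norm_gaussSum2_le {q a : ℕ} [NeZero q] (ha : a.Coprime q) (l : ZMod q) :
    ‖gaussSum2 q a l‖ ≤ √(2 / q) :=
  Real.le_sqrt_of_sq_le (norm_gaussSum2_sq_le ha l)

/-- Inversion of the finite Fourier transform defining the Gauss sums. -/
lemma sum_gaussSum2_mul (q a : ℕ) [NeZero q] (u : ZMod q) :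
    ∑ l : ZMod q, gaussSum2 q a l * ZMod.stdAddChar (-(u * l)) =
      ZMod.stdAddChar ((a : ZMod q) * u ^ 2) := by
  classical
  have hq : (q : ℂ) ≠ 0 := by exact_mod_cast NeZero.ne q
  set ψ : AddChar (ZMod q) ℂ := ZMod.stdAddChar with hψ
  have h1 : ∀ l r : ZMod q, ψ ((a : ZMod q) * r ^ 2 + r * l) * ψ (-(u * l)) =
      ψ (a * r ^ 2) * ψ (l * (r - u)) := by
    intro l r
    rw [← AddChar.map_add_eq_mul, ← AddChar.map_add_eq_mul]
    congr 1; ring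
  simp only [gaussSum2, mul_assoc, Finset.sum_mul, ← Finset.mul_sum, ← hψ]
  simp only [h1]
  rw [Finset.sum_comm]
  simp only [← Finset.mul_sum]
  simp only [AddChar.sum_mulShift _ (ZMod.isPrimitive_stdAddChar q), ZMod.card, hψ, sub_eq_zero]
  simp only [Nat.cast_ite, Nat.cast_zero, mul_ite, mul_zero, Finset.sum_ite_eq',
    Finset.mem_univ, if_true]
  field_simp

/-- The symbol (Fourier transform) of a kernel on `ℤ`. -/
def symbol (κ : ℤ → ℂ) (ξ : ℝ) : ℂ :=
  ∑' n : ℤ, κ n * Complex.exp (2 * Real.pi * Complex.I * n * ξ)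

lemma norm_exp_two_pi_mul (n : ℤ) (ξ : ℝ) :
    ‖Complex.exp (2 * Real.pi * Complex.I * n * ξ)‖ = 1 := by
  rw [show (2 * Real.pi * Complex.I * n * ξ : ℂ) = ((2 * Real.pi * n * ξ : ℝ) : ℂ) * Complex.I by
    push_cast; ring]
  exact Complex.norm_exp_ofReal_mul_I _

/-- `∑ 1/j²` over nonzero integers `j`. -/
def zetaTwoInt : ℝ := ∑' j : ℤ, ((j : ℝ) ^ 2)⁻¹

lemma summable_zetaTwoInt : Summable fun j : ℤ => ((j : ℝ) ^ 2)⁻¹ := by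
  simpa using (Real.summable_one_div_int_pow (p := 2)).2 one_lt_two

lemma zetaTwoInt_nonneg : 0 ≤ zetaTwoInt := tsum_nonneg fun j => by positivity

lemma exp_neg_le_inv {s : ℝ} (hs : 0 < s) : Real.exp (-s) ≤ s⁻¹ := by
  rw [Real.exp_neg]
  exact inv_anti₀ hs (by linarith [Real.add_one_le_exp s])

lemma exp_gauss_int_le {b : ℝ} (hb : 0 < b) (x : ℝ) {m : ℤ} (hm : m ≠ round x) :
    Real.exp (-Real.pi * b * (m - x) ^ 2) ≤ 2 / b * (((m - round x : ℤ) : ℝ) ^ 2)⁻¹ := by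
  have h1 : |x - round x| ≤ 1 / 2 := abs_sub_round x
  have h2 : (1 : ℝ) ≤ |((m - round x : ℤ) : ℝ)| := by
    rw [← Int.cast_abs]
    exact_mod_cast Int.one_le_abs (sub_ne_zero.2 hm)
  have h3 : |((m - round x : ℤ) : ℝ)| / 2 ≤ |(m : ℝ) - x| := by
    have : ((m - round x : ℤ) : ℝ) = ((m : ℝ) - x) + (x - round x) := by push_cast; ring
    have h4 := abs_add_le ((m : ℝ) - x) (x - round x)
    rw [← this] at h4
    linarith
  have h5 : ((m - round x : ℤ) : ℝ) ^ 2 / 4 ≤ ((m : ℝ) - x) ^ 2 := by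
    have := pow_le_pow_left₀ (by positivity) h3 2
    rw [sq_abs, div_pow, sq_abs] at this
    linarith
  have h6 : 0 < ((m - round x : ℤ) : ℝ) ^ 2 := by
    rw [← sq_abs]; positivity
  have h7 : b * ((m - round x : ℤ) : ℝ) ^ 2 / 2 ≤ Real.pi * b * (m - x) ^ 2 := by
    nlinarith [mul_le_mul_of_nonneg_left h5 hb.le, Real.pi_gt_three,
      mul_pos hb h6, mul_nonneg hb.le (sq_nonneg ((m : ℝ) - x))]
  calc Real.exp (-Real.pi * b * (m - x) ^ 2)
      ≤ Real.exp (-(b * ((m - round x : ℤ) : ℝ) ^ 2 / 2)) := by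
        apply Real.exp_le_exp.2; linarith
    _ ≤ (b * ((m - round x : ℤ) : ℝ) ^ 2 / 2)⁻¹ := exp_neg_le_inv (by positivity)
    _ = _ := by field_simp

/-- A sum over `ℤ` dominated by a Gaussian is its central term up to a small error. -/
lemma tsum_sub_central {b : ℝ} (hb : 0 < b) (x : ℝ) {A : ℝ} (hA : 0 ≤ A) {w : ℤ → ℂ}
    (hw : ∀ m : ℤ, ‖w m‖ ≤ A * Real.exp (-Real.pi * b * (m - x) ^ 2)) :
    Summable (fun m => ‖w m‖) ∧ ‖∑' m, w m - w (round x)‖ ≤ A * (2 / b * zetaTwoInt) := by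
  classical
  set w' : ℤ → ℂ := Function.update w (round x) 0 with hw'
  have hsum : Summable fun m : ℤ => A * (2 / b * (((m - round x : ℤ) : ℝ) ^ 2)⁻¹) :=
    (((Equiv.subRight (round x)).summable_iff.2 summable_zetaTwoInt).mul_left (2 / b)).mul_left A
  have hle : ∀ m, ‖w' m‖ ≤ A * (2 / b * (((m - round x : ℤ) : ℝ) ^ 2)⁻¹) := by
    intro m
    by_cases hm : m = round x
    · rw [hw', hm, Function.update_self, norm_zero]; positivity
    · rw [hw', Function.update_of_ne hm]
      exact (hw m).trans (mul_le_mul_of_nonneg_left (exp_gauss_int_le hb x hm) hA)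
  have hs' : Summable fun m => ‖w' m‖ := Summable.of_nonneg_of_le (fun _ => norm_nonneg _) hle hsum
  have hs : Summable fun m => ‖w m‖ := by
    refine (hs'.update (round x) ‖w (round x)‖).congr_cofinite ?_ |>.congr fun _ => rfl
    exact Filter.Eventually.of_forall fun m => by
      by_cases hm : m = round x
      · rw [hm, Function.update_self]
      · rw [Function.update_of_ne hm, hw', Function.update_of_ne hm]
  refine ⟨hs, ?_⟩
  have h1 : ∑' m, w m - w (round x) = ∑' m, w' m := by
    rw [hs.of_norm.tsum_eq_add_tsum_ite (round x), add_sub_cancel_left]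
    refine tsum_congr fun m => ?_
    rw [hw', Function.update_apply]
  rw [h1]
  refine (norm_tsum_le_tsum_norm hs').trans ((hs'.tsum_le_tsum hle hsum).trans (le_of_eq ?_))
  rw [tsum_mul_left, tsum_mul_left]
  congr 2
  exact (Equiv.subRight (round x)).tsum_eq fun j : ℤ => ((j : ℝ) ^ 2)⁻¹

/-- The one-dimensional Gaussian chirp at scale `N` and frequency `a / q + t / N²`. -/
def chirp (q a : ℕ) (t N : ℝ) (n : ℤ) : ℂ :=
  (N : ℂ)⁻¹ * Complex.exp
    ((2 * Real.pi * Complex.I * (a / q + t / N ^ 2) - Real.pi / N ^ 2) * n ^ 2)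

/-- The complex width `1 - 2 i t` of a chirp. -/
def chirpWidth (t : ℝ) : ℂ := 1 - 2 * Complex.I * t

/-- The amplitude of the symbol of a chirp. -/
def chirpConst (t N : ℝ) : ℂ := (N : ℂ)⁻¹ / (chirpWidth t / N ^ 2) ^ (1 / 2 : ℂ)

/-- A Gaussian at scale `M` on the sublattice `qℤ`. -/
def coarse (q : ℕ) (M : ℝ) (n : ℤ) : ℂ :=
  if (q : ℤ) ∣ n then ((M⁻¹ * Real.exp (-Real.pi * ((n / q : ℤ) : ℝ) ^ 2 / M ^ 2) : ℝ) : ℂ) else 0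

/-- A quadratic phase modulated by the Fejér kernel of length `q`. -/
def fejer (q a : ℕ) (n : ℤ) : ℂ :=
  ((q : ℂ) ^ 2)⁻¹ * ∑ r : Fin q, ∑ s : Fin q,
    if n = (r : ℤ) - (s : ℤ) then Complex.exp (2 * Real.pi * Complex.I * (a * n ^ 2 / q)) else 0

lemma chirpWidth_re (t : ℝ) : (chirpWidth t).re = 1 := by simp [chirpWidth]

lemma chirpWidth_im (t : ℝ) : (chirpWidth t).im = -(2 * t) := by simp [chirpWidth]

lemma chirpWidth_ne_zero (t : ℝ) : chirpWidth t ≠ 0 := fun h => by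
  have := chirpWidth_re t
  rw [h] at this
  simp at this

lemma normSq_chirpWidth (t : ℝ) : Complex.normSq (chirpWidth t) = 1 + 4 * t ^ 2 := by
  rw [Complex.normSq_apply, chirpWidth_re, chirpWidth_im]; ring

lemma chirpWidth_inv_re (t : ℝ) : ((chirpWidth t)⁻¹).re = 1 / (1 + 4 * t ^ 2) := by
  rw [Complex.inv_re, normSq_chirpWidth, chirpWidth_re]

lemma le_norm_chirpWidth (t : ℝ) : max 1 |t| ≤ ‖chirpWidth t‖ := by
  refine max_le ?_ ?_
  · have := Complex.abs_re_le_norm (chirpWidth t)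
    rwa [chirpWidth_re, abs_one] at this
  · have := Complex.abs_im_le_norm (chirpWidth t)
    rw [chirpWidth_im, abs_neg, abs_mul, abs_two] at this
    linarith [abs_nonneg t]

lemma norm_chirpConst_sq_le {t N : ℝ} (hN : 0 < N) :
    ‖chirpConst t N‖ ^ 2 ≤ (max 1 |t|)⁻¹ := by
  have hz : (chirpWidth t / N ^ 2 : ℂ) ≠ 0 :=
    div_ne_zero (chirpWidth_ne_zero t) (by exact_mod_cast (pow_pos hN 2).ne')
  have h1 : ‖(chirpWidth t / N ^ 2 : ℂ) ^ (1 / 2 : ℂ)‖ ^ 2 = ‖chirpWidth t‖ / N ^ 2 := by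
    rw [← norm_pow, one_div, Complex.cpow_ofNat_inv_pow, norm_div, norm_pow,
      Complex.norm_real, Real.norm_of_nonneg hN.le]
  rw [chirpConst, norm_div, div_pow, h1, norm_inv, Complex.norm_real, Real.norm_of_nonneg hN.le]
  have h2 := le_norm_chirpWidth t
  have h3 : 0 < max 1 |t| := lt_of_lt_of_le one_pos (le_max_left _ _)
  calc N⁻¹ ^ 2 / (‖chirpWidth t‖ / N ^ 2) = ‖chirpWidth t‖⁻¹ := by
        have : ‖chirpWidth t‖ ≠ 0 := by linarith
        field_simp
    _ ≤ _ := inv_anti₀ h3 h2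

lemma sum_zmod_eq_sum_fin {q : ℕ} [NeZero q] (φ : ZMod q → ℂ) :
    ∑ l : ZMod q, φ l = ∑ l : Fin q, φ ((l : ℕ) : ZMod q) := by
  cases q with
  | zero => exact absurd rfl (NeZero.ne 0)
  | succ n => exact Finset.sum_congr rfl fun l _ => congrArg φ (Fin.cast_val_eq_self l).symm

lemma sum_gaussSum2_mul_exp (q a : ℕ) [NeZero q] (n : ℤ) :
    ∑ l : Fin q, gaussSum2 q a ((l : ℕ) : ZMod q) *
      Complex.exp (-(2 * Real.pi * Complex.I * n * ((l : ℕ) / q : ℂ))) =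
      Complex.exp (2 * Real.pi * Complex.I * (a * n ^ 2 / q)) := by
  have h := sum_gaussSum2_mul q a (n : ZMod q)
  rw [sum_zmod_eq_sum_fin] at h
  have h1 : ((a : ZMod q) * (n : ZMod q) ^ 2) = ((a * n ^ 2 : ℤ) : ZMod q) := by push_cast; rfl
  rw [h1, ZMod.stdAddChar_coe] at h
  rw [show Complex.exp (2 * Real.pi * Complex.I * (a * n ^ 2 / q)) =
    Complex.exp (2 * Real.pi * Complex.I * ((a * n ^ 2 : ℤ) : ℂ) / q) by
      congr 1; push_cast; ring, ← h]
  refine Finset.sum_congr rfl fun l _ => ?_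
  have h2 : (-((n : ZMod q) * ((l : ℕ) : ZMod q))) = ((-(n * (l : ℕ)) : ℤ) : ZMod q) := by
    push_cast; rfl
  rw [h2, ZMod.stdAddChar_coe]
  congr 2
  push_cast; ring

/-- The Gaussian of complex width `1 - 2 i t` at scale `M`. -/
def chirpBump (t M s : ℝ) : ℂ :=
  Complex.exp (((-(Real.pi * M ^ 2 * s ^ 2) : ℝ) : ℂ) * (chirpWidth t)⁻¹)

lemma norm_chirpBump (t M s : ℝ) :
    ‖chirpBump t M s‖ = Real.exp (-Real.pi * (M ^ 2 / (1 + 4 * t ^ 2)) * s ^ 2) := by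
  rw [chirpBump, Complex.norm_exp, Complex.re_ofReal_mul, chirpWidth_inv_re]
  congr 1; ring

lemma summable_gauss {N : ℝ} (hN : 0 < N) {w : ℤ → ℂ} {A : ℝ} (hA : 0 ≤ A)
    (hw : ∀ n : ℤ, ‖w n‖ ≤ A * Real.exp (-Real.pi * (n : ℝ) ^ 2 / N ^ 2)) :
    Summable fun n => ‖w n‖ := by
  refine (tsum_sub_central (b := (N ^ 2)⁻¹) (by positivity) 0 hA fun n => (hw n).trans
    (le_of_eq ?_)).1
  congr 2; ring

lemma norm_chirp {q a : ℕ} {t N : ℝ} (hN : 0 < N) (n : ℤ) :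
    ‖chirp q a t N n‖ = N⁻¹ * Real.exp (-Real.pi * (n : ℝ) ^ 2 / N ^ 2) := by
  rw [chirp, norm_mul, norm_inv, Complex.norm_real, Real.norm_of_nonneg hN.le, Complex.norm_exp]
  congr 2
  rw [show ((2 * Real.pi * Complex.I * (a / q + t / N ^ 2) - Real.pi / N ^ 2) * n ^ 2 : ℂ) =
    ((-Real.pi * (n : ℝ) ^ 2 / N ^ 2 : ℝ) : ℂ) +
      ((2 * Real.pi * (a / q + t / N ^ 2) * n ^ 2 : ℝ) : ℂ) * Complex.I by push_cast; ring]
  simp only [Complex.add_re, Complex.ofReal_re, Complex.re_ofReal_mul, Complex.I_re]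
  ring

lemma summable_norm_chirp {q a : ℕ} {t N : ℝ} (hN : 0 < N) :
    Summable fun n => ‖chirp q a t N n‖ :=
  summable_gauss hN (inv_nonneg.2 hN.le) fun n => (norm_chirp hN n).le

lemma summable_chirpBump (t x : ℝ) {M : ℝ} (hM : 0 < M) :
    Summable fun m : ℤ => ‖chirpBump t M (m - x)‖ := by
  refine (tsum_sub_central (b := M ^ 2 / (1 + 4 * t ^ 2)) (by positivity) x zero_le_one
    fun m => ?_).1
  rw [norm_chirpBump, one_mul]

/-- Splitting a sum over `ℤ` into residue classes. -/
lemma tsum_int_eq_sum_fin (q : ℕ) [NeZero q] {F : ℤ → ℂ} (hF : Summable F) :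
    ∑' m, F m = ∑ l : Fin q, ∑' n : ℤ, F (n * q + (l : ℕ)) := by
  rw [← (Int.divModEquiv q).symm.tsum_eq]
  have hs : Summable (F ∘ (Int.divModEquiv q).symm) := (Int.divModEquiv q).symm.summable_iff.2 hF
  rw [← (Equiv.prodComm (Fin q) ℤ).tsum_eq]
  exact hs.prod_symm.tsum_prod.trans (tsum_fintype _)

/-- The symbol of a chirp, by Poisson summation. -/
lemma symbol_chirp {q a : ℕ} [NeZero q] (ha : a.Coprime q) {t N : ℝ} (hN : 0 < N) (ξ : ℝ) :
    symbol (chirp q a t N) ξ = chirpConst t N *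
      ∑' m : ℤ, gaussSum2 q a (m : ZMod q) * chirpBump t (N / q) (m - q * ξ) := by
  have hq : (0 : ℝ) < q := by exact_mod_cast Nat.pos_of_ne_zero (NeZero.ne q)
  have hqc : (q : ℂ) ≠ 0 := by exact_mod_cast NeZero.ne q
  have hNc : (N : ℂ) ≠ 0 := by exact_mod_cast hN.ne'
  set z : ℂ := chirpWidth t / N ^ 2 with hz
  have hzre : 0 < z.re := by
    have : z = ((N ^ 2)⁻¹ : ℝ) * chirpWidth t := by rw [hz]; push_cast; field_simp
    rw [this, Complex.re_ofReal_mul, chirpWidth_re]; positivity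
  set E : Fin q → ℤ → ℂ := fun l n => Complex.exp (-Real.pi * z * n ^ 2 +
    2 * Real.pi * (Complex.I * (ξ - (l : ℕ) / q)) * n) with hE
  have h1 : ∀ n : ℤ, chirp q a t N n * Complex.exp (2 * Real.pi * Complex.I * n * ξ) =
      ∑ l : Fin q, (N : ℂ)⁻¹ * (gaussSum2 q a ((l : ℕ) : ZMod q) * E l n) := by
    intro n
    have h2 : chirp q a t N n * Complex.exp (2 * Real.pi * Complex.I * n * ξ) =
        (N : ℂ)⁻¹ * (Complex.exp (2 * Real.pi * Complex.I * (a * n ^ 2 / q)) *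
          Complex.exp (-Real.pi * z * n ^ 2 + 2 * Real.pi * (Complex.I * ξ) * n)) := by
      rw [chirp, mul_assoc, ← Complex.exp_add, ← Complex.exp_add, hz, chirpWidth]
      congr 2
      field_simp
      ring
    rw [h2, ← sum_gaussSum2_mul_exp, Finset.sum_mul, Finset.mul_sum]
    refine Finset.sum_congr rfl fun l _ => ?_
    rw [mul_assoc (gaussSum2 q a _), ← Complex.exp_add, hE]
    congr 3
    ring
  have hEs : ∀ l, Summable (E l) := fun l => by
    refine (summable_gauss hN zero_le_one (w := E l) fun n => ?_).of_norm
    rw [hE, one_mul]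
    simp only
    rw [Complex.norm_exp]
    apply le_of_eq
    congr 1
    rw [show (-Real.pi * z * n ^ 2 + 2 * Real.pi * (Complex.I * (ξ - (l : ℕ) / q)) * n : ℂ) =
      ((-Real.pi * (n : ℝ) ^ 2 / N ^ 2 : ℝ) : ℂ) * chirpWidth t +
        ((2 * Real.pi * (ξ - (l : ℕ) / q) * n : ℝ) : ℂ) * Complex.I by
      rw [hz]; push_cast; ring]
    simp only [Complex.add_re, Complex.re_ofReal_mul, chirpWidth_re, Complex.I_re]
    ring
  have hP : ∀ l, ∑' n, E l n = 1 / z ^ (1 / 2 : ℂ) *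
      ∑' n : ℤ, chirpBump t (N / q) (((n * q + (l : ℕ) : ℤ) : ℝ) - q * ξ) := by
    intro l
    rw [hE]
    simp only
    rw [Complex.tsum_exp_neg_quadratic hzre]
    congr 1
    refine tsum_congr fun n => ?_
    rw [chirpBump]
    congr 1
    rw [← mul_assoc Complex.I, Complex.I_mul_I, hz]
    have := chirpWidth_ne_zero t
    push_cast
    field_simp
    ring
  have hM : 0 < N / q := by positivity
  have hs : Summable fun m : ℤ =>
      gaussSum2 q a (m : ZMod q) * chirpBump t (N / q) (m - q * ξ) := by
    refine Summable.of_norm_bounded ((summable_chirpBump t (q * ξ) hM).mul_left (√(2 / q)))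
      fun m => ?_
    rw [norm_mul]
    exact mul_le_mul_of_nonneg_right (norm_gaussSum2_le ha _) (norm_nonneg _)
  rw [symbol, tsum_congr h1, Summable.tsum_finsetSum fun l _ => ((hEs l).mul_left _).mul_left _,
    tsum_int_eq_sum_fin q hs, Finset.mul_sum]
  refine Finset.sum_congr rfl fun l _ => ?_
  rw [tsum_mul_left, tsum_mul_left, hP, chirpConst, ← hz]
  have h3 : ∀ n : ℤ, gaussSum2 q a (((n * q + (l : ℕ) : ℤ)) : ZMod q) =
      gaussSum2 q a ((l : ℕ) : ZMod q) := fun n => by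
    congr 1; push_cast; rw [ZMod.natCast_self]; ring
  simp only [h3]
  rw [tsum_mul_left]
  ring

lemma coarse_mul (q : ℕ) [NeZero q] (M : ℝ) (m : ℤ) :
    coarse q M (q * m) = ((M⁻¹ * Real.exp (-Real.pi * (m : ℝ) ^ 2 / M ^ 2) : ℝ) : ℂ) := by
  have hq : (q : ℤ) ≠ 0 := by exact_mod_cast NeZero.ne q
  rw [coarse, if_pos (dvd_mul_right _ _), Int.mul_ediv_cancel_left _ hq]

lemma mul_left_injective_int (q : ℕ) [NeZero q] : Function.Injective fun m : ℤ => (q : ℤ) * m :=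
  mul_right_injective₀ (by exact_mod_cast NeZero.ne q)

lemma coarse_eq_zero_of_notMem_range (q : ℕ) (M : ℝ) (n : ℤ)
    (hn : n ∉ Set.range fun m : ℤ => (q : ℤ) * m) : coarse q M n = 0 := by
  rw [coarse, if_neg]
  rintro ⟨m, rfl⟩
  exact hn ⟨m, rfl⟩

lemma summable_norm_coarse (q : ℕ) [NeZero q] {M : ℝ} (hM : 0 < M) :
    Summable fun n => ‖coarse q M n‖ := by
  rw [← (mul_left_injective_int q).summable_iff fun n hn => by
    rw [coarse_eq_zero_of_notMem_range q M n hn, norm_zero]]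
  refine summable_gauss (w := fun m => coarse q M (q * m)) hM (inv_nonneg.2 hM.le) fun n => ?_
  rw [coarse_mul, Complex.norm_real, Real.norm_of_nonneg (by positivity)]

/-- The symbol of `coarse`, by Poisson summation. -/
lemma symbol_coarse (q : ℕ) [NeZero q] {M : ℝ} (hM : 0 < M) (ξ : ℝ) :
    symbol (coarse q M) ξ = ∑' m : ℤ, chirpBump 0 M (m - q * ξ) := by
  have hMc : (M : ℂ) ≠ 0 := by exact_mod_cast hM.ne'
  have hM2 : (0 : ℝ) < (M ^ 2)⁻¹ := by positivity
  have h0 : ((((M ^ 2)⁻¹ : ℝ) : ℂ)) ^ (1 / 2 : ℂ) = ((M⁻¹ : ℝ) : ℂ) := by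
    rw [show (1 / 2 : ℂ) = ((1 / 2 : ℝ) : ℂ) by push_cast; rfl, ← Complex.ofReal_cpow hM2.le,
      ← Real.sqrt_eq_rpow, Real.sqrt_inv, Real.sqrt_sq hM.le]
  rw [symbol, ← (mul_left_injective_int q).tsum_eq]
  · have h1 : ∀ m : ℤ, coarse q M (q * m) *
        Complex.exp (2 * Real.pi * Complex.I * ((q * m : ℤ) : ℂ) * ξ) =
        (M : ℂ)⁻¹ * Complex.exp (-Real.pi * (((M ^ 2)⁻¹ : ℝ) : ℂ) * m ^ 2 +
          2 * Real.pi * (Complex.I * (q * ξ)) * m) := by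
      intro m
      rw [coarse_mul]
      push_cast
      rw [mul_assoc, ← Complex.exp_add]
      congr 2
      field_simp
    rw [tsum_congr h1, tsum_mul_left, Complex.tsum_exp_neg_quadratic (by rwa [Complex.ofReal_re]),
      h0]
    push_cast
    rw [← mul_assoc]
    have h2 : (M : ℂ)⁻¹ * (1 / (M : ℂ)⁻¹) = 1 := by field_simp
    rw [h2, one_mul]
    refine tsum_congr fun m => ?_
    rw [chirpBump, ← mul_assoc Complex.I, Complex.I_mul_I]
    congr 1
    simp only [chirpWidth]
    push_cast
    field_simp
    ring
  · intro n hn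
    by_contra hcon
    rw [Function.mem_support, coarse_eq_zero_of_notMem_range q M n hcon, zero_mul] at hn
    exact hn rfl

/-- The Dirichlet kernel of length `q` at the point `ξ - l / q`. -/
def dirichletMean (q : ℕ) (l : Fin q) (ξ : ℝ) : ℂ :=
  (q : ℂ)⁻¹ * ∑ r : Fin q, Complex.exp (2 * Real.pi * Complex.I * ((r : ℕ) * (ξ - (l : ℕ) / q)))

lemma dirichletMean_mul_conj (q : ℕ) (l : Fin q) (ξ : ℝ) :
    ((‖dirichletMean q l ξ‖ ^ 2 : ℝ) : ℂ) = ((q : ℂ) ^ 2)⁻¹ * ∑ r : Fin q, ∑ s : Fin q,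
      Complex.exp (2 * Real.pi * Complex.I * (((r : ℤ) - (s : ℤ) : ℤ) * ξ)) *
      Complex.exp (-(2 * Real.pi * Complex.I * ((r : ℤ) - (s : ℤ) : ℤ) * ((l : ℕ) / q : ℂ))) := by
  have h1 : ((‖dirichletMean q l ξ‖ ^ 2 : ℝ) : ℂ) =
      dirichletMean q l ξ * (starRingEnd ℂ) (dirichletMean q l ξ) := by
    rw [Complex.mul_conj, Complex.normSq_eq_norm_sq]
  rw [h1, dirichletMean, map_mul, map_sum, map_inv₀, Complex.conj_natCast, mul_mul_mul_comm,
    Finset.sum_mul_sum, ← mul_inv, ← sq]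
  congr 1
  refine Finset.sum_congr rfl fun r _ => Finset.sum_congr rfl fun s _ => ?_
  rw [← Complex.exp_conj, ← Complex.exp_add, ← Complex.exp_add]
  congr 1
  simp only [map_mul, map_sub, map_div₀, Complex.conj_I, Complex.conj_ofReal, map_ofNat,
    Complex.conj_natCast]
  push_cast
  ring

lemma sum_exp_fin (q : ℕ) [NeZero q] (u : ℤ) :
    ∑ l : Fin q, Complex.exp (-(2 * Real.pi * Complex.I * u * ((l : ℕ) / q : ℂ))) =
      if (u : ZMod q) = 0 then (q : ℂ) else 0 := by
  classical
  have h1 : ∀ l : Fin q, Complex.exp (-(2 * Real.pi * Complex.I * u * ((l : ℕ) / q : ℂ))) =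
      ZMod.stdAddChar (((l : ℕ) : ZMod q) * (-(u : ZMod q))) := by
    intro l
    have h2 : (((l : ℕ) : ZMod q) * (-(u : ZMod q))) = ((-(u * (l : ℕ)) : ℤ) : ZMod q) := by
      push_cast; ring
    rw [h2, ZMod.stdAddChar_coe]
    congr 1
    push_cast; ring
  rw [Finset.sum_congr rfl fun l _ => h1 l,
    ← sum_zmod_eq_sum_fin fun l : ZMod q => (ZMod.stdAddChar (l * (-(u : ZMod q))) : ℂ),
    AddChar.sum_mulShift _ (ZMod.isPrimitive_stdAddChar q), ZMod.card]
  simp only [neg_eq_zero, Nat.cast_ite, Nat.cast_zero]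

lemma fin_sub_cast_eq_zero {q : ℕ} (r s : Fin q) :
    ((((r : ℤ) - (s : ℤ) : ℤ) : ZMod q) = 0) ↔ s = r := by
  rw [ZMod.intCast_zmod_eq_zero_iff_dvd]
  constructor
  · intro h
    have h1 := Int.eq_zero_of_abs_lt_dvd h (by
      rw [abs_lt]; constructor <;> have := r.2 <;> have := s.2 <;> omega)
    exact Fin.ext (by omega)
  · rintro rfl; simp

lemma sum_norm_dirichletMean_sq (q : ℕ) [NeZero q] (ξ : ℝ) :
    ∑ l : Fin q, ‖dirichletMean q l ξ‖ ^ 2 = 1 := by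
  have hq : (q : ℂ) ≠ 0 := by exact_mod_cast NeZero.ne q
  have h : ((∑ l : Fin q, ‖dirichletMean q l ξ‖ ^ 2 : ℝ) : ℂ) = 1 := by
    push_cast
    have h0 : ∀ l : Fin q, ((‖dirichletMean q l ξ‖ : ℂ)) ^ 2 = _ := fun l => by
      have := dirichletMean_mul_conj q l ξ
      push_cast at this
      exact this
    rw [Finset.sum_congr rfl fun l _ => h0 l, ← Finset.mul_sum, Finset.sum_comm]
    have h1 : ∀ r : Fin q, ∑ l : Fin q, ∑ s : Fin q,
        Complex.exp (2 * Real.pi * Complex.I * (((r : ℕ) - (s : ℕ) : ℂ) * ξ)) *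
        Complex.exp (-(2 * Real.pi * Complex.I * ((r : ℕ) - (s : ℕ) : ℂ) * ((l : ℕ) / q : ℂ))) =
        q := by
      intro r
      rw [Finset.sum_comm]
      simp only [← Finset.mul_sum]
      have h2 : ∀ s : Fin q, ∑ l : Fin q,
          Complex.exp (-(2 * Real.pi * Complex.I * ((r : ℕ) - (s : ℕ) : ℂ) * ((l : ℕ) / q : ℂ))) =
          if s = r then (q : ℂ) else 0 := by
        intro s
        have := sum_exp_fin q ((r : ℤ) - (s : ℤ))
        simp only [fin_sub_cast_eq_zero] at this
        push_cast at this
        exact this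
      simp only [h2, mul_ite, mul_zero, Finset.sum_ite_eq', Finset.mem_univ, if_true]
      simp
    rw [Finset.sum_congr rfl fun r _ => h1 r]
    simp only [Finset.sum_const, Finset.card_univ, Fintype.card_fin, nsmul_eq_mul]
    field_simp
  exact_mod_cast h

lemma summable_norm_fejer (q a : ℕ) : Summable fun n => ‖fejer q a n‖ := by
  refine (summable_of_hasFiniteSupport (f := fejer q a) ?_).norm
  refine (Set.finite_Icc (-(q : ℤ)) q).subset fun n hn => ?_
  by_contra hcon
  refine hn ?_
  rw [fejer, Finset.sum_eq_zero, mul_zero]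
  intro r _
  refine Finset.sum_eq_zero fun s _ => if_neg ?_
  rintro rfl
  have := r.2
  have := s.2
  exact hcon ⟨by omega, by omega⟩

lemma symbol_fejer (q a : ℕ) [NeZero q] (ξ : ℝ) :
    symbol (fejer q a) ξ = ∑ l : Fin q, gaussSum2 q a ((l : ℕ) : ZMod q) *
      ((‖dirichletMean q l ξ‖ ^ 2 : ℝ) : ℂ) := by
  have h1 : symbol (fejer q a) ξ = ((q : ℂ) ^ 2)⁻¹ * ∑ r : Fin q, ∑ s : Fin q,
      Complex.exp (2 * Real.pi * Complex.I * (a * ((r : ℤ) - (s : ℤ) : ℤ) ^ 2 / q)) *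
      Complex.exp (2 * Real.pi * Complex.I * (((r : ℤ) - (s : ℤ) : ℤ) * ξ)) := by
    refine HasSum.tsum_eq ?_
    simp only [fejer, mul_assoc, Finset.sum_mul]
    refine HasSum.mul_left _ (hasSum_sum fun r _ => hasSum_sum fun s _ => ?_)
    simp only [ite_mul, zero_mul]
    have := hasSum_ite_eq ((r : ℤ) - (s : ℤ)) (Complex.exp (2 * (Real.pi *
      (Complex.I * (a * ((r : ℤ) - (s : ℤ) : ℤ) ^ 2 / q)))) *
      Complex.exp (2 * (Real.pi * (Complex.I * (((r : ℤ) - (s : ℤ) : ℤ) * ξ)))))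
    refine this.congr_fun ?_
    intro n
    split_ifs with h
    · rw [h]
    · rfl
  rw [h1]
  simp only [dirichletMean_mul_conj]
  simp only [← sum_gaussSum2_mul_exp, Finset.mul_sum, Finset.sum_mul]
  rw [Finset.sum_comm_cycle]
  refine Finset.sum_congr rfl fun l _ => Finset.sum_congr rfl fun r _ =>
    Finset.sum_congr rfl fun s _ => ?_
  ring

lemma norm_symbol_fejer_le {q a : ℕ} [NeZero q] (ha : a.Coprime q) (ξ : ℝ) :
    ‖symbol (fejer q a) ξ‖ ≤ √(2 / q) := by
  rw [symbol_fejer]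
  refine (norm_sum_le _ _).trans ?_
  calc _ ≤ ∑ l : Fin q, √(2 / q) * ‖dirichletMean q l ξ‖ ^ 2 := by
        refine Finset.sum_le_sum fun l _ => ?_
        rw [norm_mul, Complex.norm_real, Real.norm_of_nonneg (by positivity)]
        exact mul_le_mul_of_nonneg_right (norm_gaussSum2_le ha _) (by positivity)
    _ = √(2 / q) := by rw [← Finset.mul_sum, sum_norm_dirichletMean_sq, mul_one]

/-- Near the fraction `m / q` the symbol of `fejer` is the Gauss sum at `m`. -/
lemma norm_symbol_fejer_sub_le {q a : ℕ} [NeZero q] (ha : a.Coprime q) (ξ : ℝ) (m : ℤ) :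
    ‖symbol (fejer q a) ξ - gaussSum2 q a (m : ZMod q)‖ ≤ √(2 / q) * (26 * |q * ξ - m|) := by
  have hq : (0 : ℝ) < q := by exact_mod_cast Nat.pos_of_ne_zero (NeZero.ne q)
  have hqc : (q : ℂ) ≠ 0 := by exact_mod_cast NeZero.ne q
  have hq0 : (q : ℤ) ≠ 0 := by exact_mod_cast NeZero.ne q
  set l₀ : Fin q := ⟨(m % q).toNat, by
    have := Int.emod_lt_of_pos m (by omega : (0 : ℤ) < q)
    have := Int.emod_nonneg m hq0
    omega⟩ with hl₀
  have hl₀' : (((l₀ : ℕ) : ℤ)) = m % q := Int.toNat_of_nonneg (Int.emod_nonneg m hq0)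
  have hlm : ((l₀ : ℕ) : ZMod q) = (m : ZMod q) := by
    rw [← Int.cast_natCast, hl₀', ZMod.intCast_mod]
  set p : Fin q → ℝ := fun l => ‖dirichletMean q l ξ‖ ^ 2 with hp
  have hp0 : ∀ l, 0 ≤ p l := fun l => by positivity
  have hp1 : ∑ l, p l = 1 := sum_norm_dirichletMean_sq q ξ
  have h1 : symbol (fejer q a) ξ - gaussSum2 q a (m : ZMod q) =
      ∑ l : Fin q, (gaussSum2 q a ((l : ℕ) : ZMod q) - gaussSum2 q a (m : ZMod q)) * (p l : ℂ) := by
    simp only [sub_mul, Finset.sum_sub_distrib, ← Finset.mul_sum]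
    rw [← Complex.ofReal_sum, hp1, symbol_fejer]
    simp [hp]
  have h2 : ‖symbol (fejer q a) ξ - gaussSum2 q a (m : ZMod q)‖ ≤
      2 * √(2 / q) * (1 - p l₀) := by
    rw [h1, ← hp1, ← Finset.add_sum_erase _ _ (Finset.mem_univ l₀),
      ← Finset.add_sum_erase _ p (Finset.mem_univ l₀), hlm, sub_self, zero_mul, zero_add,
      add_sub_cancel_left, Finset.mul_sum]
    refine (norm_sum_le _ _).trans (Finset.sum_le_sum fun l _ => ?_)
    rw [norm_mul, Complex.norm_real, Real.norm_of_nonneg (hp0 l)]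
    refine mul_le_mul_of_nonneg_right ?_ (hp0 l)
    refine (norm_sub_le _ _).trans ?_
    linarith [norm_gaussSum2_le ha ((l : ℕ) : ZMod q), norm_gaussSum2_le ha (m : ZMod q)]
  set D := dirichletMean q l₀ ξ with hD
  have h3 : ‖D - 1‖ ≤ 2 * Real.pi * |q * ξ - m| := by
    have h4 : D - 1 = (q : ℂ)⁻¹ * ∑ r : Fin q,
        (Complex.exp (Complex.I * ((2 * Real.pi * ((r : ℕ) * ((q * ξ - m) / q)) : ℝ) : ℂ)) - 1) := by
      rw [Finset.sum_sub_distrib, mul_sub]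
      simp only [Finset.sum_const, Finset.card_univ, Fintype.card_fin, nsmul_eq_mul, mul_one]
      rw [inv_mul_cancel₀ hqc, hD, dirichletMean]
      congr 2
      refine Finset.sum_congr rfl fun r _ => ?_
      refine Complex.exp_eq_exp_iff_exists_int.2 ⟨(r : ℕ) * (m / q), ?_⟩
      have h5 : ((l₀ : ℕ) : ℂ) = (m : ℂ) - q * ((m / q : ℤ) : ℂ) := by
        have := Int.emod_add_mul_ediv m q
        have h6 : ((((l₀ : ℕ) : ℤ)) : ℂ) = ((m - q * (m / q) : ℤ) : ℂ) := by
          rw [hl₀']; congr 1; linarith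
        push_cast at h6
        exact h6
      push_cast
      rw [h5]
      field_simp
      ring
    rw [h4, norm_mul, norm_inv, Complex.norm_natCast]
    have h7 : ∀ r : Fin q, ‖Complex.exp (Complex.I *
        ((2 * Real.pi * ((r : ℕ) * ((q * ξ - m) / q)) : ℝ) : ℂ)) - 1‖ ≤
        2 * Real.pi * |q * ξ - m| := by
      intro r
      refine Real.norm_exp_I_mul_ofReal_sub_one_le.trans ?_
      have hr : ((r : ℕ) : ℝ) ≤ q := by exact_mod_cast r.2.le
      rw [Real.norm_eq_abs, abs_mul, abs_of_pos Real.two_pi_pos, abs_mul, abs_div,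
        abs_of_pos hq, Nat.abs_cast]
      refine mul_le_mul_of_nonneg_left ?_ Real.two_pi_pos.le
      rw [← mul_div_assoc, div_le_iff₀ hq, mul_comm]
      exact mul_le_mul_of_nonneg_left hr (abs_nonneg _)
    calc (q : ℝ)⁻¹ * _ ≤ (q : ℝ)⁻¹ * ∑ r : Fin q, 2 * Real.pi * |q * ξ - m| := by
          refine mul_le_mul_of_nonneg_left ?_ (by positivity)
          exact (norm_sum_le _ _).trans (Finset.sum_le_sum fun r _ => h7 r)
      _ = _ := by
          simp only [Finset.sum_const, Finset.card_univ, Fintype.card_fin, nsmul_eq_mul]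
          field_simp
  have h8 : 1 - p l₀ ≤ 2 * (2 * Real.pi * |q * ξ - m|) := by
    have h9 : 1 - ‖D‖ ≤ ‖D - 1‖ := by
      have := norm_sub_norm_le (1 : ℂ) D
      rw [norm_one, norm_sub_rev] at this
      exact this
    have h10 : p l₀ = ‖D‖ ^ 2 := rfl
    rw [h10]
    nlinarith [sq_nonneg (‖D‖ - 1)]
  have h11 : 0 ≤ √(2 / q : ℝ) := Real.sqrt_nonneg _
  have h12 : 2 * (2 * (2 * Real.pi * |q * ξ - m|)) ≤ 26 * |q * ξ - m| := by
    nlinarith [abs_nonneg (q * ξ - m), Real.pi_lt_d2]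
  calc _ ≤ 2 * √(2 / q) * (1 - p l₀) := h2
    _ ≤ 2 * √(2 / q) * (2 * (2 * Real.pi * |q * ξ - m|)) := by gcongr
    _ = √(2 / q) * (2 * (2 * (2 * Real.pi * |q * ξ - m|))) := by ring
    _ ≤ _ := mul_le_mul_of_nonneg_left h12 h11

lemma mul_exp_neg_le_one (s : ℝ) : s * Real.exp (-s) ≤ 1 := by
  rw [Real.exp_neg, ← div_eq_mul_inv, div_le_one (Real.exp_pos s)]
  linarith [Real.add_one_le_exp s]

lemma mul_exp_neg_sq_le {u K T : ℝ} (hK : 0 < K) (hT : 0 ≤ T) (hKT : K ≤ 5 * T ^ 2) :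
    u * Real.exp (-Real.pi * u ^ 2 / K) ≤ T := by
  refine (abs_le_of_sq_le_sq' ?_ hT).2
  have h1 := mul_exp_neg_le_one (2 * Real.pi * u ^ 2 / K)
  have h2 : (u * Real.exp (-Real.pi * u ^ 2 / K)) ^ 2 =
      K / (2 * Real.pi) * (2 * Real.pi * u ^ 2 / K * Real.exp (-(2 * Real.pi * u ^ 2 / K))) := by
    rw [mul_pow, ← Real.exp_nat_mul, ← mul_assoc]
    have := Real.pi_pos
    congr 1
    · field_simp
    · congr 1; push_cast; ring
  rw [h2]
  calc _ ≤ K / (2 * Real.pi) * 1 := mul_le_mul_of_nonneg_left h1 (by positivity)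
    _ ≤ T ^ 2 := by
      rw [mul_one, div_le_iff₀ (by positivity)]
      nlinarith [Real.pi_gt_three, sq_nonneg T]

lemma norm_chirpBump_sub_one_le (t : ℝ) {M s : ℝ} (hM : 0 ≤ M) :
    ‖chirpBump t M s - 1‖ ≤ 7 * (M * |s|) := by
  set w : ℂ := ((-(Real.pi * M ^ 2 * s ^ 2) : ℝ) : ℂ) * (chirpWidth t)⁻¹ with hw
  have hu : 0 ≤ M * |s| := by positivity
  have hpi := Real.pi_gt_three
  have hpi' := Real.pi_lt_d2
  have h1 : ‖w‖ ≤ Real.pi * (M * |s|) ^ 2 := by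
    rw [hw, norm_mul, Complex.norm_real, norm_neg, norm_inv, mul_pow, sq_abs, ← mul_assoc,
      Real.norm_of_nonneg (by positivity)]
    have h2 : 1 ≤ ‖chirpWidth t‖ := (le_max_left _ _).trans (le_norm_chirpWidth t)
    exact mul_le_of_le_one_right (by positivity) (inv_le_one_of_one_le₀ h2)
  by_cases h : Real.pi * (M * |s|) ^ 2 ≤ 1
  · have h3 := Complex.norm_exp_sub_one_le (h1.trans h)
    have h4 : M * |s| ≤ 1 := by nlinarith
    rw [chirpBump, ← hw]
    nlinarith
  · push Not at h
    have h3 : ‖chirpBump t M s‖ ≤ 1 := by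
      rw [norm_chirpBump]
      apply Real.exp_le_one_iff.2
      have : 0 ≤ Real.pi * (M ^ 2 / (1 + 4 * t ^ 2)) * s ^ 2 := by positivity
      linarith
    have h4 := norm_sub_le (chirpBump t M s) 1
    rw [norm_one] at h4
    have h5 : (1 : ℝ) / 3 ≤ M * |s| := by
      by_contra hcon
      push Not at hcon
      nlinarith
    nlinarith

/-- The symbol of the main term approximating the chirp. -/
def mainSymbol (q a : ℕ) (t N : ℝ) (ξ : ℝ) : ℂ :=
  chirpConst t N * symbol (fejer q a) ξ * symbol (coarse q (N / q)) ξ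

/-- The bounds satisfied by the symbols of a chirp and of its main term, in terms of the
distance `y` of `q * ξ` to the integers. -/
structure SymbolBounds (S P : ℂ) (E u T e : ℝ) : Prop where
  le₁ : ‖S‖ ≤ E
  le₂ : ‖P‖ ≤ E
  decay₁ : ‖S‖ * u ≤ E * T
  decay₂ : ‖P‖ * u ≤ E * T
  sub_le : ‖S - P‖ ≤ E * (u + e)

/-- The absolute constant in the symbol estimates. -/
def symbolCst : ℝ := 50 + 20 * zetaTwoInt

lemma symbolCst_pos : 0 < symbolCst := by
  have := zetaTwoInt_nonneg
  unfold symbolCst; positivity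

lemma SymbolBounds.of_approx {c S' G H g w h : ℂ} {A M R T y : ℝ} (hA0 : 0 ≤ A)
    (hT1 : 1 ≤ T) (hTM : T ≤ M) (hR : M * R = T) (hy2 : |y| ≤ 1 / 2)
    (hgA : ‖g‖ ≤ A) (hGA : ‖G‖ ≤ A)
    (hS1 : ‖S' - g * w‖ ≤ A * (10 * zetaTwoInt * R)) (hH1 : ‖H - h‖ ≤ 2 * zetaTwoInt * R)
    (hw1 : ‖w‖ ≤ 1) (hh1 : ‖h‖ ≤ 1) (hw2 : M * |y| * ‖w‖ ≤ T) (hh2 : M * |y| * ‖h‖ ≤ T)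
    (hwh : ‖w - h‖ ≤ 14 * (M * |y|)) (hG1 : ‖G - g‖ ≤ A * (26 * |y|)) :
    SymbolBounds (c * S') (c * (G * H)) (symbolCst * (‖c‖ * A)) (M * |y|) T R := by
  have hM0 : 0 < M := by linarith
  have hR0 : 0 < R := by
    by_contra hcon
    push Not at hcon
    nlinarith
  have hR1 : R ≤ 1 := by
    by_contra hcon
    push Not at hcon
    nlinarith
  have hy0 : 0 ≤ |y| := abs_nonneg y
  have hMR := hR
  have hcst : symbolCst = 50 + 20 * zetaTwoInt := rfl
  have hZ0 : 0 ≤ zetaTwoInt := zetaTwoInt_nonneg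
  generalize symbolCst = B₀ at *
  generalize zetaTwoInt = Z at *
  have hS2 : ‖S'‖ ≤ A * (‖w‖ + 10 * Z * R) := by
    calc ‖S'‖ = ‖(S' - g * w) + g * w‖ := by rw [sub_add_cancel]
      _ ≤ ‖S' - g * w‖ + ‖g‖ * ‖w‖ := by rw [← norm_mul]; exact norm_add_le _ _
      _ ≤ A * (10 * Z * R) + A * ‖w‖ := by gcongr
      _ = _ := by ring
  have hH2 : ‖H‖ ≤ ‖h‖ + 2 * Z * R := by
    calc ‖H‖ = ‖(H - h) + h‖ := by rw [sub_add_cancel]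
      _ ≤ _ := (norm_add_le _ _).trans (by linarith)
  have hGH : ‖G * H‖ ≤ A * (‖h‖ + 2 * Z * R) := by
    rw [norm_mul]; exact mul_le_mul hGA hH2 (norm_nonneg _) hA0
  have key : ∀ (V : ℂ) (B : ℝ), ‖V‖ ≤ A * B → B ≤ B₀ →
      ‖c * V‖ ≤ B₀ * (‖c‖ * A) := fun V B hV hB => by
    rw [norm_mul]
    calc ‖c‖ * ‖V‖ ≤ ‖c‖ * (A * B₀) := by
          gcongr; exact hV.trans (mul_le_mul_of_nonneg_left hB hA0)
      _ = _ := by ring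
  have key2 : ∀ (V : ℂ) (B : ℝ), ‖V‖ ≤ A * B → M * |y| * B ≤ B₀ * T →
      ‖c * V‖ * (M * |y|) ≤ B₀ * (‖c‖ * A) * T := fun V B hV hB => by
    rw [norm_mul]
    calc ‖c‖ * ‖V‖ * (M * |y|) ≤ ‖c‖ * (A * B) * (M * |y|) := by gcongr
      _ = ‖c‖ * A * (M * |y| * B) := by ring
      _ ≤ ‖c‖ * A * (B₀ * T) := by gcongr
      _ = _ := by ring
  have hZR : Z * R ≤ Z := mul_le_of_le_one_right hZ0 hR1
  have hyR : M * |y| * (Z * R) ≤ Z * T := by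
    calc M * |y| * (Z * R) = |y| * (Z * (M * R)) := by ring
      _ ≤ 1 * (Z * (M * R)) := by
        refine mul_le_mul_of_nonneg_right (by linarith) (by positivity)
      _ = Z * T := by rw [hMR, one_mul]
  have hZT : 0 ≤ Z * T := by positivity
  refine ⟨key _ _ hS2 (by rw [hcst]; linarith), key _ _ hGH (by rw [hcst]; linarith),
    key2 _ _ hS2 (by rw [hcst]; linarith), key2 _ _ hGH (by rw [hcst]; linarith), ?_⟩
  have hMy : |y| ≤ M * |y| := le_mul_of_one_le_left hy0 (by linarith)
  have hdiff : ‖S' - G * H‖ ≤ A * (40 * (M * |y|) + 12 * Z * R) := by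
    have e : S' - G * H = (S' - g * w) + g * (w - h) - (G - g) * h - G * (H - h) := by ring
    rw [e]
    have h1 : ‖g * (w - h)‖ ≤ A * (14 * (M * |y|)) := by
      rw [norm_mul]; exact mul_le_mul hgA hwh (norm_nonneg _) hA0
    have h2 : ‖(G - g) * h‖ ≤ A * (26 * (M * |y|)) := by
      rw [norm_mul]
      calc _ ≤ A * (26 * |y|) * 1 := mul_le_mul hG1 hh1 (norm_nonneg _) (by positivity)
        _ ≤ _ := by rw [mul_one]; gcongr
    have h3 : ‖G * (H - h)‖ ≤ A * (2 * Z * R) := by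
      rw [norm_mul]; exact mul_le_mul hGA hH1 (norm_nonneg _) hA0
    have h4 := norm_sub_le ((S' - g * w) + g * (w - h) - (G - g) * h) (G * (H - h))
    have h5 := norm_sub_le ((S' - g * w) + g * (w - h)) ((G - g) * h)
    have h6 := norm_add_le (S' - g * w) (g * (w - h))
    linarith
  rw [← mul_sub, norm_mul]
  have hfin : 40 * (M * |y|) + 12 * Z * R ≤ B₀ * (M * |y| + R) := by
    rw [hcst]
    have : 0 ≤ M * |y| := by positivity
    nlinarith [mul_nonneg hZ0 this, mul_nonneg hZ0 hR0.le]
  calc ‖c‖ * ‖S' - G * H‖ ≤ ‖c‖ * (A * (B₀ * (M * |y| + R))) := by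
        gcongr; exact hdiff.trans (mul_le_mul_of_nonneg_left hfin hA0)
    _ = _ := by ring

lemma symbolBounds {q a : ℕ} [NeZero q] (ha : a.Coprime q) {t N : ℝ}
    (hN : q * max 1 |t| ≤ N) (ξ : ℝ) :
    SymbolBounds (symbol (chirp q a t N) ξ) (mainSymbol q a t N ξ)
      (symbolCst * (‖chirpConst t N‖ * √(2 / q))) (N / q * |q * ξ - round (q * ξ)|) (max 1 |t|)
      (max 1 |t| / (N / q)) := by
  have hq : (0 : ℝ) < q := by exact_mod_cast Nat.pos_of_ne_zero (NeZero.ne q)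
  set T := max 1 |t| with hT
  set M := N / q with hM
  set x := q * ξ with hx
  set y := x - round x with hy
  set A : ℝ := √(2 / q) with hA
  set Z := zetaTwoInt with hZ
  have hZ0 : 0 ≤ Z := zetaTwoInt_nonneg
  have hA0 : 0 ≤ A := Real.sqrt_nonneg _
  have hT1 : 1 ≤ T := le_max_left _ _
  have hTM : T ≤ M := by rw [hM, le_div_iff₀ hq, mul_comm]; exact hN
  have hM0 : 0 < M := by linarith
  have hN0 : 0 < N := by
    have : N = M * q := by rw [hM]; field_simp
    rw [this]; positivity
  have hy2 : |y| ≤ 1 / 2 := abs_sub_round x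
  have hy0 : 0 ≤ |y| := abs_nonneg y
  have hK : 1 + 4 * t ^ 2 ≤ 5 * T ^ 2 := by
    have : t ^ 2 ≤ T ^ 2 := by
      rw [← sq_abs t]; exact pow_le_pow_left₀ (abs_nonneg _) (le_max_right _ _) 2
    nlinarith
  set c := chirpConst t N with hc
  set R : ℝ := T / M with hR
  have hR0 : 0 < R := by positivity
  have hR1 : R ≤ 1 := (div_le_one hM0).2 hTM
  have hMR : M * R = T := by rw [hR]; field_simp
  have hT2 : (T / M) ^ 2 ≤ R := by
    rw [← hR]; nlinarith
  set g := gaussSum2 q a ((round x : ℤ) : ZMod q) with hg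
  have hgA : ‖g‖ ≤ A := norm_gaussSum2_le ha _
  set w := chirpBump t M (round x - x) with hw
  set h := chirpBump 0 M (round x - x) with hh
  set S' := ∑' m : ℤ, gaussSum2 q a (m : ZMod q) * chirpBump t M (m - x) with hS'
  set H := symbol (coarse q M) ξ with hH
  set G := symbol (fejer q a) ξ with hG
  have hGA : ‖G‖ ≤ A := norm_symbol_fejer_le ha ξ
  have hSeq : symbol (chirp q a t N) ξ = c * S' := symbol_chirp ha hN0 ξ
  have hS1 : ‖S' - g * w‖ ≤ A * (10 * Z * R) := by
    refine (tsum_sub_central (b := M ^ 2 / (1 + 4 * t ^ 2)) (by positivity) x hA0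
      fun m => ?_).2.trans ?_
    · rw [norm_mul, norm_chirpBump]
      exact mul_le_mul_of_nonneg_right (norm_gaussSum2_le ha _) (Real.exp_pos _).le
    · refine mul_le_mul_of_nonneg_left ?_ hA0
      have h1 : 2 / (M ^ 2 / (1 + 4 * t ^ 2)) ≤ 10 * R := by
        calc 2 / (M ^ 2 / (1 + 4 * t ^ 2)) = 2 * (1 + 4 * t ^ 2) / M ^ 2 := by field_simp
          _ ≤ 2 * (5 * T ^ 2) / M ^ 2 := by gcongr
          _ = 10 * (T / M) ^ 2 := by ring
          _ ≤ 10 * R := by linarith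
      calc _ ≤ 10 * R * Z := mul_le_mul_of_nonneg_right h1 hZ0
        _ = _ := by ring
  have hH1 : ‖H - h‖ ≤ 2 * Z * R := by
    rw [hH, symbol_coarse q hM0]
    refine (tsum_sub_central (b := M ^ 2) (by positivity) x zero_le_one fun m => ?_).2.trans ?_
    · rw [norm_chirpBump, one_mul]
      simp only [ne_eq, OfNat.ofNat_ne_zero, not_false_eq_true, zero_pow, mul_zero, add_zero,
        div_one, hx, le_refl]
    · have h1 : 2 / M ^ 2 ≤ 2 * R := by
        calc 2 / M ^ 2 ≤ 2 * T ^ 2 / M ^ 2 := by gcongr; nlinarith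
          _ = 2 * (T / M) ^ 2 := by ring
          _ ≤ _ := by linarith
      rw [one_mul]
      calc _ ≤ 2 * R * Z := mul_le_mul_of_nonneg_right h1 hZ0
        _ = _ := by ring
  have hbw : ‖w‖ = Real.exp (-Real.pi * (M * |y|) ^ 2 / (1 + 4 * t ^ 2)) := by
    rw [hw, norm_chirpBump, mul_pow, sq_abs, hy]; congr 1; ring
  have hbh : ‖h‖ = Real.exp (-Real.pi * (M * |y|) ^ 2 / 1) := by
    rw [hh, norm_chirpBump, mul_pow, sq_abs, hy]; congr 1; ring
  have hw1 : ‖w‖ ≤ 1 := by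
    rw [hbw]; apply Real.exp_le_one_iff.2
    rw [neg_mul, neg_div, neg_nonpos]; positivity
  have hh1 : ‖h‖ ≤ 1 := by
    rw [hbh]; apply Real.exp_le_one_iff.2
    rw [neg_mul, neg_div, neg_nonpos]; positivity
  have hw2 : M * |y| * ‖w‖ ≤ T := by
    rw [hbw]; exact mul_exp_neg_sq_le (by positivity) (by linarith) hK
  have hh2 : M * |y| * ‖h‖ ≤ T := by
    rw [hbh]; exact mul_exp_neg_sq_le one_pos (by linarith) (by nlinarith)
  have hPeq : mainSymbol q a t N ξ = c * (G * H) := by rw [mainSymbol, ← mul_assoc]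
  have hsym : |((round x : ℤ) : ℝ) - x| = |y| := by rw [hy, abs_sub_comm]
  have hwh : ‖w - h‖ ≤ 14 * (M * |y|) := by
    have h1 := norm_chirpBump_sub_one_le t (s := round x - x) hM0.le
    have h2 := norm_chirpBump_sub_one_le 0 (s := round x - x) hM0.le
    rw [hsym] at h1 h2
    have h3 := norm_sub_le (w - 1) (h - 1)
    rw [sub_sub_sub_cancel_right] at h3
    linarith
  rw [hSeq, hPeq]
  exact SymbolBounds.of_approx hA0 hT1 hTM hMR hy2 hgA hGA hS1 hH1 hw1 hh1 hw2 hh2 hwh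
    (norm_symbol_fejer_sub_le ha ξ _)

section

open MeasureTheory UnitAddTorus

lemma tendsto_orthonormal_norm_sq {ι E : Type*} [NormedAddCommGroup E] [InnerProductSpace ℂ E]
    {e : ι → E} (he : Orthonormal ℂ e) {a : ι → ℂ} {g : E} (hg : HasSum (fun n => a n • e n) g) :
    HasSum (fun n => ‖a n‖ ^ 2) (‖g‖ ^ 2) := by
  have h1 : Filter.Tendsto (fun s : Finset ι => ‖∑ n ∈ s, a n • e n‖ ^ 2) Filter.atTop
      (nhds (‖g‖ ^ 2)) := (hg.norm).pow 2
  refine h1.congr fun s => ?_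
  have h2 := he.inner_sum a a s
  have h3 := inner_self_eq_norm_sq_to_K (𝕜 := ℂ) (∑ n ∈ s, a n • e n)
  rw [h2] at h3
  have h4 : ∀ z : ℂ, (starRingEnd ℂ) z * z = ((‖z‖ ^ 2 : ℝ) : ℂ) := fun z => by
    rw [Complex.conj_mul']; push_cast; rfl
  simp only [h4] at h3
  have h5 : ((∑ n ∈ s, ‖a n‖ ^ 2 : ℝ) : ℂ) = ((‖∑ n ∈ s, a n • e n‖ ^ 2 : ℝ) : ℂ) := by
    push_cast at h3 ⊢; exact h3
  exact_mod_cast h5.symm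

/-- The normalized Haar measure on the torus. -/
def torusMeasure (d : ℕ) : Measure (UnitAddTorus (Fin d)) :=
  Measure.pi fun _ => AddCircle.haarAddCircle

instance (d : ℕ) : IsProbabilityMeasure (torusMeasure d) := by
  unfold torusMeasure; infer_instance

/-- The Fourier series with coefficients `κ`. -/
def torusHat {d : ℕ} (κ : (Fin d → ℤ) → ℂ) (ξ : UnitAddTorus (Fin d)) : ℂ :=
  ∑' u, κ u * mFourier u ξ

lemma norm_mFourier_apply {d : ℕ} (u : Fin d → ℤ) (ξ : UnitAddTorus (Fin d)) :
    ‖mFourier u ξ‖ = 1 := by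
  simp only [mFourier, ContinuousMap.coe_mk, norm_prod, fourier_apply, Circle.norm_coe,
    Finset.prod_const_one]

lemma hasSum_torusHat {d : ℕ} {κ : (Fin d → ℤ) → ℂ} (hκ : Summable fun u => ‖κ u‖) :
    ∃ g : C(UnitAddTorus (Fin d), ℂ), HasSum (fun u => κ u • mFourier u) g ∧ ⇑g = torusHat κ := by
  have h : Summable fun u => κ u • mFourier u := by
    refine Summable.of_norm (hκ.congr fun u => ?_)
    rw [norm_smul, mFourier_norm, mul_one]
  refine ⟨_, h.hasSum, funext fun ξ => ?_⟩
  exact (ContinuousMap.tsum_apply h ξ).symm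

lemma continuous_torusHat {d : ℕ} {κ : (Fin d → ℤ) → ℂ} (hκ : Summable fun u => ‖κ u‖) :
    Continuous (torusHat κ) := by
  obtain ⟨g, -, hg⟩ := hasSum_torusHat hκ
  rw [← hg]; exact g.continuous

lemma lintegral_torusHat_sq {d : ℕ} {κ : (Fin d → ℤ) → ℂ} (hκ : Summable fun u => ‖κ u‖) :
    ∫⁻ ξ, ‖torusHat κ ξ‖ₑ ^ 2 ∂torusMeasure d = ∑' u, ‖κ u‖ₑ ^ 2 := by
  obtain ⟨g, hg, hgeq⟩ := hasSum_torusHat hκ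
  have horth : Orthonormal ℂ fun u : Fin d → ℤ =>
      ContinuousMap.toLp (E := ℂ) 2 (torusMeasure d) ℂ (mFourier u) :=
    UnitAddTorus.orthonormal_mFourier
  have h1 := hg.mapL (ContinuousMap.toLp (E := ℂ) 2 (torusMeasure d) ℂ)
  simp only [map_smul] at h1
  have h2 := tendsto_orthonormal_norm_sq horth h1
  have h3 : ‖ContinuousMap.toLp (E := ℂ) 2 (torusMeasure d) ℂ g‖ₑ ^ 2 =
      ∫⁻ ξ, ‖g ξ‖ₑ ^ 2 ∂torusMeasure d := by
    rw [Lp.enorm_def, eLpNorm_congr_ae (ContinuousMap.coeFn_toLp (𝕜 := ℂ) (torusMeasure d) g),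
      eLpNorm_eq_lintegral_rpow_enorm_toReal (by norm_num) (by norm_num), ← ENNReal.rpow_natCast,
      ← ENNReal.rpow_mul]
    norm_num
  rw [← hgeq, ← h3]
  have h4 : ∀ z : ℂ, ‖z‖ₑ ^ 2 = ENNReal.ofReal (‖z‖ ^ 2) := fun z => by
    rw [ENNReal.ofReal_pow (norm_nonneg _), ofReal_norm]
  simp only [h4]
  rw [← ENNReal.ofReal_tsum_of_nonneg (fun _ => by positivity) h2.summable, h2.tsum_eq,
    ENNReal.ofReal_pow (norm_nonneg _), ofReal_norm]

/-- Convolution on `ℤ^d`. -/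
def conv {d : ℕ} (κ f : (Fin d → ℤ) → ℂ) (x : Fin d → ℤ) : ℂ := ∑' y, κ (x - y) * f y

/-- The shear `(x, y) ↦ (x - y, y)`. -/
def shearEquiv (G : Type*) [AddCommGroup G] : G × G ≃ G × G where
  toFun p := (p.1 - p.2, p.2)
  invFun p := (p.1 + p.2, p.2)
  left_inv p := by simp
  right_inv p := by simp

lemma summable_norm_shear {d : ℕ} {κ f : (Fin d → ℤ) → ℂ} (hκ : Summable fun u => ‖κ u‖)
    (hf : Summable fun u => ‖f u‖) :
    Summable fun p : (Fin d → ℤ) × (Fin d → ℤ) => ‖κ (p.1 - p.2) * f p.2‖ := by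
  have h := (Summable.mul_norm hκ hf)
  exact (shearEquiv (Fin d → ℤ)).summable_iff.2 h

lemma summable_norm_conv {d : ℕ} {κ f : (Fin d → ℤ) → ℂ} (hκ : Summable fun u => ‖κ u‖)
    (hf : Summable fun u => ‖f u‖) : Summable fun x => ‖conv κ f x‖ := by
  have h := summable_norm_shear hκ hf
  refine Summable.of_nonneg_of_le (fun _ => norm_nonneg _) (fun x => ?_) h.prod
  exact norm_tsum_le_tsum_norm (h.prod_factor x)

lemma torusHat_conv {d : ℕ} {κ f : (Fin d → ℤ) → ℂ} (hκ : Summable fun u => ‖κ u‖)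
    (hf : Summable fun u => ‖f u‖) (ξ : UnitAddTorus (Fin d)) :
    torusHat (conv κ f) ξ = torusHat κ ξ * torusHat f ξ := by
  have h1 : Summable fun u => ‖κ u * mFourier u ξ‖ := by
    simpa only [norm_mul, norm_mFourier_apply, mul_one] using hκ
  have h2 : Summable fun u => ‖f u * mFourier u ξ‖ := by
    simpa only [norm_mul, norm_mFourier_apply, mul_one] using hf
  have h3 : Summable fun p : (Fin d → ℤ) × (Fin d → ℤ) =>
      κ (p.1 - p.2) * f p.2 * mFourier p.1 ξ := by
    refine Summable.of_norm ((summable_norm_shear hκ hf).congr fun p => ?_)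
    rw [norm_mul _ (mFourier _ _), norm_mFourier_apply, mul_one]
  rw [torusHat, torusHat, torusHat, tsum_mul_tsum_of_summable_norm h1 h2]
  rw [← (shearEquiv (Fin d → ℤ)).tsum_eq]
  calc _ = ∑' x, ∑' y, κ (x - y) * f y * mFourier x ξ :=
        tsum_congr fun x => by rw [conv, tsum_mul_right]
    _ = _ := by
      rw [← h3.tsum_prod]
      refine tsum_congr fun p => ?_
      have : mFourier p.1 ξ = mFourier (p.1 - p.2) ξ * mFourier p.2 ξ := by
        rw [← mFourier_add, sub_add_cancel]
      rw [this]
      simp only [shearEquiv, Equiv.coe_fn_mk]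
      ring

lemma torusHat_sub {d : ℕ} {κ κ' : (Fin d → ℤ) → ℂ} (hκ : Summable fun u => ‖κ u‖)
    (hκ' : Summable fun u => ‖κ' u‖) (ξ : UnitAddTorus (Fin d)) :
    torusHat (κ - κ') ξ = torusHat κ ξ - torusHat κ' ξ := by
  have hs : ∀ {g : (Fin d → ℤ) → ℂ}, Summable (fun u => ‖g u‖) →
      Summable fun u => g u * mFourier u ξ := fun hg =>
    Summable.of_norm (by simpa only [norm_mul, norm_mFourier_apply, mul_one] using hg)
  simp only [torusHat, Pi.sub_apply, sub_mul]
  exact (hs hκ).tsum_sub (hs hκ')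

lemma sum_tsum_le_of_torusHat_le {d : ℕ} {ι : Type*} (K : Finset ι) {g : ι → (Fin d → ℤ) → ℂ}
    (hg : ∀ k ∈ K, Summable fun u => ‖g k u‖) {f : (Fin d → ℤ) → ℂ}
    (hf : Summable fun u => ‖f u‖) {m : ι → UnitAddTorus (Fin d) → ℂ}
    (hm : ∀ k ∈ K, ∀ ξ, torusHat (g k) ξ = m k ξ * torusHat f ξ) {B : ℝ≥0∞}
    (hB : ∀ ξ, ∑ k ∈ K, ‖m k ξ‖ₑ ^ 2 ≤ B) :
    ∑ k ∈ K, ∑' x, ‖g k x‖ₑ ^ 2 ≤ B * ∑' x, ‖f x‖ₑ ^ 2 := by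
  calc ∑ k ∈ K, ∑' x, ‖g k x‖ₑ ^ 2
      = ∑ k ∈ K, ∫⁻ ξ, ‖torusHat (g k) ξ‖ₑ ^ 2 ∂torusMeasure d :=
        Finset.sum_congr rfl fun k hk => (lintegral_torusHat_sq (hg k hk)).symm
    _ = ∫⁻ ξ, ∑ k ∈ K, ‖torusHat (g k) ξ‖ₑ ^ 2 ∂torusMeasure d := by
        rw [lintegral_finsetSum']
        exact fun k hk =>
          ((continuous_torusHat (hg k hk)).enorm.measurable.pow_const 2).aemeasurable
    _ ≤ ∫⁻ ξ, B * ‖torusHat f ξ‖ₑ ^ 2 ∂torusMeasure d := by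
        refine lintegral_mono fun ξ => ?_
        calc _ = (∑ k ∈ K, ‖m k ξ‖ₑ ^ 2) * ‖torusHat f ξ‖ₑ ^ 2 := by
              rw [Finset.sum_mul]
              exact Finset.sum_congr rfl fun k hk => by rw [hm k hk, enorm_mul, mul_pow]
          _ ≤ _ := by gcongr; exact hB ξ
    _ = _ := by
        rw [lintegral_const_mul, lintegral_torusHat_sq hf]
        exact (continuous_torusHat hf).enorm.measurable.pow_const 2

/-- The tensor product of kernels on `ℤ`. -/
def tensor {d : ℕ} (κ : ℤ → ℂ) (u : Fin d → ℤ) : ℂ := ∏ i, κ (u i)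

lemma summable_tsum_prod {d : ℕ} {F : Fin d → ℤ → ℂ} (hF : ∀ i, Summable fun n => ‖F i n‖) :
    (Summable fun u : Fin d → ℤ => ‖∏ i, F i (u i)‖) ∧
      ∑' u : Fin d → ℤ, ∏ i, F i (u i) = ∏ i, ∑' n, F i n := by
  induction d with
  | zero => exact ⟨(hasSum_fintype _).summable, by simp⟩
  | succ d ih =>
    obtain ⟨h1, h2⟩ := ih fun i : Fin d => hF i.succ
    have e : ∀ p : ℤ × (Fin d → ℤ), ∏ i, F i (Fin.consEquiv (fun _ => ℤ) p i) =
        F 0 p.1 * ∏ i : Fin d, F i.succ (p.2 i) := fun p => by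
      rw [Fin.prod_univ_succ]; rfl
    constructor
    · rw [← (Fin.consEquiv fun _ => ℤ).summable_iff]
      refine (Summable.mul_norm (hF 0) h1).congr fun p => ?_
      rw [Function.comp_apply, e p]
    · rw [← (Fin.consEquiv fun _ => ℤ).tsum_eq, Fin.prod_univ_succ, ← h2,
        tsum_mul_tsum_of_summable_norm (hF 0) h1]
      exact tsum_congr e

lemma summable_norm_tensor {d : ℕ} {κ : ℤ → ℂ} (hκ : Summable fun n => ‖κ n‖) :
    Summable fun u : Fin d → ℤ => ‖tensor κ u‖ :=
  (summable_tsum_prod fun _ => hκ).1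

lemma torusHat_tensor {d : ℕ} {κ : ℤ → ℂ} (hκ : Summable fun n => ‖κ n‖) (ξ : Fin d → ℝ) :
    torusHat (tensor κ) (fun i => (ξ i : UnitAddCircle)) = ∏ i, symbol κ (ξ i) := by
  have e : ∀ (n : ℤ) (x : ℝ), fourier n (x : UnitAddCircle) =
      Complex.exp (2 * Real.pi * Complex.I * n * x) := fun n x => by
    rw [fourier_coe_apply]; simp
  have h : ∀ i, Summable fun n : ℤ =>
      ‖κ n * Complex.exp (2 * Real.pi * Complex.I * n * ξ i)‖ := fun i => by
    simpa only [norm_mul, norm_exp_two_pi_mul, mul_one] using hκ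
  simp only [symbol]
  rw [← (summable_tsum_prod h).2, torusHat]
  refine tsum_congr fun u => ?_
  rw [tensor, Finset.prod_mul_distrib]
  congr 1
  change ∏ i, fourier (u i) (ξ i : UnitAddCircle) = _
  exact Finset.prod_congr rfl fun i _ => e _ _

lemma exists_real_rep {d : ℕ} (ξ : UnitAddTorus (Fin d)) :
    ∃ x : Fin d → ℝ, ξ = fun i => (x i : UnitAddCircle) := by
  choose x hx using fun i => QuotientAddGroup.mk_surjective (ξ i)
  exact ⟨x, funext fun i => (hx i).symm⟩

lemma SymbolBounds.mono {S P : ℂ} {E E' u T e : ℝ} (h : SymbolBounds S P E u T e) (hE : E ≤ E')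
    (hu : 0 ≤ u) (hT : 0 ≤ T) (he : 0 ≤ e) : SymbolBounds S P E' u T e :=
  ⟨h.le₁.trans hE, h.le₂.trans hE, h.decay₁.trans (by gcongr), h.decay₂.trans (by gcongr),
    h.sub_le.trans (by gcongr)⟩

lemma norm_prod_sub_prod_le {ι : Type*} (s : Finset ι) {S P : ι → ℂ} {E δ : ℝ} (hE : 0 ≤ E)
    (hS : ∀ i, ‖S i‖ ≤ E) (hP : ∀ i, ‖P i‖ ≤ E) (hSP : ∀ i ∈ s, ‖S i - P i‖ ≤ E * δ) :
    ‖∏ i ∈ s, S i - ∏ i ∈ s, P i‖ ≤ s.card * E ^ s.card * δ := by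
  classical
  induction s using Finset.induction_on with
  | empty => simp
  | insert a s ha ih =>
    rw [Finset.prod_insert ha, Finset.prod_insert ha, Finset.card_insert_of_notMem ha]
    have h1 := ih fun i hi => hSP i (Finset.mem_insert_of_mem hi)
    have h2 := hSP a (Finset.mem_insert_self a s)
    have h3 : ‖∏ i ∈ s, S i‖ ≤ E ^ s.card := by
      rw [norm_prod, ← Finset.prod_const]
      exact Finset.prod_le_prod (fun i _ => norm_nonneg _) fun i _ => hS i
    have e : S a * ∏ i ∈ s, S i - P a * ∏ i ∈ s, P i =
        (S a - P a) * ∏ i ∈ s, S i + P a * (∏ i ∈ s, S i - ∏ i ∈ s, P i) := by ring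
    rw [e]
    calc _ ≤ ‖S a - P a‖ * ‖∏ i ∈ s, S i‖ + ‖P a‖ * ‖∏ i ∈ s, S i - ∏ i ∈ s, P i‖ := by
          rw [← norm_mul, ← norm_mul]; exact norm_add_le _ _
      _ ≤ E * δ * E ^ s.card + E * (s.card * E ^ s.card * δ) :=
          add_le_add (mul_le_mul h2 h3 (norm_nonneg _) ((norm_nonneg _).trans h2))
            (mul_le_mul (hP a) h1 (norm_nonneg _) hE)
      _ = _ := by push_cast; ring

lemma SymbolBounds.prod {d : ℕ} {S P : Fin d → ℂ} {E T e : ℝ} {u : Fin d → ℝ} (hE : 0 ≤ E)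
    (hT : 0 ≤ T) (h : ∀ i, SymbolBounds (S i) (P i) E (u i) T e) {i₀ : Fin d}
    (hu : ∀ i, u i ≤ u i₀) :
    SymbolBounds (∏ i, S i) (∏ i, P i) (d * E ^ d) (u i₀) T e := by
  classical
  have hd : (1 : ℝ) ≤ d := by exact_mod_cast Fin.pos i₀
  have hEd : E ^ d ≤ d * E ^ d := le_mul_of_one_le_left (by positivity) hd
  have bound : ∀ {Q : Fin d → ℂ}, (∀ i, ‖Q i‖ ≤ E) → ‖∏ i, Q i‖ ≤ d * E ^ d := fun hQ => by
    refine le_trans ?_ hEd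
    rw [norm_prod]
    calc _ ≤ ∏ _i : Fin d, E := Finset.prod_le_prod (fun i _ => norm_nonneg _) fun i _ => hQ i
      _ = _ := by simp
  have decay : ∀ {Q : Fin d → ℂ}, (∀ i, ‖Q i‖ ≤ E) → ‖Q i₀‖ * u i₀ ≤ E * T →
      ‖∏ i, Q i‖ * u i₀ ≤ d * E ^ d * T := fun {Q} hQ h₀ => by
    refine le_trans ?_ (mul_le_mul_of_nonneg_right hEd hT)
    rw [norm_prod, ← Finset.mul_prod_erase _ _ (Finset.mem_univ i₀)]
    have h1 : ∏ i ∈ Finset.univ.erase i₀, ‖Q i‖ ≤ E ^ (d - 1) := by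
      calc _ ≤ ∏ _i ∈ Finset.univ.erase i₀, E :=
            Finset.prod_le_prod (fun i _ => norm_nonneg _) fun i _ => hQ i
        _ = _ := by simp
    calc _ = (‖Q i₀‖ * u i₀) * ∏ i ∈ Finset.univ.erase i₀, ‖Q i‖ := by ring
      _ ≤ (E * T) * E ^ (d - 1) :=
        mul_le_mul h₀ h1 (Finset.prod_nonneg fun _ _ => norm_nonneg _) (by positivity)
      _ = E ^ (d - 1 + 1) * T := by ring
      _ = _ := by rw [Nat.sub_add_cancel (Fin.pos i₀)]
  refine ⟨bound fun i => (h i).le₁, bound fun i => (h i).le₂,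
    decay (fun i => (h i).le₁) (h i₀).decay₁, decay (fun i => (h i).le₂) (h i₀).decay₂, ?_⟩
  have := norm_prod_sub_prod_le (δ := u i₀ + e) Finset.univ hE (fun i => (h i).le₁)
    (fun i => (h i).le₂) fun i _ => (h i).sub_le.trans (by gcongr; exact hu i)
  simpa using this

lemma min_inv_sq_le {x : ℝ} (hx : 0 ≤ x) :
    min x x⁻¹ ^ 2 ≤ 10 / 3 * ((2 * x) ^ 2 / (1 + (2 * x) ^ 2) - x ^ 2 / (1 + x ^ 2)) := by
  rcases hx.eq_or_lt with rfl | hx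
  · simp
  have e : (2 * x) ^ 2 / (1 + (2 * x) ^ 2) - x ^ 2 / (1 + x ^ 2) =
      3 * x ^ 2 / ((1 + 4 * x ^ 2) * (1 + x ^ 2)) := by field_simp; ring
  rw [e]
  rcases le_total x 1 with h | h
  · have h1 : min x x⁻¹ ^ 2 ≤ x ^ 2 := by gcongr; exact min_le_left _ _
    refine h1.trans ?_
    have h2 : x ^ 2 ≤ 1 := pow_le_one₀ hx.le h
    rw [mul_div_assoc', le_div_iff₀ (by positivity)]
    have : (1 + 4 * x ^ 2) * (1 + x ^ 2) ≤ 10 := by nlinarith [sq_nonneg x]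
    nlinarith [sq_nonneg x]
  · have h1 : min x x⁻¹ ^ 2 ≤ x⁻¹ ^ 2 := by gcongr; exact min_le_right _ _
    refine h1.trans ?_
    have h2 : 1 ≤ x ^ 2 := one_le_pow₀ h
    rw [mul_div_assoc', le_div_iff₀ (by positivity), inv_pow, inv_mul_le_iff₀ (by positivity)]
    nlinarith [sq_nonneg x]

lemma sum_min_inv_sq_le (K : Finset ℕ) {r : ℝ} (hr : 0 ≤ r) :
    ∑ k ∈ K, min (2 ^ k * r) (2 ^ k * r)⁻¹ ^ 2 ≤ 4 := by
  obtain ⟨n, hn⟩ := K.exists_nat_subset_range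
  set φ : ℕ → ℝ := fun k => (2 ^ k * r) ^ 2 / (1 + (2 ^ k * r) ^ 2) with hφ
  have hφ0 : ∀ k, 0 ≤ φ k := fun k => by positivity
  have hφ1 : ∀ k, φ k ≤ 1 := fun k => (div_le_one (by positivity)).2 (by linarith)
  calc _ ≤ ∑ k ∈ Finset.range n, min (2 ^ k * r) (2 ^ k * r)⁻¹ ^ 2 :=
        Finset.sum_le_sum_of_subset_of_nonneg hn fun _ _ _ => sq_nonneg _
    _ ≤ ∑ k ∈ Finset.range n, 10 / 3 * (φ (k + 1) - φ k) := by
        refine Finset.sum_le_sum fun k _ => (min_inv_sq_le (by positivity)).trans (le_of_eq ?_)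
        simp only [hφ, pow_succ']
        ring_nf
    _ = 10 / 3 * (φ n - φ 0) := by rw [← Finset.mul_sum, Finset.sum_range_sub]
    _ ≤ 4 := by linarith [hφ0 0, hφ1 n]

lemma sum_sq_le_of_symbolBounds (K : Finset ℕ) {S P : ℕ → ℂ} {E q Y T : ℝ}
    (hq : 0 < q) (hY : 0 ≤ Y) (hT : 1 ≤ T) (hK : ∀ k ∈ K, q * T ≤ 2 ^ k)
    (h : ∀ k ∈ K, SymbolBounds (S k) (P k) E (2 ^ k / q * Y) T (T / (2 ^ k / q))) :
    ∑ k ∈ K, ‖S k - P k‖ ^ 2 ≤ 64 * E ^ 2 * T := by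
  set s := √T with hs
  have hs2 : s ^ 2 = T := Real.sq_sqrt (by linarith)
  have hs0 : 0 < s := Real.sqrt_pos.2 (by linarith)
  have key : ∀ k ∈ K, ‖S k - P k‖ ^ 2 ≤ 8 * E ^ 2 * T *
      (min (2 ^ k * (1 / (q * T))) (2 ^ k * (1 / (q * T)))⁻¹ ^ 2 +
        min (2 ^ k * (Y / (q * s))) (2 ^ k * (Y / (q * s)))⁻¹ ^ 2) := fun k hk => by
    set D := ‖S k - P k‖ with hD
    have hD0 : 0 ≤ D := norm_nonneg _
    set M : ℝ := 2 ^ k / q with hM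
    have hM0 : 0 < M := by positivity
    have hMT : T ≤ M := by rw [hM, le_div_iff₀ hq, mul_comm]; exact hK k hk
    have e1 : (2 : ℝ) ^ k * (1 / (q * T)) = M / T := by rw [hM]; field_simp
    have e2 : (2 : ℝ) ^ k * (Y / (q * s)) = M * Y / s := by rw [hM]; field_simp
    have hT0 : 0 < T := by linarith
    have hTM1 : T / M ≤ 1 := (div_le_one hM0).2 hMT
    rw [e1, e2, inv_div, inv_div, min_eq_right (hTM1.trans ((one_le_div hT0).2 hMT))]
    have b1 : D ≤ E * (M * Y + T / M) := (h k hk).sub_le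
    have b2 : D * (M * Y) ≤ 2 * E * T := by
      have := norm_sub_le (S k) (P k)
      have h1 := (h k hk).decay₁
      have h2 := (h k hk).decay₂
      have h3 : 0 ≤ M * Y := by positivity
      nlinarith
    rcases le_total (M * Y) s with hc | hc
    · have h1 : M * Y / s ≤ s / (M * Y) ∨ M * Y = 0 := by
        rcases (show 0 ≤ M * Y by positivity).eq_or_lt with h0 | h0
        · exact Or.inr h0.symm
        · exact Or.inl (((div_le_one hs0).2 hc).trans ((one_le_div h0).2 hc))
      have h2 : min (M * Y / s) (s / (M * Y)) = M * Y / s := by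
        rcases h1 with h1 | h1
        · exact min_eq_left h1
        · simp [h1]
      rw [h2]
      have h3 : D ^ 2 ≤ (E * (M * Y + T / M)) ^ 2 := pow_le_pow_left₀ hD0 b1 2
      have h4 : T * (M * Y / s) ^ 2 = (M * Y) ^ 2 := by rw [div_pow, hs2]; field_simp
      have h5 : (T / M) ^ 2 ≤ T * (T / M) ^ 2 := le_mul_of_one_le_left (by positivity) hT
      calc D ^ 2 ≤ E ^ 2 * (M * Y + T / M) ^ 2 := by rw [← mul_pow]; exact h3
        _ ≤ E ^ 2 * (8 * ((T / M) ^ 2 + (M * Y) ^ 2)) := by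
            gcongr; nlinarith [sq_nonneg (M * Y - T / M), sq_nonneg (M * Y + T / M)]
        _ ≤ E ^ 2 * (8 * (T * (T / M) ^ 2 + T * (M * Y / s) ^ 2)) := by rw [h4]; gcongr
        _ = _ := by ring
    · have h0 : 0 < M * Y := hs0.trans_le hc
      have h2 : min (M * Y / s) (s / (M * Y)) = s / (M * Y) :=
        min_eq_right (((div_le_one h0).2 hc).trans ((one_le_div hs0).2 hc))
      rw [h2]
      have h3 : D ≤ 2 * E * T / (M * Y) := by rwa [le_div_iff₀ h0]
      have h4 : T * (s / (M * Y)) ^ 2 = (T / (M * Y)) ^ 2 := by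
        rw [div_pow, div_pow, hs2]; ring
      calc D ^ 2 ≤ (2 * E * T / (M * Y)) ^ 2 := pow_le_pow_left₀ hD0 h3 2
        _ = 4 * E ^ 2 * (T / (M * Y)) ^ 2 := by ring
        _ = 4 * E ^ 2 * (T * (s / (M * Y)) ^ 2) := by rw [h4]
        _ ≤ 8 * E ^ 2 * (T * (T / M) ^ 2 + T * (s / (M * Y)) ^ 2) := by
            have : 0 ≤ E ^ 2 * (T * (T / M) ^ 2) := by positivity
            have : 0 ≤ E ^ 2 * (T * (s / (M * Y)) ^ 2) := by positivity
            linarith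
        _ = _ := by ring
  calc _ ≤ _ := Finset.sum_le_sum key
    _ ≤ 8 * E ^ 2 * T * (4 + 4) := by
      rw [← Finset.mul_sum, Finset.sum_add_distrib]
      gcongr
      · exact sum_min_inv_sq_le K (by positivity)
      · exact sum_min_inv_sq_le K (by positivity)
    _ = _ := by ring

/-- The maximal function over convolutions with chirps of frequency `a / q` at dyadic scales. -/
def chirpMax {d : ℕ} (q a : ℕ) (t : ℝ) (f : (Fin d → ℤ) → ℂ) (x : Fin d → ℤ) : ℝ≥0∞ :=
  ⨆ (k : ℕ) (_ : q * max 1 |t| ≤ 2 ^ k), ‖conv (tensor (chirp q a t (2 ^ k))) f x‖ₑ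

/-- The square of the operator norm of `chirpMax` on `ℓ²`, up to a constant. -/
def arcWeight (d q : ℕ) (t : ℝ) : ℝ := max 1 |t| * ((q * max 1 |t|)⁻¹) ^ d

/-- The convolution of `f` with the tensor power of the Fejér kernel. -/
def fejerConv {d : ℕ} (q a : ℕ) (f : (Fin d → ℤ) → ℂ) : (Fin d → ℤ) → ℂ :=
  conv (tensor (fejer q a)) f

/-- The main term in the convolution of `f` with a chirp. -/
def mainConv {d : ℕ} (q a : ℕ) (t N : ℝ) (f : (Fin d → ℤ) → ℂ) (x : Fin d → ℤ) : ℂ :=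
  chirpConst t N ^ d * conv (tensor (coarse q (N / q))) (fejerConv q a f) x

lemma enorm_sq_eq_ofReal (z : ℂ) : ‖z‖ₑ ^ 2 = ENNReal.ofReal (‖z‖ ^ 2) := by
  rw [ENNReal.ofReal_pow (norm_nonneg _), ofReal_norm]

lemma summable_norm_fejerConv {d : ℕ} (q a : ℕ) {f : (Fin d → ℤ) → ℂ}
    (hf : Summable fun u => ‖f u‖) : Summable fun u => ‖fejerConv q a f u‖ :=
  summable_norm_conv (summable_norm_tensor (summable_norm_fejer q a)) hf

lemma tsum_fejerConv_sq_le {d q a : ℕ} [NeZero q] (ha : a.Coprime q) {f : (Fin d → ℤ) → ℂ}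
    (hf : Summable fun u => ‖f u‖) :
    ∑' x, ‖fejerConv q a f x‖ₑ ^ 2 ≤ ENNReal.ofReal ((2 / q) ^ d) * ∑' x, ‖f x‖ₑ ^ 2 := by
  have hG := summable_norm_tensor (d := d) (summable_norm_fejer q a)
  have h := sum_tsum_le_of_torusHat_le (Finset.univ : Finset Unit) (g := fun _ => fejerConv q a f)
    (fun _ _ => summable_norm_fejerConv q a hf) hf (m := fun _ => torusHat (tensor (fejer q a)))
    (fun _ _ ξ => torusHat_conv hG hf ξ) (B := ENNReal.ofReal ((2 / q) ^ d)) fun ξ => ?_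
  · simpa using h
  · obtain ⟨x, rfl⟩ := exists_real_rep ξ
    rw [Finset.univ_unique, Finset.sum_singleton, torusHat_tensor (summable_norm_fejer q a),
      enorm_sq_eq_ofReal]
    refine ENNReal.ofReal_le_ofReal ?_
    rw [norm_prod, ← Finset.prod_pow]
    calc _ ≤ ∏ _i : Fin d, (2 / q : ℝ) :=
        Finset.prod_le_prod (fun _ _ => by positivity) fun i _ => by
          calc _ ≤ √(2 / q) ^ 2 := pow_le_pow_left₀ (norm_nonneg _) (norm_symbol_fejer_le ha _) 2
            _ = _ := Real.sq_sqrt (by positivity)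
      _ = _ := by simp [div_pow]

/-- The decomposition of `ℤ^d` into residue classes modulo `q`. -/
def residueEquiv (d q : ℕ) [NeZero q] : (Fin d → ℤ) ≃ (Fin d → ℤ) × (Fin d → Fin q) :=
  (Equiv.piCongrRight fun _ => Int.divModEquiv q).trans (Equiv.arrowProdEquivProdArrow _ _ _)

lemma residueEquiv_symm_apply (d q : ℕ) [NeZero q] (n : Fin d → ℤ) (l : Fin d → Fin q) :
    (residueEquiv d q).symm (n, l) = fun i => n i * q + (l i : ℕ) := rfl

lemma enorm_conv_coarse_le {d q : ℕ} [NeZero q] {M : ℝ} (hM : 0 < M) (F : (Fin d → ℤ) → ℂ)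
    (n : Fin d → ℤ) (l : Fin d → Fin q) :
    ‖conv (tensor (coarse q M)) F ((residueEquiv d q).symm (n, l))‖ₑ ≤
      gaussAvg M (fun m => ‖F ((residueEquiv d q).symm (m, l))‖ₑ) n := by
  have hq0 : (q : ℤ) ≠ 0 := by exact_mod_cast NeZero.ne q
  set x := (residueEquiv d q).symm (n, l) with hx
  have hinj : Function.Injective fun (m : Fin d → ℤ) i => (q : ℤ) * m i := fun m m' h =>
    funext fun i => mul_left_injective_int q (congrFun h i)
  have hsupp : Function.support (fun u : Fin d → ℤ => ‖tensor (coarse q M) u‖ₑ * ‖F (x - u)‖ₑ) ⊆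
      Set.range fun (m : Fin d → ℤ) i => (q : ℤ) * m i := fun u hu => by
    by_contra hcon
    have : ∃ i, u i ∉ Set.range fun m : ℤ => (q : ℤ) * m := by
      by_contra hall
      push Not at hall
      choose m hm using hall
      exact hcon ⟨m, funext hm⟩
    obtain ⟨i, hi⟩ := this
    apply hu
    have h0 : tensor (coarse q M) u = 0 :=
      Finset.prod_eq_zero (Finset.mem_univ i) (coarse_eq_zero_of_notMem_range q M _ hi)
    simp [h0]
  calc ‖conv (tensor (coarse q M)) F x‖ₑ
      ≤ ∑' y, ‖tensor (coarse q M) (x - y) * F y‖ₑ := enorm_tsum_le_tsum_enorm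
    _ = ∑' u, ‖tensor (coarse q M) u‖ₑ * ‖F (x - u)‖ₑ := by
        rw [← (Equiv.subLeft x).tsum_eq]
        exact tsum_congr fun u => by simp [enorm_mul]
    _ = ∑' m : Fin d → ℤ, ‖tensor (coarse q M) (fun i => (q : ℤ) * m i)‖ₑ *
          ‖F (x - fun i => (q : ℤ) * m i)‖ₑ := (hinj.tsum_eq hsupp).symm
    _ = _ := by
        refine tsum_congr fun m => ?_
        congr 1
        · rw [tensor, ← ofReal_norm]
          congr 1
          simp only [coarse_mul]
          rw [← Complex.ofReal_prod, Complex.norm_real, Finset.prod_mul_distrib,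
            ← Real.exp_sum, Real.norm_of_nonneg (by positivity)]
          simp only [Finset.prod_const, Finset.card_univ, Fintype.card_fin, inv_pow, normSq]
          congr 2
          rw [← Finset.sum_div, ← Finset.mul_sum]
          push_cast
          rfl
        · congr 2
          rw [hx, residueEquiv_symm_apply, residueEquiv_symm_apply]
          funext i
          simp only [Pi.sub_apply]
          ring

lemma exists_tsum_iSup_coarse_sq_le (d : ℕ) : ∃ C : ℝ≥0, ∀ (q : ℕ) [NeZero q]
    (F : (Fin d → ℤ) → ℂ),
    ∑' x, (⨆ (M : ℝ) (_ : 1 ≤ M), ‖conv (tensor (coarse q M)) F x‖ₑ) ^ 2 ≤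
      C * ∑' x, ‖F x‖ₑ ^ 2 := by
  obtain ⟨C, hC⟩ := exists_gaussMax_strong d one_lt_two
  refine ⟨C, fun q _ F => ?_⟩
  rw [← (residueEquiv d q).symm.tsum_eq, ← (residueEquiv d q).symm.tsum_eq fun x => ‖F x‖ₑ ^ 2,
    ENNReal.tsum_prod', ENNReal.tsum_prod', ENNReal.tsum_comm,
    ENNReal.tsum_comm (f := fun n l => ‖F ((residueEquiv d q).symm (n, l))‖ₑ ^ 2),
    ← ENNReal.tsum_mul_left]
  refine ENNReal.tsum_le_tsum fun l => ?_
  have h := hC fun m => ‖F ((residueEquiv d q).symm (m, l))‖ₑ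
  simp only [ENNReal.rpow_two] at h
  refine le_trans (ENNReal.tsum_le_tsum fun n => ?_) h
  gcongr
  exact iSup₂_mono fun M hM => enorm_conv_coarse_le (by linarith) F n l

lemma summable_norm_mainConv {d q a : ℕ} [NeZero q] {t N : ℝ} (hN : 0 < N) {f : (Fin d → ℤ) → ℂ}
    (hf : Summable fun u => ‖f u‖) : Summable fun u => ‖mainConv q a t N f u‖ := by
  have hq : (0 : ℝ) < q := by exact_mod_cast Nat.pos_of_ne_zero (NeZero.ne q)
  simp only [mainConv, norm_mul]
  exact (summable_norm_conv (summable_norm_tensor (summable_norm_coarse q (by positivity)))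
    (summable_norm_fejerConv q a hf)).mul_left _

lemma torusHat_mainConv {d q a : ℕ} [NeZero q] {t N : ℝ} (hN : 0 < N) {f : (Fin d → ℤ) → ℂ}
    (hf : Summable fun u => ‖f u‖) (ξ : Fin d → ℝ) :
    torusHat (mainConv q a t N f) (fun i => (ξ i : UnitAddCircle)) =
      (∏ i, mainSymbol q a t N (ξ i)) * torusHat f (fun i => (ξ i : UnitAddCircle)) := by
  have hq : (0 : ℝ) < q := by exact_mod_cast Nat.pos_of_ne_zero (NeZero.ne q)
  have h1 := summable_norm_coarse q (show 0 < N / q by positivity)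
  have h2 := summable_norm_fejer q a
  have e : torusHat (mainConv q a t N f) (fun i => (ξ i : UnitAddCircle)) =
      chirpConst t N ^ d * torusHat (conv (tensor (coarse q (N / q))) (fejerConv q a f))
        (fun i => (ξ i : UnitAddCircle)) := by
    simp only [torusHat, mainConv, mul_assoc]
    exact tsum_mul_left
  rw [e, torusHat_conv (summable_norm_tensor h1) (summable_norm_fejerConv q a hf), fejerConv,
    torusHat_conv (summable_norm_tensor h2) hf, torusHat_tensor h1, torusHat_tensor h2]
  simp only [mainSymbol, Finset.prod_mul_distrib, Finset.prod_const, Finset.card_univ,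
    Fintype.card_fin]
  ring

/-- The difference between the convolution of `f` with a chirp and its main term. -/
def errConv {d : ℕ} (q a : ℕ) (t N : ℝ) (f : (Fin d → ℤ) → ℂ) : (Fin d → ℤ) → ℂ :=
  conv (tensor (chirp q a t N)) f - mainConv q a t N f

lemma sum_tsum_errConv_sq_le {d q a : ℕ} [NeZero d] [NeZero q] (ha : a.Coprime q) (t : ℝ)
    {f : (Fin d → ℤ) → ℂ} (hf : Summable fun u => ‖f u‖) (K : Finset ℕ)
    (hK : ∀ k ∈ K, q * max 1 |t| ≤ 2 ^ k) :
    ∑ k ∈ K, ∑' x, ‖errConv q a t (2 ^ k) f x‖ₑ ^ 2 ≤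
      ENNReal.ofReal (64 * d ^ 2 * (2 * symbolCst ^ 2) ^ d * arcWeight d q t) *
        ∑' x, ‖f x‖ₑ ^ 2 := by
  have hq : (0 : ℝ) < q := by exact_mod_cast Nat.pos_of_ne_zero (NeZero.ne q)
  have hT : 1 ≤ max 1 |t| := le_max_left _ _
  have hN : ∀ k : ℕ, (0 : ℝ) < 2 ^ k := fun k => by positivity
  have hs1 : ∀ k : ℕ, Summable fun u : Fin d → ℤ => ‖tensor (chirp q a t (2 ^ k)) u‖ := fun k =>
    summable_norm_tensor (summable_norm_chirp (hN k))
  have hs2 := fun k => summable_norm_conv (hs1 k) hf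
  have hs3 := fun k => summable_norm_mainConv (a := a) (t := t) (q := q) (hN k) hf
  refine sum_tsum_le_of_torusHat_le K (g := fun k => errConv q a t (2 ^ k) f)
    (fun k _ => ?_) hf (m := fun k ξ => torusHat (tensor (chirp q a t (2 ^ k))) ξ -
      ∏ i, mainSymbol q a t (2 ^ k) ((exists_real_rep ξ).choose i)) (fun k _ ξ => ?_) fun ξ => ?_
  · exact Summable.of_nonneg_of_le (fun _ => norm_nonneg _) (fun u => norm_sub_le _ _)
      ((hs2 k).add (hs3 k))
  · have hξ := (exists_real_rep ξ).choose_spec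
    have h := torusHat_mainConv (a := a) (t := t) (q := q) (hN k) hf (exists_real_rep ξ).choose
    rw [← hξ] at h
    rw [errConv, torusHat_sub (hs2 k) (hs3 k), torusHat_conv (hs1 k) hf, h, sub_mul]
  · set x := (exists_real_rep ξ).choose with hx
    have hξ : ξ = fun i => (x i : UnitAddCircle) := (exists_real_rep ξ).choose_spec
    obtain ⟨i₀, -, hi₀⟩ := Finset.exists_max_image Finset.univ
      (fun i => |q * x i - round (q * x i)|) ⟨(0 : Fin d), Finset.mem_univ _⟩
    set T := max 1 |t| with hTdef
    have hT0 : 0 < T := by linarith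
    set E₀ := symbolCst * (√(T⁻¹) * √(2 / q)) with hE₀
    have hE0 : 0 ≤ E₀ := mul_nonneg symbolCst_pos.le (by positivity)
    have hb : ∀ k ∈ K, SymbolBounds (torusHat (tensor (chirp q a t (2 ^ k))) ξ)
        (∏ i, mainSymbol q a t (2 ^ k) (x i)) (d * E₀ ^ d)
        (2 ^ k / q * |q * x i₀ - round (q * x i₀)|) T (T / (2 ^ k / q)) := fun k hk => by
      rw [hξ, torusHat_tensor (summable_norm_chirp (hN k))]
      refine SymbolBounds.prod (u := fun i => 2 ^ k / q * |q * x i - round (q * x i)|) hE0 hT0.le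
        (fun i => ?_) fun i =>
          mul_le_mul_of_nonneg_left (hi₀ i (Finset.mem_univ i)) (by positivity)
      refine (symbolBounds ha (hK k hk) (x i)).mono ?_ (by positivity) hT0.le (by positivity)
      rw [hE₀]
      have := symbolCst_pos
      gcongr
      exact Real.le_sqrt_of_sq_le (norm_chirpConst_sq_le (hN k))
    have h := sum_sq_le_of_symbolBounds K hq (abs_nonneg _) hT hK hb
    simp only [enorm_sq_eq_ofReal]
    rw [← ENNReal.ofReal_sum_of_nonneg fun _ _ => by positivity]
    refine ENNReal.ofReal_le_ofReal (h.trans (le_of_eq ?_))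
    have e : E₀ ^ 2 = (2 * symbolCst ^ 2) * (q * T)⁻¹ := by
      rw [hE₀, mul_pow, mul_pow, Real.sq_sqrt (by positivity), Real.sq_sqrt (by positivity)]
      field_simp
    rw [arcWeight, mul_pow, ← pow_mul, mul_comm d 2, pow_mul, e, mul_pow]
    ring

lemma exists_tsum_iSup_mainConv_sq_le (d : ℕ) : ∃ C : ℝ≥0, ∀ (q a : ℕ) [NeZero q]
    (_ : a.Coprime q) (t : ℝ) (f : (Fin d → ℤ) → ℂ) (_ : Summable fun u => ‖f u‖),
    ∑' x, (⨆ (k : ℕ) (_ : q * max 1 |t| ≤ 2 ^ k), ‖mainConv q a t (2 ^ k) f x‖ₑ) ^ 2 ≤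
      C * ENNReal.ofReal (arcWeight d q t) * ∑' x, ‖f x‖ₑ ^ 2 := by
  obtain ⟨C, hC⟩ := exists_tsum_iSup_coarse_sq_le d
  refine ⟨C * 2 ^ d, fun q a _ ha t f hf => ?_⟩
  have hq : (0 : ℝ) < q := by exact_mod_cast Nat.pos_of_ne_zero (NeZero.ne q)
  set T := max 1 |t| with hT
  have hT1 : 1 ≤ T := le_max_left _ _
  have hT0 : 0 < T := by linarith
  have h1 : ∀ x, (⨆ (k : ℕ) (_ : q * T ≤ 2 ^ k), ‖mainConv q a t (2 ^ k) f x‖ₑ) ^ 2 ≤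
      ENNReal.ofReal (T⁻¹ ^ d) *
        (⨆ (M : ℝ) (_ : 1 ≤ M), ‖conv (tensor (coarse q M)) (fejerConv q a f) x‖ₑ) ^ 2 := fun x => by
    have e : ENNReal.ofReal (T⁻¹ ^ d) = ENNReal.ofReal (√(T⁻¹) ^ d) ^ 2 := by
      rw [← ENNReal.ofReal_pow (by positivity), ← pow_mul, mul_comm d 2, pow_mul,
        Real.sq_sqrt (by positivity)]
    rw [e, ← mul_pow]
    gcongr
    refine iSup₂_le fun k hk => ?_
    rw [mainConv, enorm_mul]
    refine mul_le_mul' ?_ (le_iSup₂_of_le ((2 : ℝ) ^ k / q) ?_ le_rfl)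
    · rw [← ofReal_norm, norm_pow]
      refine ENNReal.ofReal_le_ofReal (pow_le_pow_left₀ (norm_nonneg _) ?_ d)
      exact Real.le_sqrt_of_sq_le (norm_chirpConst_sq_le (by positivity))
    · rw [one_le_div hq]
      exact (le_mul_of_one_le_right hq.le hT1).trans hk
  calc _ ≤ ∑' x, ENNReal.ofReal (T⁻¹ ^ d) *
        (⨆ (M : ℝ) (_ : 1 ≤ M), ‖conv (tensor (coarse q M)) (fejerConv q a f) x‖ₑ) ^ 2 :=
        ENNReal.tsum_le_tsum h1
    _ ≤ ENNReal.ofReal (T⁻¹ ^ d) * (C * (ENNReal.ofReal ((2 / q) ^ d) * ∑' x, ‖f x‖ₑ ^ 2)) := by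
        rw [ENNReal.tsum_mul_left]
        gcongr
        exact (hC q _).trans (mul_le_mul_right (tsum_fejerConv_sq_le ha hf) _)
    _ = C * (ENNReal.ofReal (T⁻¹ ^ d * (2 / q) ^ d)) * ∑' x, ‖f x‖ₑ ^ 2 := by
        rw [ENNReal.ofReal_mul (by positivity)]; ring
    _ ≤ C * (ENNReal.ofReal (2 ^ d * arcWeight d q t)) * ∑' x, ‖f x‖ₑ ^ 2 := by
        refine mul_le_mul_left (mul_le_mul_right (ENNReal.ofReal_le_ofReal ?_) _) _
        rw [arcWeight, ← hT]
        calc T⁻¹ ^ d * (2 / q) ^ d = 2 ^ d * (1 * ((q * T)⁻¹) ^ d) := by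
              rw [← mul_pow, one_mul, ← mul_pow]; congr 1; field_simp
          _ ≤ _ := by gcongr
    _ = _ := by
        rw [ENNReal.ofReal_mul (by positivity), ENNReal.ofReal_pow (by norm_num)]
        push_cast
        rw [ENNReal.ofReal_ofNat]
        ring

/-- The `ℓ²` bound for the maximal function over chirps of a fixed frequency. -/
theorem exists_tsum_chirpMax_sq_le (d : ℕ) [NeZero d] : ∃ C : ℝ≥0, ∀ (q a : ℕ) [NeZero q]
    (_ : a.Coprime q) (t : ℝ) (f : (Fin d → ℤ) → ℂ) (_ : Summable fun u => ‖f u‖),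
    ∑' x, chirpMax q a t f x ^ 2 ≤
      C * ENNReal.ofReal (arcWeight d q t) * ∑' x, ‖f x‖ₑ ^ 2 := by
  obtain ⟨C, hC⟩ := exists_tsum_iSup_mainConv_sq_le d
  set B : ℝ := 64 * d ^ 2 * (2 * symbolCst ^ 2) ^ d with hB
  have hB0 : 0 ≤ B := by positivity
  refine ⟨2 * B.toNNReal + 2 * C, fun q a _ ha t f hf => ?_⟩
  set p : ℕ → Prop := fun k => q * max 1 |t| ≤ 2 ^ k with hp
  have h1 : ∑' x, ∑' k : {k // p k}, ‖errConv q a t (2 ^ (k : ℕ)) f x‖ₑ ^ 2 ≤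
      ENNReal.ofReal (B * arcWeight d q t) * ∑' x, ‖f x‖ₑ ^ 2 := by
    rw [ENNReal.tsum_comm, ENNReal.tsum_eq_iSup_sum]
    refine iSup_le fun K => ?_
    have h := sum_tsum_errConv_sq_le ha t hf (K.map (Function.Embedding.subtype p)) fun k hk => by
      obtain ⟨k', -, rfl⟩ := Finset.mem_map.1 hk
      exact k'.2
    rwa [Finset.sum_map] at h
  have h2 : ∀ x, chirpMax q a t f x ^ 2 ≤
      2 * ∑' k : {k // p k}, ‖errConv q a t (2 ^ (k : ℕ)) f x‖ₑ ^ 2 +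
      2 * (⨆ (k : ℕ) (_ : p k), ‖mainConv q a t (2 ^ k) f x‖ₑ) ^ 2 := fun x => by
    set G := ⨆ (k : ℕ) (_ : p k), ‖mainConv q a t (2 ^ k) f x‖ₑ with hG
    rw [chirpMax, ENNReal.iSup₂_pow_of_ne_zero _ two_ne_zero]
    refine iSup₂_le fun k hk => ?_
    have h3 : conv (tensor (chirp q a t (2 ^ k))) f x =
        errConv q a t (2 ^ k) f x + mainConv q a t (2 ^ k) f x := by
      rw [errConv, Pi.sub_apply, sub_add_cancel]
    calc ‖conv (tensor (chirp q a t (2 ^ k))) f x‖ₑ ^ 2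
        ≤ (‖errConv q a t (2 ^ k) f x‖ₑ + G) ^ 2 := by
          rw [h3]
          gcongr
          exact (enorm_add_le _ _).trans (add_le_add_right
            (le_iSup₂ (f := fun (k : ℕ) (_ : p k) => ‖mainConv q a t (2 ^ k) f x‖ₑ) k hk) _)
      _ ≤ 2 * (‖errConv q a t (2 ^ k) f x‖ₑ ^ 2 + G ^ 2) := by
          have := ENNReal.rpow_add_le_mul_rpow_add_rpow ‖errConv q a t (2 ^ k) f x‖ₑ G
            (p := 2) one_le_two
          norm_num at this
          exact this
      _ ≤ _ := by
          rw [mul_add]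
          gcongr
          exact ENNReal.le_tsum (f := fun k : {k // p k} => ‖errConv q a t (2 ^ (k : ℕ)) f x‖ₑ ^ 2)
            ⟨k, hk⟩
  calc _ ≤ _ := ENNReal.tsum_le_tsum h2
    _ ≤ 2 * (ENNReal.ofReal (B * arcWeight d q t) * ∑' x, ‖f x‖ₑ ^ 2) +
        2 * (C * ENNReal.ofReal (arcWeight d q t) * ∑' x, ‖f x‖ₑ ^ 2) := by
      rw [ENNReal.tsum_add, ENNReal.tsum_mul_left, ENNReal.tsum_mul_left]
      gcongr
      exact hC q a ha t f hf
    _ = _ := by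
      rw [ENNReal.ofReal_mul hB0, ENNReal.ofReal]
      push_cast
      ring

end

section

open MeasureTheory Set

lemma levelCount_le_add {ι : Type*} {g g₁ g₂ : ι → ℝ≥0∞} (h : ∀ x, g x ≤ g₁ x + g₂ x)
    (α : ℝ≥0∞) : levelCount g α ≤ levelCount g₁ (α / 2) + levelCount g₂ (α / 2) := by
  rw [levelCount, levelCount, levelCount, ← ENNReal.tsum_add]
  refine ENNReal.tsum_le_tsum fun x => ?_
  simp only [indicator_apply, mem_ofPred_eq, Pi.one_apply]
  by_cases h0 : α < g x
  · have : α / 2 < g₁ x ∨ α / 2 < g₂ x := by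
      by_contra hcon
      push Not at hcon
      have := (h x).trans (add_le_add hcon.1 hcon.2)
      rw [ENNReal.add_halves] at this
      exact absurd h0 (not_lt.2 this)
    rcases this with h1 | h1 <;> simp [h0, h1]
  · simp [h0]

lemma levelCount_le_sq {ι : Type*} (g : ι → ℝ≥0∞) {α : ℝ} (hα : 0 < α) :
    levelCount g (ENNReal.ofReal α) ≤ ((ENNReal.ofReal α)⁻¹) ^ 2 * ∑' x, g x ^ 2 := by
  rw [levelCount, ← ENNReal.tsum_mul_left]
  refine ENNReal.tsum_le_tsum fun x => ?_
  simp only [indicator_apply, mem_ofPred_eq, Pi.one_apply]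
  split_ifs with h
  · rw [← mul_pow]
    refine one_le_pow₀ ?_
    have h0 : ENNReal.ofReal α ≠ 0 := by simpa using hα
    calc (1 : ℝ≥0∞) = (ENNReal.ofReal α)⁻¹ * ENNReal.ofReal α :=
          (ENNReal.inv_mul_cancel h0 ENNReal.ofReal_ne_top).symm
      _ ≤ _ := by gcongr
  · exact zero_le

lemma enorm_tensor_chirp {d : ℕ} (q a : ℕ) (t : ℝ) {N : ℝ} (hN : 0 < N) (u : Fin d → ℤ) :
    ‖tensor (chirp q a t N) u‖ₑ =
      ENNReal.ofReal ((N ^ d)⁻¹ * Real.exp (-Real.pi * (normSq u : ℝ) / N ^ 2)) := by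
  rw [tensor, ← ofReal_norm, norm_prod]
  congr 1
  simp only [norm_chirp hN, Finset.prod_mul_distrib, ← Real.exp_sum, Finset.prod_const,
    Finset.card_univ, Fintype.card_fin, inv_pow, normSq]
  congr 2
  rw [← Finset.sum_div, ← Finset.mul_sum]
  push_cast
  rfl

lemma chirpMax_le_gaussMax {d : ℕ} (q a : ℕ) [NeZero q] (t : ℝ) (f : (Fin d → ℤ) → ℂ)
    (x : Fin d → ℤ) : chirpMax q a t f x ≤ gaussMax (fun y => ‖f y‖ₑ) x := by
  refine iSup₂_le fun k hk => le_iSup₂_of_le ((2 : ℝ) ^ k) (one_le_pow₀ one_le_two) ?_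
  calc ‖conv (tensor (chirp q a t (2 ^ k))) f x‖ₑ
      ≤ ∑' y, ‖tensor (chirp q a t (2 ^ k)) (x - y) * f y‖ₑ := enorm_tsum_le_tsum_enorm
    _ = ∑' u, ‖tensor (chirp q a t (2 ^ k)) u‖ₑ * ‖f (x - u)‖ₑ := by
        rw [← (Equiv.subLeft x).tsum_eq]
        exact tsum_congr fun u => by simp [enorm_mul]
    _ = _ := tsum_congr fun u => by rw [enorm_tensor_chirp q a t (by positivity)]

lemma conv_add_right {d : ℕ} {κ f g : (Fin d → ℤ) → ℂ} (hκ : Summable fun u => ‖κ u‖)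
    (hf : Summable fun u => ‖f u‖) (hg : Summable fun u => ‖g u‖) (x : Fin d → ℤ) :
    conv κ (f + g) x = conv κ f x + conv κ g x := by
  simp only [conv, Pi.add_apply, mul_add]
  exact ((summable_norm_shear hκ hf).prod_factor x).of_norm.tsum_add
    ((summable_norm_shear hκ hg).prod_factor x).of_norm

lemma chirpMax_add_le {d : ℕ} (q a : ℕ) (t : ℝ) {f g : (Fin d → ℤ) → ℂ}
    (hf : Summable fun u => ‖f u‖) (hg : Summable fun u => ‖g u‖) (x : Fin d → ℤ) :
    chirpMax q a t (f + g) x ≤ chirpMax q a t f x + chirpMax q a t g x := by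
  refine iSup₂_le fun k hk => ?_
  rw [conv_add_right (summable_norm_tensor (summable_norm_chirp (by positivity))) hf hg]
  refine (enorm_add_le _ _).trans (add_le_add ?_ ?_)
  · exact le_iSup₂ (f := fun (k : ℕ) (_ : q * max 1 |t| ≤ 2 ^ k) =>
      ‖conv (tensor (chirp q a t (2 ^ k))) f x‖ₑ) k hk
  · exact le_iSup₂ (f := fun (k : ℕ) (_ : q * max 1 |t| ≤ 2 ^ k) =>
      ‖conv (tensor (chirp q a t (2 ^ k))) g x‖ₑ) k hk

lemma arcWeight_pos (d q : ℕ) [NeZero q] (t : ℝ) : 0 < arcWeight d q t := by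
  have hq : (0 : ℝ) < q := by exact_mod_cast Nat.pos_of_ne_zero (NeZero.ne q)
  unfold arcWeight; positivity

/-- The `ℓ^p` bound for the maximal function over chirps of a fixed frequency. -/
theorem exists_tsum_chirpMax_rpow_le (d : ℕ) [NeZero d] {p : ℝ} (hp : 1 < p) (hp2 : p < 2) :
    ∃ C : ℝ≥0, ∀ (q a : ℕ) [NeZero q] (_ : a.Coprime q) (t : ℝ) (f : (Fin d → ℤ) → ℝ≥0)
      (_ : Summable f),
    ∑' x, chirpMax q a t (fun y => ((f y : ℝ) : ℂ)) x ^ p ≤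
      C * ENNReal.ofReal (arcWeight d q t ^ (p - 1)) * ∑' x, (f x : ℝ≥0∞) ^ p := by
  obtain ⟨C₁, hC₁⟩ := exists_gaussMax_weak d
  obtain ⟨C₂, hC₂⟩ := exists_tsum_chirpMax_sq_le d
  refine ⟨2 * C₁ * (p / (p - 1)).toNNReal + 4 * C₂ * (p / (2 - p)).toNNReal,
    fun q a _ ha t f hf => ?_⟩
  set W := arcWeight d q t with hW
  have hW0 : 0 < W := arcWeight_pos d q t
  have hsum : ∀ g : (Fin d → ℤ) → ℝ≥0, (∀ x, g x ≤ f x) →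
      Summable fun x => ‖((g x : ℝ) : ℂ)‖ := fun g hg => by
    simp only [Complex.norm_real, Real.norm_of_nonneg (NNReal.coe_nonneg _)]
    exact NNReal.summable_coe.2 (NNReal.summable_of_le hg hf)
  have hL : ∀ s, Summable fun x => ‖((largePart f s x : ℝ) : ℂ)‖ := fun s =>
    hsum _ (indicator_le_self _ _)
  have hS : ∀ s, Summable fun x => ‖((smallPart f s x : ℝ) : ℂ)‖ := fun s =>
    hsum _ (indicator_le_self _ _)
  have henorm : ∀ v : ℝ≥0, ‖((v : ℝ) : ℂ)‖ₑ = v := fun v => by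
    rw [← ofReal_norm, Complex.norm_real, Real.norm_of_nonneg (NNReal.coe_nonneg _),
      ENNReal.ofReal_coe_nnreal]
  have key := tsum_rpow_le_of_weak_one_two hp hp2 (inv_pos.2 hW0)
    (chirpMax q a t fun y => ((f y : ℝ) : ℂ)) f (2 * C₁) (4 * C₂ * W.toNNReal) fun α hα => ?_
  · refine key.trans (mul_le_mul_left (le_of_eq ?_) _)
    have e1 : (W⁻¹) ^ (1 - p) = W ^ (p - 1) := by
      rw [Real.inv_rpow hW0.le, ← Real.rpow_neg hW0.le]; congr 1; ring
    have e2 : W * (W⁻¹) ^ (2 - p) = W ^ (p - 1) := by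
      rw [Real.inv_rpow hW0.le, ← Real.rpow_neg hW0.le]
      nth_rewrite 1 [← Real.rpow_one W]
      rw [← Real.rpow_add hW0]; congr 1; ring
    have e3 : (W.toNNReal : ℝ≥0∞) * ENNReal.ofReal (p / (2 - p) * (W⁻¹) ^ (2 - p)) =
        ENNReal.ofReal (p / (2 - p)) * ENNReal.ofReal (W ^ (p - 1)) := by
      change ENNReal.ofReal W * _ = _
      rw [← e2, ← ENNReal.ofReal_mul hW0.le,
        ← ENNReal.ofReal_mul (div_nonneg (by linarith) (by linarith))]
      congr 1; ring
    rw [e1, ENNReal.ofReal_mul (div_nonneg (by linarith) (by linarith))]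
    push_cast
    rw [mul_assoc (4 * (C₂ : ℝ≥0∞)), e3]
    simp only [ENNReal.ofReal]
    ring
  · set s := W⁻¹ * α with hs
    have h2 : ENNReal.ofReal α / 2 = ENNReal.ofReal (α / 2) := by
      rw [ENNReal.ofReal_div_of_pos two_pos, ENNReal.ofReal_ofNat]
    have hα2 : (ENNReal.ofReal (α / 2))⁻¹ = 2 * (ENNReal.ofReal α)⁻¹ := by
      rw [← h2, ENNReal.inv_div (by simp) (by simp), ENNReal.div_eq_inv_mul, mul_comm]
    have hsplit : (fun y => ((f y : ℝ) : ℂ)) =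
        (fun y => ((largePart f s y : ℝ) : ℂ)) + fun y => ((smallPart f s y : ℝ) : ℂ) := by
      funext y
      rw [Pi.add_apply, ← Complex.ofReal_add, ← NNReal.coe_add, ← Pi.add_apply,
        largePart_add_smallPart]
    refine (levelCount_le_add (fun x => by
      rw [hsplit]; exact chirpMax_add_le q a t (hL s) (hS s) x) _).trans (add_le_add ?_ ?_)
    · rw [h2]
      refine (levelCount_mono (fun x => chirpMax_le_gaussMax q a t _ x) _).trans
        ((hC₁ _ _ (by positivity)).trans (le_of_eq ?_))
      rw [hα2]
      simp only [henorm]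
      push_cast
      ring
    · rw [h2]
      refine (levelCount_le_sq _ (by positivity)).trans ?_
      calc _ ≤ _ := mul_le_mul_right (hC₂ q a ha t _ (hS s)) _
        _ = _ := by
          rw [hα2]
          simp only [henorm, ENNReal.ofReal]
          push_cast
          ring

/-- A weighted form of Minkowski's inequality for `ℓ^p` sums of integrals. -/
lemma tsum_lintegral_rpow_le {Ω ι : Type*} [MeasurableSpace Ω] [Countable ι] (μ : Measure Ω)
    {p : ℝ} (hp : 1 < p) {w : Ω → ℝ≥0} (hw : Measurable w) {F : ι → Ω → ℝ≥0∞}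
    (hF : ∀ x, Measurable (F x)) (D : ℝ≥0∞) (h : ∀ ω, ∑' x, F x ω ^ p ≤ D * (w ω : ℝ≥0∞) ^ p) :
    ∑' x, (∫⁻ ω, F x ω ∂μ) ^ p ≤ D * (∫⁻ ω, w ω ∂μ) ^ p := by
  have hp0 : 0 < p := by linarith
  set s : ℝ := (p - 1) / p with hs
  have hs0 : 0 < s := div_pos (by linarith) hp0
  have hpq : p.HolderConjugate s⁻¹ := by
    rw [Real.holderConjugate_iff]
    refine ⟨hp, ?_⟩
    rw [inv_inv, hs]; field_simp; ring
  have hw' : Measurable fun ω => (w ω : ℝ≥0∞) := hw.coe_nnreal_ennreal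
  have hFw : ∀ x ω, F x ω = 0 ∨ w ω ≠ 0 := fun x ω => by
    by_contra! hcon
    have h1 := h ω
    rw [hcon.2, ENNReal.coe_zero, ENNReal.zero_rpow_of_pos hp0, mul_zero, nonpos_iff_eq_zero,
      ENNReal.tsum_eq_zero] at h1
    exact hcon.1 ((ENNReal.rpow_eq_zero_iff_of_pos hp0).1 (h1 x))
  have hx : ∀ x, (∫⁻ ω, F x ω ∂μ) ^ p ≤
      (∫⁻ ω, (F x ω * (w ω : ℝ≥0∞) ^ (-s)) ^ p ∂μ) * (∫⁻ ω, w ω ∂μ) ^ (p - 1) := fun x => by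
    have h1 := ENNReal.lintegral_mul_le_Lp_mul_Lq μ hpq
      (f := fun ω => F x ω * (w ω : ℝ≥0∞) ^ (-s)) (g := fun ω => (w ω : ℝ≥0∞) ^ s)
      (by fun_prop) (by fun_prop)
    have h2 : ∀ ω, ((fun ω => F x ω * (w ω : ℝ≥0∞) ^ (-s)) * fun ω => (w ω : ℝ≥0∞) ^ s) ω =
        F x ω := fun ω => by
      rcases hFw x ω with h0 | h0
      · simp [h0]
      · simp only [Pi.mul_apply]
        rw [mul_assoc, ← ENNReal.rpow_add _ _ (by simpa using h0) ENNReal.coe_ne_top,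
          neg_add_cancel, ENNReal.rpow_zero, mul_one]
    have h3 : ∀ ω, ((w ω : ℝ≥0∞) ^ s) ^ s⁻¹ = w ω := fun ω => by
      rw [← ENNReal.rpow_mul, mul_inv_cancel₀ hs0.ne', ENNReal.rpow_one]
    simp only [h2, h3] at h1
    calc _ ≤ _ := ENNReal.rpow_le_rpow h1 hp0.le
      _ = _ := by
        rw [ENNReal.mul_rpow_of_nonneg _ _ hp0.le, ← ENNReal.rpow_mul, ← ENNReal.rpow_mul,
          one_div_mul_cancel hp0.ne', ENNReal.rpow_one]
        congr 2
        rw [one_div, inv_inv, hs]; field_simp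
  calc _ ≤ ∑' x, (∫⁻ ω, (F x ω * (w ω : ℝ≥0∞) ^ (-s)) ^ p ∂μ) * (∫⁻ ω, w ω ∂μ) ^ (p - 1) :=
        ENNReal.tsum_le_tsum hx
    _ = (∫⁻ ω, ∑' x, (F x ω * (w ω : ℝ≥0∞) ^ (-s)) ^ p ∂μ) * (∫⁻ ω, w ω ∂μ) ^ (p - 1) := by
        rw [ENNReal.tsum_mul_right, lintegral_tsum fun x => by fun_prop]
    _ ≤ (∫⁻ ω, D * w ω ∂μ) * (∫⁻ ω, w ω ∂μ) ^ (p - 1) := by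
        refine mul_le_mul_left (lintegral_mono fun ω => ?_) _
        by_cases h0 : w ω = 0
        · have : ∀ x, F x ω = 0 := fun x => (hFw x ω).resolve_right (not_not.2 h0)
          simp [this, h0, hp0]
        · have h0' : (w ω : ℝ≥0∞) ≠ 0 := by simpa using h0
          simp only [ENNReal.mul_rpow_of_nonneg _ _ hp0.le, ENNReal.tsum_mul_right]
          refine (mul_le_mul_left (h ω) _).trans (le_of_eq ?_)
          rw [mul_assoc, ← ENNReal.rpow_mul, ← ENNReal.rpow_add _ _ h0' ENNReal.coe_ne_top]
          congr 1
          nth_rewrite 2 [← ENNReal.rpow_one (w ω : ℝ≥0∞)]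
          congr 1
          rw [hs]; field_simp; ring
    _ = _ := by
        rw [lintegral_const_mul _ hw', mul_assoc]
        congr 1
        nth_rewrite 1 [← ENNReal.rpow_one (∫⁻ ω, (w ω : ℝ≥0∞) ∂μ)]
        rw [← ENNReal.rpow_add_of_nonneg _ _ zero_le_one (by linarith)]
        congr 1; ring

lemma conv_eq_sum {d : ℕ} (κ : (Fin d → ℤ) → ℂ) {f : (Fin d → ℤ) → ℂ}
    {s : Finset (Fin d → ℤ)} (hs : ∀ y ∉ s, f y = 0) (x : Fin d → ℤ) :
    conv κ f x = ∑ y ∈ s, κ (x - y) * f y :=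
  tsum_eq_sum fun y hy => by rw [hs y hy, mul_zero]

lemma measurable_enorm_conv_chirp {d : ℕ} (q a : ℕ) (N : ℝ) {f : (Fin d → ℤ) → ℂ}
    (hf : f.support.Finite) (x : Fin d → ℤ) :
    Measurable fun t => ‖conv (tensor (chirp q a t N)) f x‖ₑ := by
  have hs : ∀ y ∉ hf.toFinset, f y = 0 := fun y hy => by simpa using hy
  simp only [conv_eq_sum _ hs, tensor, chirp]
  refine Continuous.measurable ?_
  fun_prop

lemma measurable_chirpMax {d : ℕ} (q a : ℕ) {f : (Fin d → ℤ) → ℂ} (hf : f.support.Finite)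
    (x : Fin d → ℤ) : Measurable fun t => chirpMax q a t f x := by
  unfold chirpMax
  refine Measurable.iSup fun k => ?_
  have hm : MeasurableSet {t : ℝ | (q : ℝ) * max 1 |t| ≤ 2 ^ k} :=
    measurableSet_le (by fun_prop) (by fun_prop)
  convert (measurable_enorm_conv_chirp q a (2 ^ k) hf x).indicator hm using 2 with t
  by_cases h : (q : ℝ) * max 1 |t| ≤ 2 ^ k <;> simp [h]

/-- The reduced fractions `a / q` in the unit interval, as pairs `(q, a)`. -/
def IsArc (z : ℕ × ℕ) : Prop := z.1 ≠ 0 ∧ z.2 ≤ z.1 ∧ z.2.Coprime z.1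

open Classical in
/-- The contribution of all arcs to the circle method. -/
def arcSum {d : ℕ} (f : (Fin d → ℤ) → ℂ) (x : Fin d → ℤ) : ℝ≥0∞ :=
  ∑' z : ℕ × ℕ, if IsArc z then ∫⁻ t, chirpMax z.1 z.2 t f x else 0

lemma lintegral_max_rpow_lt_top {s : ℝ} (hs : 1 < s) :
    ∫⁻ t : ℝ, ENNReal.ofReal ((max 1 |t|) ^ (-s)) < ∞ := by
  have h1 := finite_integral_one_add_norm (E := ℝ) (μ := volume) (r := s) (by simpa using hs)
  refine lt_of_le_of_lt ?_ (ENNReal.mul_lt_top (ENNReal.ofReal_lt_top (r := 2 ^ s)) h1)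
  rw [← lintegral_const_mul _ (by fun_prop)]
  refine lintegral_mono fun t => ?_
  rw [← ENNReal.ofReal_mul (by positivity)]
  refine ENNReal.ofReal_le_ofReal ?_
  have hT : 1 + |t| ≤ 2 * max 1 |t| := by linarith [le_max_left 1 |t|, le_max_right 1 |t|]
  rw [Real.norm_eq_abs, Real.rpow_neg (by positivity), Real.rpow_neg (by positivity),
    ← div_eq_mul_inv, inv_eq_one_div, div_le_div_iff₀ (by positivity) (by positivity), one_mul,
    ← Real.mul_rpow (by norm_num) (by positivity)]
  exact Real.rpow_le_rpow (by positivity) hT (by linarith)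

lemma arcWeight_rpow (d q : ℕ) [NeZero d] [NeZero q] (t κ : ℝ) :
    arcWeight d q t ^ κ = (q : ℝ) ^ (-(d * κ)) * (max 1 |t|) ^ (-((d - 1) * κ)) := by
  have hq : (0 : ℝ) < q := by exact_mod_cast Nat.pos_of_ne_zero (NeZero.ne q)
  have hT : 0 < max 1 |t| := by positivity
  rw [arcWeight, ← Real.rpow_natCast, Real.mul_rpow hT.le (by positivity), ← Real.rpow_mul
    (by positivity), Real.inv_rpow (by positivity), ← Real.rpow_neg (by positivity),
    Real.mul_rpow hq.le hT.le, mul_left_comm, ← Real.rpow_add hT]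
  congr 2; ring

/-- The `ℓ^p` bound for the sum over all arcs. -/
theorem exists_tsum_arcSum_rpow_le (d : ℕ) (hd : 5 ≤ d) {p : ℝ} (hp : (d : ℝ) / (d - 2) < p)
    (hp2 : p < 2) : ∃ C : ℝ≥0, ∀ f : (Fin d → ℤ) → ℝ≥0, f.support.Finite →
      ∑' x, arcSum (fun y => ((f y : ℝ) : ℂ)) x ^ p ≤ C * ∑' x, (f x : ℝ≥0∞) ^ p := by
  classical
  have : NeZero d := ⟨by omega⟩
  have hd' : (5 : ℝ) ≤ d := by exact_mod_cast hd
  have hdp : (d : ℝ) < p * (d - 2) := (div_lt_iff₀ (by linarith)).1 hp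
  have hp1 : 1 < p := lt_trans ((one_lt_div (by linarith)).2 (by linarith)) hp
  have hp0 : 0 < p := by linarith
  obtain ⟨C, hC⟩ := exists_tsum_chirpMax_rpow_le d hp1 hp2
  set κ : ℝ := (p - 1) / p with hκ
  have hκp : κ * p = p - 1 := by rw [hκ]; field_simp
  have hκd : 2 < d * κ := by
    rw [hκ, mul_div_assoc', lt_div_iff₀ hp0]; linarith
  have hκd1 : 1 < (d - 1) * κ := by
    have : κ < 1 := by rw [hκ, div_lt_one hp0]; linarith
    linarith
  set J := (∫⁻ t : ℝ, ENNReal.ofReal ((max 1 |t|) ^ (-((d - 1) * κ)))).toNNReal with hJ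
  have hJ' : (J : ℝ≥0∞) = ∫⁻ t : ℝ, ENNReal.ofReal ((max 1 |t|) ^ (-((d - 1) * κ))) :=
    ENNReal.coe_toNNReal (lintegral_max_rpow_lt_top hκd1).ne
  let w : ℕ × ℕ → ℝ≥0 := fun z => if IsArc z then (z.1 : ℝ≥0) ^ (-(d * κ)) * J else 0
  have hwsum : ∑' z, (w z : ℝ≥0∞) ≠ ∞ := by
    have hs : Summable fun q : ℕ => 2 * (q : ℝ≥0) ^ (1 - d * κ) * J :=
      ((NNReal.summable_rpow.2 (by linarith)).mul_left _).mul_right _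
    refine ne_top_of_le_ne_top (ENNReal.tsum_coe_ne_top_iff_summable.2 hs) ?_
    rw [ENNReal.tsum_prod']
    refine ENNReal.tsum_le_tsum fun q => ?_
    by_cases hq : q = 0
    · simp [w, IsArc, hq]
    have hle : ∀ a, (w (q, a) : ℝ≥0∞) ≤ if a ∈ Finset.range (q + 1) then
        (((q : ℝ≥0) ^ (-(d * κ)) * J : ℝ≥0) : ℝ≥0∞) else 0 := fun a => by
      by_cases ha : IsArc (q, a)
      · simp only [w, if_pos ha]
        rw [if_pos (Finset.mem_range.2 (Nat.lt_succ_of_le ha.2.1))]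
      · simp [w, if_neg ha]
    refine (ENNReal.tsum_le_tsum hle).trans ?_
    rw [tsum_eq_sum (s := Finset.range (q + 1)) fun a ha => if_neg ha,
      Finset.sum_congr rfl fun a ha => if_pos ha, Finset.sum_const, Finset.card_range,
      nsmul_eq_mul]
    norm_cast
    have hq1 : (1 : ℝ≥0) ≤ q := by exact_mod_cast Nat.one_le_iff_ne_zero.2 hq
    rw [← mul_assoc, sub_eq_add_neg, NNReal.rpow_add (by positivity), NNReal.rpow_one, ← mul_assoc]
    gcongr
    push_cast
    linarith
  refine ⟨C * (∑' z, (w z : ℝ≥0∞)).toNNReal ^ p, fun f hf => ?_⟩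
  have hfc : (fun y => ((f y : ℝ) : ℂ)).support.Finite := by
    refine hf.subset fun y hy => ?_
    simpa using hy
  have hfs : Summable f := summable_of_hasFiniteSupport hf
  set A := ∑' x, (f x : ℝ≥0∞) ^ p
  have h1 : ∀ z, IsArc z → ∑' x, (∫⁻ t, chirpMax z.1 z.2 t (fun y => ((f y : ℝ) : ℂ)) x) ^ p ≤
      C * A * (w z : ℝ≥0∞) ^ p := fun z hz => by
    have : NeZero z.1 := ⟨hz.1⟩
    refine (tsum_lintegral_rpow_le volume hp1
      (w := fun t => (arcWeight d z.1 t ^ κ).toNNReal) ?_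
      (fun x => measurable_chirpMax z.1 z.2 hfc x) (C * A) fun t => ?_).trans (le_of_eq ?_)
    · unfold arcWeight; fun_prop
    · refine (hC z.1 z.2 hz.2.2 t f hfs).trans (le_of_eq ?_)
      have h0 := arcWeight_pos d z.1 t
      change _ = _ * ENNReal.ofReal _ ^ p
      rw [ENNReal.ofReal_rpow_of_nonneg (by positivity) hp0.le, ← Real.rpow_mul h0.le, hκp]
      ring
    · congr 2
      simp only [w, if_pos hz]
      rw [ENNReal.coe_mul, hJ', ← lintegral_const_mul _ (by fun_prop)]
      refine lintegral_congr fun t => ?_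
      change ENNReal.ofReal _ = _
      rw [arcWeight_rpow, ENNReal.ofReal_mul (by positivity), ENNReal.ofReal,
        Real.toNNReal_rpow_of_nonneg (by positivity), Real.toNNReal_natCast]
  have h2 := tsum_lintegral_rpow_le (Measure.count : Measure (ℕ × ℕ)) hp1 (w := w)
    (measurable_of_countable _)
    (F := fun x z => if IsArc z then
      ∫⁻ t, chirpMax z.1 z.2 t (fun y => ((f y : ℝ) : ℂ)) x else 0)
    (fun x => measurable_of_countable _) (C * A) fun z => ?_
  · simp only [lintegral_count] at h2
    refine h2.trans (le_of_eq ?_)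
    rw [ENNReal.coe_mul, ENNReal.coe_rpow_of_nonneg _ hp0.le, ENNReal.coe_toNNReal hwsum]
    ring
  · by_cases hz : IsArc z
    · simpa only [if_pos hz] using h1 z hz
    · simp [if_neg hz, hp0]

/-- The lattice points on the sphere `|u|² = μ`. -/
def sphere (d μ : ℕ) : Finset (Fin d → ℤ) := (cube 0 μ).filter fun u => normSq u = μ

lemma mem_cube_of_normSq_le {d μ : ℕ} {u : Fin d → ℤ} (h : normSq u ≤ μ) : u ∈ cube 0 μ := by
  rw [mem_cube]
  intro i
  have h1 := (sq_le_normSq u i).trans h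
  have h2 : |u i| ≤ (u i) ^ 2 := by
    rcases eq_or_ne (u i) 0 with h0 | h0
    · simp [h0]
    · rw [← sq_abs]
      nlinarith [Int.one_le_abs h0]
  simpa using h2.trans h1

lemma mem_sphere {d μ : ℕ} {u : Fin d → ℤ} : u ∈ sphere d μ ↔ normSq u = μ := by
  rw [sphere, Finset.mem_filter, and_iff_right_iff_imp]
  exact fun h => mem_cube_of_normSq_le h.le

/-- The maximal function over averages on the spheres `|u|² = μ`, `μ ≥ 0`. -/
def sphMax {d : ℕ} (f : (Fin d → ℤ) → ℝ≥0∞) (x : Fin d → ℤ) : ℝ≥0∞ :=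
  ⨆ μ : ℕ, ENNReal.ofReal ((max 1 (μ : ℝ)) ^ (1 - (d : ℝ) / 2)) * ∑ u ∈ sphere d μ, f (x - u)

lemma integral_exp_two_pi_int (n : ℤ) :
    ∫ θ in (0 : ℝ)..1, Complex.exp (2 * Real.pi * Complex.I * n * θ) = if n = 0 then 1 else 0 := by
  split_ifs with h
  · simp [h]
  · have hc : (2 * Real.pi * Complex.I * n : ℂ) ≠ 0 := by
      simp [h, Real.pi_ne_zero]
    rw [integral_exp_mul_complex hc]
    have : Complex.exp (2 * Real.pi * Complex.I * n * (1 : ℝ)) = 1 := by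
      rw [Complex.exp_eq_one_iff]
      exact ⟨n, by push_cast; ring⟩
    rw [this]; simp

lemma tensor_chirp {d : ℕ} (q a : ℕ) (t N : ℝ) (u : Fin d → ℤ) :
    tensor (chirp q a t N) u = ((N : ℂ) ^ d)⁻¹ *
      (Complex.exp (2 * Real.pi * Complex.I * normSq u * ((a / q + t / N ^ 2 : ℝ) : ℂ)) *
        (Real.exp (-Real.pi * (normSq u : ℝ) / N ^ 2) : ℂ)) := by
  rw [tensor]
  simp only [chirp, Finset.prod_mul_distrib, ← Complex.exp_sum, Finset.prod_const,
    Finset.card_univ, Fintype.card_fin, inv_pow, normSq]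
  rw [← Finset.mul_sum, Complex.ofReal_exp, ← Complex.exp_add]
  congr 2
  push_cast
  ring

/-- The exponential sum whose Fourier coefficients are Gaussian-weighted spherical sums. -/
def sphSum {d : ℕ} (s : Finset (Fin d → ℤ)) (f : (Fin d → ℤ) → ℝ≥0) (x : Fin d → ℤ) (N θ : ℝ) :
    ℂ :=
  ∑ y ∈ s, Complex.exp (2 * Real.pi * Complex.I * normSq (x - y) * θ) *
    ((Real.exp (-Real.pi * (normSq (x - y) : ℝ) / N ^ 2) * f y : ℝ) : ℂ)

lemma sphSum_eq {d : ℕ} {s : Finset (Fin d → ℤ)} {f : (Fin d → ℤ) → ℝ≥0}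
    (hs : ∀ y ∉ s, f y = 0) (x : Fin d → ℤ) (q a : ℕ) (t : ℝ) {N : ℝ} (hN : 0 < N) :
    sphSum s f x N (a / q + t / N ^ 2) =
      N ^ d * conv (tensor (chirp q a t N)) (fun y => ((f y : ℝ) : ℂ)) x := by
  have hN' : (N : ℂ) ^ d ≠ 0 := pow_ne_zero _ (by exact_mod_cast hN.ne')
  rw [conv_eq_sum (s := s) _ (fun y hy => by simp [hs y hy]), Finset.mul_sum, sphSum]
  refine Finset.sum_congr rfl fun y _ => ?_
  rw [tensor_chirp, ← mul_assoc, ← mul_assoc, mul_inv_cancel₀ hN', one_mul, Complex.ofReal_mul,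
    ← mul_assoc]

lemma sum_sphere_le {d : ℕ} {s : Finset (Fin d → ℤ)} {f : (Fin d → ℤ) → ℝ≥0}
    (hs : ∀ y ∉ s, f y = 0) (x : Fin d → ℤ) (μ : ℕ) (N : ℝ) :
    ∑ u ∈ sphere d μ, (f (x - u) : ℝ≥0∞) ≤ ENNReal.ofReal (Real.exp (Real.pi * μ / N ^ 2)) *
      ∫⁻ θ in Ioc (0 : ℝ) 1, ‖sphSum s f x N θ‖ₑ := by
  set E := Real.exp (Real.pi * μ / N ^ 2) with hE
  have h0 : ∑ u ∈ sphere d μ, f (x - u) = ∑ y ∈ s, if normSq (x - y) = μ then f y else 0 := by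
    rw [← Finset.sum_filter]
    symm
    refine Finset.sum_of_injOn (fun y => x - y) (fun y _ z _ h => by simpa using h) ?_ ?_ ?_
    · intro y hy
      simp only [Finset.coe_filter, mem_ofPred_eq] at hy
      exact mem_sphere.2 hy.2
    · intro u hu hu'
      refine hs _ fun hmem => hu' ⟨x - u, ?_, by simp⟩
      simpa [hmem] using mem_sphere.1 hu
    · intro y _; simp
  have h1 : ((∑ u ∈ sphere d μ, f (x - u) : ℝ≥0) : ℝ) = E * ‖∫ θ in (0 : ℝ)..1,
      Complex.exp (2 * Real.pi * Complex.I * (-μ : ℤ) * θ) * sphSum s f x N θ‖ := by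
    have h2 : ∫ θ in (0 : ℝ)..1,
        Complex.exp (2 * Real.pi * Complex.I * (-μ : ℤ) * θ) * sphSum s f x N θ =
        ((E⁻¹ * (∑ u ∈ sphere d μ, f (x - u) : ℝ≥0) : ℝ) : ℂ) := by
      simp only [sphSum, Finset.mul_sum]
      rw [intervalIntegral.integral_finsetSum fun y _ =>
        Continuous.intervalIntegrable (by fun_prop) _ _, h0]
      push_cast
      rw [Finset.mul_sum]
      refine Finset.sum_congr rfl fun y _ => ?_
      have h3 : ∀ θ : ℝ, Complex.exp (2 * Real.pi * Complex.I * -μ * θ) *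
          (Complex.exp (2 * Real.pi * Complex.I * normSq (x - y) * θ) *
            (Complex.exp (-Real.pi * normSq (x - y) / N ^ 2) * (f y : ℝ))) =
          Complex.exp (2 * Real.pi * Complex.I * (normSq (x - y) - μ : ℤ) * θ) *
            (Complex.exp (-Real.pi * normSq (x - y) / N ^ 2) * (f y : ℝ)) := fun θ => by
        rw [← mul_assoc, ← Complex.exp_add]
        congr 2
        push_cast; ring
      simp only [h3]
      rw [intervalIntegral.integral_mul_const, integral_exp_two_pi_int]
      simp only [sub_eq_zero]
      split_ifs with h
      · rw [h, hE, one_mul, Complex.ofReal_exp, ← Complex.exp_neg]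
        push_cast
        congr 2
        ring
      · simp
    rw [h2, Complex.norm_real, Real.norm_of_nonneg (by positivity), ← mul_assoc,
      mul_inv_cancel₀ (Real.exp_pos _).ne', one_mul]
  calc _ = ENNReal.ofReal ((∑ u ∈ sphere d μ, f (x - u) : ℝ≥0) : ℝ) := by
        rw [ENNReal.ofReal_coe_nnreal]; push_cast; rfl
    _ = ENNReal.ofReal E * ‖∫ θ in (0 : ℝ)..1,
      Complex.exp (2 * Real.pi * Complex.I * (-μ : ℤ) * θ) * sphSum s f x N θ‖ₑ := by
        rw [h1, ENNReal.ofReal_mul (Real.exp_pos _).le, ofReal_norm]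
    _ ≤ _ := by
        refine mul_le_mul_right ?_ _
        rw [intervalIntegral.integral_of_le zero_le_one]
        refine (enorm_integral_le_lintegral_enorm _).trans (le_of_eq (lintegral_congr fun θ => ?_))
        rw [enorm_mul]
        have : ‖Complex.exp (2 * Real.pi * Complex.I * (-μ : ℤ) * θ)‖ₑ = 1 := by
          rw [← ofReal_norm, norm_exp_two_pi_mul, ENNReal.ofReal_one]
        rw [this, one_mul]

lemma exists_arc {N : ℕ} (hN : 0 < N) {θ : ℝ} (h0 : 0 < θ) (h1 : θ ≤ 1) :
    ∃ z : ℕ × ℕ, IsArc z ∧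
      z.1 * max 1 |(N : ℝ) ^ 2 * (θ - z.2 / z.1)| ≤ N := by
  obtain ⟨r, hr, hrN⟩ := Real.exists_rat_abs_sub_le_and_den_le θ hN
  have hN' : (0 : ℝ) < N := by exact_mod_cast hN
  have hd : (0 : ℝ) < r.den := by exact_mod_cast r.pos
  have hd1 : (1 : ℝ) ≤ r.den := by exact_mod_cast r.pos
  have hrd : (r : ℝ) = r.num / r.den := by exact_mod_cast (Rat.num_div_den r).symm
  have hlt : |θ * r.den - r.num| ≤ 1 / (N + 1) := by
    have : θ * r.den - r.num = (θ - r) * r.den := by rw [hrd]; field_simp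
    rw [this, abs_mul, abs_of_pos hd]
    calc _ ≤ 1 / ((N + 1) * r.den : ℝ) * r.den := by gcongr
      _ = _ := by field_simp
  have hlt1 : 1 / (N + 1 : ℝ) < 1 := by rw [div_lt_one (by positivity)]; linarith
  have hnum : 0 ≤ r.num := by
    have : (-1 : ℝ) < r.num := by
      have := (abs_le.1 hlt).2
      nlinarith [mul_pos h0 hd]
    have : -1 < r.num := by exact_mod_cast this
    omega
  have hcast : ((r.num.toNat : ℕ) : ℝ) = r.num := by
    exact_mod_cast congrArg (Int.cast (R := ℝ)) (Int.toNat_of_nonneg hnum)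
  refine ⟨(r.den, r.num.toNat), ⟨r.den_nz, ?_, ?_⟩, ?_⟩
  · have : (r.num : ℝ) < r.den + 1 := by
      have := (abs_le.1 hlt).1
      nlinarith [mul_le_of_le_one_left hd.le h1]
    have : r.num < r.den + 1 := by exact_mod_cast this
    dsimp only
    omega
  · have := r.reduced
    rwa [show r.num.toNat = r.num.natAbs by omega]
  · dsimp only
    rw [hcast, ← hrd, mul_max_of_nonneg _ _ hd.le, mul_one, abs_mul, abs_of_pos (by positivity)]
    refine max_le (by exact_mod_cast hrN) ?_
    calc _ ≤ (r.den : ℝ) * (N ^ 2 * (1 / ((N + 1) * r.den))) := by gcongr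
      _ = N * (N / (N + 1)) := by field_simp
      _ ≤ N * 1 := by gcongr; rw [div_le_one (by positivity)]; linarith
      _ = _ := mul_one _

lemma lintegral_comp_scale {F : ℝ → ℝ≥0∞} (hF : Measurable F) {c : ℝ} (hc : 0 < c) (b : ℝ) :
    ∫⁻ θ, F (c * (θ - b)) = ENNReal.ofReal c⁻¹ * ∫⁻ t, F t := by
  rw [lintegral_sub_right_eq_self (fun θ => F (c * θ)) b, ← lintegral_map hF (by fun_prop),
    Real.map_volume_mul_left hc.ne', lintegral_smul_measure, abs_of_pos (inv_pos.2 hc)]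
  rfl

lemma lintegral_sphSum_le {d : ℕ} {s : Finset (Fin d → ℤ)} {f : (Fin d → ℤ) → ℝ≥0}
    (hs : ∀ y ∉ s, f y = 0) (x : Fin d → ℤ) (k : ℕ) :
    ∫⁻ θ in Ioc (0 : ℝ) 1, ‖sphSum s f x (2 ^ k) θ‖ₑ ≤
      ENNReal.ofReal ((2 ^ k) ^ d * ((2 ^ k) ^ 2)⁻¹) *
        arcSum (fun y => ((f y : ℝ) : ℂ)) x := by
  classical
  set N : ℝ := 2 ^ k with hN
  have hN0 : 0 < N := by positivity
  set g : (Fin d → ℤ) → ℂ := fun y => ((f y : ℝ) : ℂ) with hg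
  have hgs : g.support.Finite := s.finite_toSet.subset fun y hy => by
    by_contra h
    exact hy (by simp [g, hs y h])
  let G : ℕ × ℕ → ℝ → ℝ≥0∞ := fun z t => if IsArc z then chirpMax z.1 z.2 t g x else 0
  have hG : ∀ z, Measurable (G z) := fun z => by
    by_cases hz : IsArc z
    · simpa only [G, if_pos hz] using measurable_chirpMax z.1 z.2 hgs x
    · simp [G, if_neg hz]
  calc _ ≤ ∫⁻ θ in Ioc (0 : ℝ) 1, ENNReal.ofReal (N ^ d) *
        ∑' z, G z (N ^ 2 * (θ - z.2 / z.1)) := by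
        refine setLIntegral_mono' measurableSet_Ioc fun θ hθ => ?_
        obtain ⟨z, hz, hzN⟩ := exists_arc (N := 2 ^ k) (by positivity) hθ.1 hθ.2
        push_cast at hzN
        have h1 : θ = z.2 / z.1 + N ^ 2 * (θ - z.2 / z.1) / N ^ 2 := by field_simp; ring
        have h2 : ‖sphSum s f x N θ‖ₑ ≤ ENNReal.ofReal (N ^ d) *
            G z (N ^ 2 * (θ - z.2 / z.1)) := by
          nth_rewrite 1 [h1]
          rw [sphSum_eq hs x z.1 z.2 _ hN0, enorm_mul, ← ofReal_norm ((N : ℂ) ^ d), norm_pow,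
            Complex.norm_real, Real.norm_of_nonneg hN0.le]
          refine mul_le_mul_right ?_ _
          simp only [G, if_pos hz]
          exact le_iSup₂ (f := fun (k : ℕ) (_ : z.1 * max 1 |N ^ 2 * (θ - z.2 / z.1)| ≤ 2 ^ k) =>
            ‖conv (tensor (chirp z.1 z.2 (N ^ 2 * (θ - z.2 / z.1)) (2 ^ k))) g x‖ₑ) k hzN
        exact h2.trans (mul_le_mul_right (ENNReal.le_tsum z) _)
    _ ≤ ∫⁻ θ : ℝ, ENNReal.ofReal (N ^ d) * ∑' z, G z (N ^ 2 * (θ - z.2 / z.1)) :=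
        setLIntegral_le_lintegral _ _
    _ = ENNReal.ofReal (N ^ d) * ∑' z, ENNReal.ofReal (N ^ 2)⁻¹ * ∫⁻ t, G z t := by
        have hGc : ∀ z, Measurable fun θ : ℝ => G z (N ^ 2 * (θ - z.2 / z.1)) := fun z =>
          (hG z).comp (by fun_prop)
        rw [lintegral_const_mul _ (Measurable.tsum hGc), lintegral_tsum fun z => (hGc z).aemeasurable]
        congr 1
        exact tsum_congr fun z => lintegral_comp_scale (hG z) (by positivity) _
    _ = _ := by
        rw [ENNReal.tsum_mul_left, ← mul_assoc, ← ENNReal.ofReal_mul (by positivity), arcSum]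
        congr 1
        refine tsum_congr fun z => ?_
        by_cases hz : IsArc z <;> simp [G, hz]

lemma sphMax_le_arcSum {d : ℕ} (hd : 2 ≤ d) {f : (Fin d → ℤ) → ℝ≥0} (hf : f.support.Finite)
    (x : Fin d → ℤ) :
    sphMax (fun y => (f y : ℝ≥0∞)) x ≤ ENNReal.ofReal (Real.exp (4 * Real.pi)) *
      arcSum (fun y => ((f y : ℝ) : ℂ)) x := by
  refine iSup_le fun μ => ?_
  have hs : ∀ y ∉ hf.toFinset, f y = 0 := fun y hy => by simpa using hy
  set m : ℝ := max 1 (μ : ℝ) with hm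
  have hm1 : 1 ≤ m := le_max_left _ _
  obtain ⟨k, hk1, hk2⟩ := exists_nat_pow_near hm1 (by norm_num : (1 : ℝ) < 4)
  have h4 : ((2 : ℝ) ^ k) ^ 2 = 4 ^ k := by rw [← pow_mul, mul_comm, pow_mul]; norm_num
  have hμ : (μ : ℝ) ≤ m := le_max_right _ _
  refine (mul_le_mul_right ((sum_sphere_le hs x μ (2 ^ k)).trans
    (mul_le_mul_right (lintegral_sphSum_le hs x k) _)) _).trans ?_
  rw [← mul_assoc, ← mul_assoc, ← ENNReal.ofReal_mul (by positivity),
    ← ENNReal.ofReal_mul (by positivity)]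
  refine mul_le_mul_left (ENNReal.ofReal_le_ofReal ?_) _
  have e1 : Real.exp (Real.pi * μ / (2 ^ k) ^ 2) ≤ Real.exp (4 * Real.pi) := by
    rw [Real.exp_le_exp, h4, div_le_iff₀ (by positivity)]
    rw [pow_succ] at hk2
    nlinarith [Real.pi_pos]
  have e2 : ((2 : ℝ) ^ k) ^ d * ((2 ^ k) ^ 2)⁻¹ ≤ m ^ ((d : ℝ) / 2 - 1) := by
    have hd' : (2 : ℝ) ≤ d := by exact_mod_cast hd
    rw [← Real.rpow_natCast ((2 : ℝ) ^ k) d, ← Real.rpow_natCast ((2 : ℝ) ^ k) 2,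
      ← Real.rpow_neg (by positivity), ← Real.rpow_add (by positivity)]
    calc ((2 : ℝ) ^ k) ^ ((d : ℝ) + -((2 : ℕ) : ℝ)) = (((2 : ℝ) ^ k) ^ 2) ^ ((d : ℝ) / 2 - 1) := by
          rw [← Real.rpow_natCast ((2 : ℝ) ^ k) 2, ← Real.rpow_mul (by positivity)]
          congr 1; push_cast; ring
      _ ≤ _ := Real.rpow_le_rpow (by positivity) (by rw [h4]; exact hk1) (by linarith)
  calc _ ≤ m ^ (1 - (d : ℝ) / 2) * Real.exp (4 * Real.pi) * m ^ ((d : ℝ) / 2 - 1) :=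
        mul_le_mul (mul_le_mul_of_nonneg_left e1 (by positivity)) e2 (by positivity)
          (by positivity)
    _ = Real.exp (4 * Real.pi) * (m ^ (1 - (d : ℝ) / 2) * m ^ ((d : ℝ) / 2 - 1)) := by ring
    _ = _ := by
        rw [← Real.rpow_add (by positivity)]; simp

/-- The truncation of `f` to values at most `n` on the cube of radius `n`. -/
def truncation {d : ℕ} (f : (Fin d → ℤ) → ℝ≥0∞) (n : ℕ) (y : Fin d → ℤ) : ℝ≥0 :=
  if y ∈ cube 0 n then (min (f y) n).toNNReal else 0

lemma coe_truncation {d : ℕ} (f : (Fin d → ℤ) → ℝ≥0∞) (n : ℕ) (y : Fin d → ℤ) :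
    (truncation f n y : ℝ≥0∞) = if y ∈ cube 0 n then min (f y) n else 0 := by
  rw [truncation]
  split_ifs
  · exact ENNReal.coe_toNNReal (ne_top_of_le_ne_top (ENNReal.natCast_ne_top n) (min_le_right _ _))
  · rfl

lemma truncation_support_finite {d : ℕ} (f : (Fin d → ℤ) → ℝ≥0∞) (n : ℕ) :
    (truncation f n).support.Finite :=
  (cube 0 n).finite_toSet.subset fun y hy => by
    by_contra h
    exact hy (if_neg h)

lemma truncation_le {d : ℕ} (f : (Fin d → ℤ) → ℝ≥0∞) (n : ℕ) (y : Fin d → ℤ) :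
    (truncation f n y : ℝ≥0∞) ≤ f y := by
  rw [coe_truncation]
  split_ifs
  · exact min_le_left _ _
  · exact zero_le

lemma monotone_truncation {d : ℕ} (f : (Fin d → ℤ) → ℝ≥0∞) (y : Fin d → ℤ) :
    Monotone fun n => (truncation f n y : ℝ≥0∞) := by
  intro m n hmn
  simp only [coe_truncation]
  split_ifs with h1 h2
  · exact min_le_min_left _ (by exact_mod_cast hmn)
  · exact absurd (mem_cube.2 fun i => (mem_cube.1 h1 i).trans (by exact_mod_cast hmn)) h2
  · exact zero_le
  · exact zero_le

lemma iSup_truncation {d : ℕ} (f : (Fin d → ℤ) → ℝ≥0∞) (y : Fin d → ℤ) :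
    ⨆ n, (truncation f n y : ℝ≥0∞) = f y := by
  refine le_antisymm (iSup_le fun n => truncation_le f n y) (le_of_forall_lt fun c hc => ?_)
  obtain ⟨n, hn⟩ := ENNReal.exists_nat_gt hc.ne_top
  set m := max n (normSq y).toNat
  have hy : y ∈ cube 0 m := mem_cube_of_normSq_le (by
    have := normSq_nonneg y
    omega)
  refine lt_iSup_iff.2 ⟨m, ?_⟩
  rw [coe_truncation, if_pos hy]
  exact lt_min hc (hn.trans_le (by exact_mod_cast le_max_left _ _))

lemma sphMax_mono {d : ℕ} {f g : (Fin d → ℤ) → ℝ≥0∞} (h : f ≤ g) (x : Fin d → ℤ) :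
    sphMax f x ≤ sphMax g x :=
  iSup_mono fun _ => mul_le_mul_right (Finset.sum_le_sum fun u _ => h (x - u)) _

lemma sphMax_le_iSup_truncation {d : ℕ} (f : (Fin d → ℤ) → ℝ≥0∞) (x : Fin d → ℤ) :
    sphMax f x ≤ ⨆ n, sphMax (fun y => (truncation f n y : ℝ≥0∞)) x := by
  refine iSup_le fun μ => ?_
  simp only [← iSup_truncation f]
  rw [ENNReal.finsetSum_iSup_of_monotone fun u => monotone_truncation f (x - u), ENNReal.mul_iSup]
  refine iSup_mono fun n => ?_
  exact le_iSup (fun μ : ℕ => ENNReal.ofReal ((max 1 (μ : ℝ)) ^ (1 - (d : ℝ) / 2)) *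
    ∑ u ∈ sphere d μ, (truncation f n (x - u) : ℝ≥0∞)) μ

/-- The `ℓ^p` bound for the discrete spherical maximal function, for `p < 2`. -/
theorem exists_tsum_sphMax_rpow_le_of_lt_two (d : ℕ) (hd : 5 ≤ d) {p : ℝ}
    (hp : (d : ℝ) / (d - 2) < p) (hp2 : p < 2) : ∃ C : ℝ≥0, ∀ f : (Fin d → ℤ) → ℝ≥0∞,
      ∑' x, sphMax f x ^ p ≤ C * ∑' x, f x ^ p := by
  have hd' : (5 : ℝ) ≤ d := by exact_mod_cast hd
  have hp0 : 0 < p := lt_trans (div_pos (by linarith) (by linarith)) hp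
  obtain ⟨C, hC⟩ := exists_tsum_arcSum_rpow_le d hd hp hp2
  refine ⟨(Real.exp (4 * Real.pi)).toNNReal ^ p * C, fun f => ?_⟩
  have h1 : ∀ n, ∑' x, sphMax (fun y => (truncation f n y : ℝ≥0∞)) x ^ p ≤
      ((Real.exp (4 * Real.pi)).toNNReal ^ p * C : ℝ≥0) * ∑' x, f x ^ p := fun n => by
    calc _ ≤ ∑' x, (ENNReal.ofReal (Real.exp (4 * Real.pi)) *
          arcSum (fun y => ((truncation f n y : ℝ) : ℂ)) x) ^ p :=
          ENNReal.tsum_le_tsum fun x => ENNReal.rpow_le_rpow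
            (sphMax_le_arcSum (by omega) (truncation_support_finite f n) x) hp0.le
      _ ≤ ENNReal.ofReal (Real.exp (4 * Real.pi)) ^ p *
          (C * ∑' x, (truncation f n x : ℝ≥0∞) ^ p) := by
          simp only [ENNReal.mul_rpow_of_nonneg _ _ hp0.le, ENNReal.tsum_mul_left]
          exact mul_le_mul_right (hC _ (truncation_support_finite f n)) _
      _ ≤ ENNReal.ofReal (Real.exp (4 * Real.pi)) ^ p * (C * ∑' x, f x ^ p) :=
          mul_le_mul_right (mul_le_mul_right (ENNReal.tsum_le_tsum fun x =>
            ENNReal.rpow_le_rpow (truncation_le f n x) hp0.le) _) _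
      _ = _ := by
          rw [ENNReal.coe_mul, ENNReal.coe_rpow_of_nonneg _ hp0.le, mul_assoc]; rfl
  have h2 : ∀ x, sphMax f x ^ p ≤
      ⨆ n, sphMax (fun y => (truncation f n y : ℝ≥0∞)) x ^ p := fun x =>
    calc _ ≤ (⨆ n, sphMax (fun y => (truncation f n y : ℝ≥0∞)) x) ^ p :=
          ENNReal.rpow_le_rpow (sphMax_le_iSup_truncation f x) hp0.le
      _ = _ := (ENNReal.orderIsoRpow p hp0).map_iSup _
  refine (ENNReal.tsum_le_tsum h2).trans ?_
  rw [ENNReal.tsum_eq_iSup_sum]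
  refine iSup_le fun X => ?_
  rw [ENNReal.finsetSum_iSup_of_monotone fun x m n hmn => ENNReal.rpow_le_rpow
    (sphMax_mono (fun y => monotone_truncation f y hmn) x) hp0.le]
  exact iSup_le fun n => (ENNReal.sum_le_tsum X).trans (h1 n)

lemma exists_card_sphere_le (d : ℕ) (hd : 5 ≤ d) : ∃ K : ℝ≥0, ∀ μ : ℕ,
    ENNReal.ofReal ((max 1 (μ : ℝ)) ^ (1 - (d : ℝ) / 2)) * (sphere d μ).card ≤ K := by
  classical
  have hd' : (5 : ℝ) ≤ d := by exact_mod_cast hd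
  obtain ⟨p, hp, hp2⟩ := exists_between (show (d : ℝ) / (d - 2) < 2 by
    rw [div_lt_iff₀ (by linarith)]; linarith)
  have hp0 : 0 < p := lt_trans (div_pos (by linarith) (by linarith)) hp
  obtain ⟨C, hC⟩ := exists_tsum_sphMax_rpow_le_of_lt_two d hd hp hp2
  refine ⟨(2 ^ d * C) ^ p⁻¹, fun μ => ?_⟩
  rw [ENNReal.coe_rpow_of_nonneg _ (inv_nonneg.2 hp0.le), ENNReal.le_rpow_inv_iff hp0]
  set A := ENNReal.ofReal ((max 1 (μ : ℝ)) ^ (1 - (d : ℝ) / 2)) * (sphere d μ).card with hA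
  let f : (Fin d → ℤ) → ℝ≥0∞ := fun y => if y ∈ cube 0 (2 * μ) then 1 else 0
  have h1 : ∀ x ∈ cube 0 μ, A ≤ sphMax f x := fun x hx => by
    refine le_iSup_of_le μ (le_of_eq ?_)
    rw [hA, Finset.card_eq_sum_ones]
    push_cast
    congr 1
    refine Finset.sum_congr rfl fun u hu => (if_pos ?_).symm
    have hu' := mem_cube_of_normSq_le (mem_sphere.1 hu).le
    rw [mem_cube] at hx hu' ⊢
    intro i
    have hx := hx i
    have hu := hu' i
    simp only [Pi.zero_apply, sub_zero, Pi.sub_apply, abs_le] at hx hu ⊢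
    push_cast
    constructor <;> linarith
  have h2 : (((2 * μ + 1) ^ d : ℕ) : ℝ≥0∞) * A ^ p ≤
      (((2 * μ + 1) ^ d : ℕ) : ℝ≥0∞) * (2 ^ d * C) := by
    calc _ = ∑ x ∈ cube (0 : Fin d → ℤ) μ, A ^ p := by
          rw [Finset.sum_const, card_cube, nsmul_eq_mul]
      _ ≤ ∑ x ∈ cube (0 : Fin d → ℤ) μ, sphMax f x ^ p :=
          Finset.sum_le_sum fun x hx => ENNReal.rpow_le_rpow (h1 x hx) hp0.le
      _ ≤ C * ∑' x, f x ^ p := (ENNReal.sum_le_tsum _).trans (hC f)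
      _ = C * (((2 * (2 * μ) + 1) ^ d : ℕ) : ℝ≥0∞) := by
          rw [tsum_eq_sum (s := cube 0 (2 * μ)) fun y hy => by simp [f, hy, hp0],
            Finset.sum_congr rfl (g := fun _ => (1 : ℝ≥0∞)) fun y hy => by simp [f, hy],
            ← card_cube (0 : Fin d → ℤ)]
          simp
      _ ≤ C * (((2 * (2 * μ + 1)) ^ d : ℕ) : ℝ≥0∞) := by
          refine mul_le_mul_right ?_ _
          exact_mod_cast Nat.pow_le_pow_left (by omega) d
      _ = _ := by rw [mul_pow]; push_cast; ring
  have h3 := (ENNReal.mul_le_mul_iff_right (a := (((2 * μ + 1) ^ d : ℕ) : ℝ≥0∞))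
    (by exact_mod_cast (by positivity : (2 * μ + 1) ^ d ≠ 0)) (ENNReal.natCast_ne_top _)).1 h2
  exact_mod_cast h3

/-- The `ℓ^p` bound for the discrete spherical maximal function. -/
theorem exists_tsum_sphMax_rpow_le (d : ℕ) (hd : 5 ≤ d) {p : ℝ}
    (hp : (d : ℝ) / (d - 2) < p) : ∃ C : ℝ≥0, ∀ f : (Fin d → ℤ) → ℝ≥0∞,
      ∑' x, sphMax f x ^ p ≤ C * ∑' x, f x ^ p := by
  rcases lt_or_ge p 2 with hp2 | hp2
  · exact exists_tsum_sphMax_rpow_le_of_lt_two d hd hp hp2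
  have hd' : (5 : ℝ) ≤ d := by exact_mod_cast hd
  obtain ⟨p₀, h0, h2⟩ := exists_between (show (d : ℝ) / (d - 2) < 2 by
    rw [div_lt_iff₀ (by linarith)]; linarith)
  have hp0 : 0 < p₀ := lt_trans (div_pos (by linarith) (by linarith)) h0
  set a : ℝ := p / p₀ with ha
  have hap : a * p₀ = p := div_mul_cancel₀ _ hp0.ne'
  have ha1 : 1 ≤ a := (one_le_div hp0).2 (by linarith)
  have ha0 : 0 < a := by linarith
  obtain ⟨C, hC⟩ := exists_tsum_sphMax_rpow_le_of_lt_two d hd h0 h2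
  obtain ⟨K, hK⟩ := exists_card_sphere_le d hd
  refine ⟨(K ^ (a - 1)) ^ p₀ * C, fun f => ?_⟩
  have h3 : ∀ x, sphMax f x ^ a ≤ (K ^ (a - 1) : ℝ≥0) * sphMax (fun y => f y ^ a) x := fun x => by
    rw [← ENNReal.le_rpow_inv_iff ha0]
    refine iSup_le fun μ => ?_
    rw [ENNReal.le_rpow_inv_iff ha0]
    set c := ENNReal.ofReal ((max 1 (μ : ℝ)) ^ (1 - (d : ℝ) / 2)) with hc
    have hc0 : c ≠ 0 := by
      rw [hc, ne_eq, ENNReal.ofReal_eq_zero, not_le]; positivity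
    calc _ = c ^ a * (∑ u ∈ sphere d μ, f (x - u)) ^ a := ENNReal.mul_rpow_of_nonneg _ _ ha0.le
      _ ≤ c ^ a * ((sphere d μ).card ^ (a - 1) * ∑ u ∈ sphere d μ, f (x - u) ^ a) :=
          mul_le_mul_right (ENNReal.rpow_sum_le_const_mul_sum_rpow _ _ ha1) _
      _ = (c * (sphere d μ).card) ^ (a - 1) * (c * ∑ u ∈ sphere d μ, f (x - u) ^ a) := by
          have : c ^ a = c ^ (a - 1) * c := by
            nth_rewrite 3 [← ENNReal.rpow_one c]
            rw [← ENNReal.rpow_add _ _ hc0 ENNReal.ofReal_ne_top]; congr 1; ring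
          rw [ENNReal.mul_rpow_of_nonneg _ _ (by linarith), this]
          ring
      _ ≤ _ := by
          rw [ENNReal.coe_rpow_of_nonneg _ (by linarith)]
          exact mul_le_mul' (ENNReal.rpow_le_rpow (hK μ) (by linarith))
            (le_iSup (fun μ : ℕ => ENNReal.ofReal ((max 1 (μ : ℝ)) ^ (1 - (d : ℝ) / 2)) *
              ∑ u ∈ sphere d μ, f (x - u) ^ a) μ)
  calc ∑' x, sphMax f x ^ p = ∑' x, (sphMax f x ^ a) ^ p₀ :=
        tsum_congr fun x => by rw [← ENNReal.rpow_mul, hap]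
    _ ≤ ∑' x, ((K ^ (a - 1) : ℝ≥0) * sphMax (fun y => f y ^ a) x) ^ p₀ :=
        ENNReal.tsum_le_tsum fun x => ENNReal.rpow_le_rpow (h3 x) hp0.le
    _ ≤ ((K ^ (a - 1) : ℝ≥0) : ℝ≥0∞) ^ p₀ * (C * ∑' x, (f x ^ a) ^ p₀) := by
        simp only [ENNReal.mul_rpow_of_nonneg _ _ hp0.le, ENNReal.tsum_mul_left]
        exact mul_le_mul_right (hC _) _
    _ = _ := by
        rw [ENNReal.coe_mul, ENNReal.coe_rpow_of_nonneg _ hp0.le, mul_assoc]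
        simp only [← ENNReal.rpow_mul, hap]

/-- The lattice points in the ball `|u|² ≤ μ`. -/
def latticeBall (d μ : ℕ) : Finset (Fin d → ℤ) := (cube 0 μ).filter fun u => normSq u ≤ μ

lemma mem_latticeBall {d μ : ℕ} {u : Fin d → ℤ} : u ∈ latticeBall d μ ↔ normSq u ≤ μ := by
  rw [latticeBall, Finset.mem_filter, and_iff_right_iff_imp]
  exact mem_cube_of_normSq_le

lemma sum_latticeBall_le {d lam : ℕ} (hlam : 1 ≤ lam) (f : (Fin d → ℤ) → ℝ≥0∞)
    (x : Fin d → ℤ) :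
    ∑ u ∈ latticeBall d lam, f (x - u) ≤
      ENNReal.ofReal (Real.exp Real.pi * (lam : ℝ) ^ ((d : ℝ) / 2)) * gaussMax f x := by
  have hl : (1 : ℝ) ≤ lam := by exact_mod_cast hlam
  have hM : 1 ≤ √(lam : ℝ) := Real.one_le_sqrt.2 hl
  have hMd : √(lam : ℝ) ^ d = (lam : ℝ) ^ ((d : ℝ) / 2) := by
    rw [Real.sqrt_eq_rpow, ← Real.rpow_natCast, ← Real.rpow_mul (by positivity)]
    congr 1; ring
  set c := Real.exp Real.pi * (lam : ℝ) ^ ((d : ℝ) / 2) with hc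
  calc _ ≤ ∑ u ∈ latticeBall d lam, ENNReal.ofReal c * (ENNReal.ofReal ((√(lam : ℝ) ^ d)⁻¹ *
        Real.exp (-Real.pi * (normSq u : ℝ) / √(lam : ℝ) ^ 2)) * f (x - u)) := by
        refine Finset.sum_le_sum fun u hu => ?_
        rw [← mul_assoc, ← ENNReal.ofReal_mul (by positivity)]
        refine le_mul_of_one_le_left zero_le ?_
        rw [← ENNReal.ofReal_one]
        refine ENNReal.ofReal_le_ofReal ?_
        have hu' : (normSq u : ℝ) ≤ lam := by exact_mod_cast mem_latticeBall.1 hu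
        have hpos : 0 < (lam : ℝ) ^ ((d : ℝ) / 2) := by positivity
        rw [hMd, Real.sq_sqrt (by positivity), hc]
        calc (1 : ℝ) ≤ Real.exp (Real.pi + -Real.pi * (normSq u : ℝ) / lam) := by
              rw [Real.one_le_exp_iff, ← sub_nonneg.trans (Iff.refl _)]
              have : Real.pi * (normSq u : ℝ) / lam ≤ Real.pi := by
                rw [div_le_iff₀ (by positivity)]
                exact mul_le_mul_of_nonneg_left hu' Real.pi_pos.le
              rw [neg_mul, neg_div]; linarith
          _ = _ := by rw [Real.exp_add]; field_simp
    _ ≤ ENNReal.ofReal c * gaussAvg (√(lam : ℝ)) f x := by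
        rw [← Finset.mul_sum]
        exact mul_le_mul_right (ENNReal.sum_le_tsum _) _
    _ ≤ _ := mul_le_mul_right (le_iSup₂ (f := fun (M : ℝ) (_ : 1 ≤ M) => gaussAvg M f x) _ hM) _

lemma sum_sphere_le_sphMax {d lam μ : ℕ} (hd : 2 ≤ d) (hlam : 1 ≤ lam) (hμ : μ ≤ lam)
    (f : (Fin d → ℤ) → ℝ≥0∞) (x : Fin d → ℤ) :
    ∑ u ∈ sphere d μ, f (x - u) ≤
      ENNReal.ofReal ((lam : ℝ) ^ ((d : ℝ) / 2 - 1)) * sphMax f x := by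
  have hd' : (2 : ℝ) ≤ d := by exact_mod_cast hd
  set m : ℝ := max 1 (μ : ℝ) with hm
  have hm0 : 0 < m := by positivity
  have hml : m ≤ lam := max_le (by exact_mod_cast hlam) (by exact_mod_cast hμ)
  calc _ = ENNReal.ofReal (m ^ ((d : ℝ) / 2 - 1)) *
        (ENNReal.ofReal (m ^ (1 - (d : ℝ) / 2)) * ∑ u ∈ sphere d μ, f (x - u)) := by
        rw [← mul_assoc, ← ENNReal.ofReal_mul (by positivity), ← Real.rpow_add hm0]
        simp
    _ ≤ _ := mul_le_mul' (ENNReal.ofReal_le_ofReal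
        (Real.rpow_le_rpow hm0.le hml (by linarith)))
        (le_iSup (fun μ : ℕ => ENNReal.ofReal ((max 1 (μ : ℝ)) ^ (1 - (d : ℝ) / 2)) *
          ∑ u ∈ sphere d μ, f (x - u)) μ)

/-- Slicing a sum over a sphere in `(ℤ^d)^(m+1)` along the last factor. -/
lemma sum_slice_le {d m lam : ℕ} (hd : 2 ≤ d) (hlam : 1 ≤ lam)
    (F : Fin (m + 1) → (Fin d → ℤ) → ℝ≥0∞) (x : Fin d → ℤ)
    {S : Finset (Fin (m + 1) → Fin d → ℤ)} (hS : ∀ u ∈ S, ∑ i, normSq (u i) = (lam : ℤ)) :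
    ∑ u ∈ S, ∏ i, F i (x - u i) ≤
      (∏ i : Fin m, ∑ u ∈ latticeBall d lam, F i.castSucc (x - u)) *
        (ENNReal.ofReal ((lam : ℝ) ^ ((d : ℝ) / 2 - 1)) * sphMax (F (Fin.last m)) x) := by
  classical
  have hsplit : ∀ u ∈ S,
      ∑ i : Fin m, normSq (u i.castSucc) + normSq (u (Fin.last m)) = (lam : ℤ) := fun u hu => by
    rw [← hS u hu, Fin.sum_univ_castSucc]
  have hmaps : ∀ u ∈ S, Fin.init u ∈ Fintype.piFinset fun _ : Fin m => latticeBall d lam := by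
    intro u hu
    refine Fintype.mem_piFinset.2 fun i => mem_latticeBall.2 ?_
    have h1 := Finset.single_le_sum (f := fun i : Fin m => normSq (u i.castSucc))
      (fun _ _ => normSq_nonneg _) (Finset.mem_univ i)
    have h2 := normSq_nonneg (u (Fin.last m))
    have h3 := hsplit u hu
    simp only [Fin.init]
    linarith
  rw [← Finset.sum_fiberwise_of_maps_to hmaps, Finset.prod_univ_sum, Finset.sum_mul]
  refine Finset.sum_le_sum fun v hv => ?_
  set T := S.filter fun u => Fin.init u = v with hT
  have hTv : ∀ u ∈ T, Fin.init u = v := fun u hu => (Finset.mem_filter.1 hu).2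
  have hinj : Set.InjOn (fun u : Fin (m + 1) → Fin d → ℤ => u (Fin.last m)) T := by
    intro u hu u' hu' h
    dsimp only at h
    rw [← Fin.snoc_init_self u, ← Fin.snoc_init_self u', hTv u hu, hTv u' hu', h]
  set ν : ℤ := ∑ i, normSq (v i) with hν
  have hν0 : 0 ≤ ν := Finset.sum_nonneg fun _ _ => normSq_nonneg _
  have hsub : T.image (fun u => u (Fin.last m)) ⊆ sphere d (lam - ν).toNat := by
    intro w hw
    obtain ⟨u, hu, rfl⟩ := Finset.mem_image.1 hw
    have h1 := hsplit u (Finset.mem_filter.1 hu).1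
    have h2 : ∑ i : Fin m, normSq (u i.castSucc) = ν := by
      rw [hν, ← hTv u hu]; rfl
    have h3 := normSq_nonneg (u (Fin.last m))
    rw [mem_sphere]
    omega
  calc _ = ∑ u ∈ T, (∏ i : Fin m, F i.castSucc (x - v i)) *
        F (Fin.last m) (x - u (Fin.last m)) := by
        refine Finset.sum_congr rfl fun u hu => ?_
        rw [Fin.prod_univ_castSucc, ← hTv u hu]; rfl
    _ = (∏ i : Fin m, F i.castSucc (x - v i)) *
        ∑ w ∈ T.image (fun u => u (Fin.last m)), F (Fin.last m) (x - w) := by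
        rw [← Finset.mul_sum, Finset.sum_image hinj]
    _ ≤ (∏ i : Fin m, F i.castSucc (x - v i)) *
        ∑ w ∈ sphere d (lam - ν).toNat, F (Fin.last m) (x - w) :=
        mul_le_mul_right (Finset.sum_le_sum_of_subset hsub) _
    _ ≤ _ := mul_le_mul_right (sum_sphere_le_sphMax hd hlam (by omega) _ _) _

/-- The multilinear maximal function is dominated by a product of linear maximal functions. -/
lemma multMax_le {d m : ℕ} (hd : 2 ≤ d) (f : Fin (m + 1) → (Fin d → ℤ) → ℂ) (x : Fin d → ℤ) :
    multMax d (m + 1) f x ≤ ENNReal.ofReal (Real.exp Real.pi) ^ m *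
      ((∏ i : Fin m, gaussMax (fun y => ‖f i.castSucc y‖ₑ) x) *
        sphMax (fun y => ‖f (Fin.last m) y‖ₑ) x) := by
  classical
  refine iSup₂_le fun lam hlam => ?_
  change ‖multAvg d (m + 1) f lam x‖ₑ ≤ _
  have hl : (1 : ℝ) ≤ lam := by exact_mod_cast hlam
  have hl0 : (0 : ℝ) < lam := by linarith
  set S : Finset (Fin (m + 1) → Fin d → ℤ) :=
    (Fintype.piFinset fun _ => cube 0 lam).filter fun u => ∑ i, normSq (u i) = (lam : ℤ) with hS
  have hmem : ∀ u : Fin (m + 1) → Fin d → ℤ, (∑ i, normSq (u i) = (lam : ℤ)) = (u ∈ S) := by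
    intro u
    rw [hS, Finset.mem_filter, eq_iff_iff, iff_and_self]
    refine fun h => Fintype.mem_piFinset.2 fun i => mem_cube_of_normSq_le (h ▸ ?_)
    exact Finset.single_le_sum (f := fun i => normSq (u i)) (fun _ _ => normSq_nonneg _)
      (Finset.mem_univ i)
  set e : ℝ := (((m + 1) * d : ℕ) : ℝ) / 2 - 1 with he
  have h1 : ‖multAvg d (m + 1) f lam x‖ₑ ≤ ENNReal.ofReal ((lam : ℝ) ^ e)⁻¹ *
      ∑ u ∈ S, ∏ i, ‖f i (x - u i)‖ₑ := by
    unfold multAvg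
    have hfin := finsum_mem_coe_finset (fun u => ∏ i, f i (x - u i)) S
    simp only [Finset.mem_coe] at hfin
    simp only [hmem]
    rw [hfin, enorm_mul, ← ofReal_norm, Complex.norm_real,
      Real.norm_of_nonneg (by positivity)]
    refine mul_le_mul_right ((enorm_sum_le _ _).trans (le_of_eq ?_)) _
    refine Finset.sum_congr rfl fun u _ => ?_
    simp only [← ofReal_norm]
    rw [norm_prod, ENNReal.ofReal_prod_of_nonneg fun _ _ => norm_nonneg _]
  refine h1.trans ((mul_le_mul_right (sum_slice_le hd hlam (fun i y => ‖f i y‖ₑ) x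
    fun u hu => (hmem u).symm ▸ hu) _).trans ?_)
  refine (mul_le_mul_right (mul_le_mul_left (Finset.prod_le_prod' fun i _ =>
    sum_latticeBall_le hlam (fun y => ‖f i.castSucc y‖ₑ) x) _) _).trans (le_of_eq ?_)
  rw [Finset.prod_mul_distrib, Finset.prod_const, Finset.card_univ, Fintype.card_fin,
    ENNReal.ofReal_mul (Real.exp_pos _).le, mul_pow]
  have h2 : ENNReal.ofReal ((lam : ℝ) ^ e)⁻¹ * (ENNReal.ofReal ((lam : ℝ) ^ ((d : ℝ) / 2)) ^ m *
      ENNReal.ofReal ((lam : ℝ) ^ ((d : ℝ) / 2 - 1))) = 1 := by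
    rw [← ENNReal.ofReal_pow (by positivity), ← ENNReal.ofReal_mul (by positivity),
      ← ENNReal.ofReal_mul (by positivity), ← Real.rpow_natCast, ← Real.rpow_mul hl0.le,
      ← Real.rpow_add hl0, ← Real.rpow_neg hl0.le, ← Real.rpow_add hl0, he]
    push_cast
    ring_nf
    simp
  set P := ∏ i : Fin m, gaussMax (fun y => ‖f i.castSucc y‖ₑ) x
  set Q := sphMax (fun y => ‖f (Fin.last m) y‖ₑ) x
  calc _ = (ENNReal.ofReal ((lam : ℝ) ^ e)⁻¹ * (ENNReal.ofReal ((lam : ℝ) ^ ((d : ℝ) / 2)) ^ m *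
      ENNReal.ofReal ((lam : ℝ) ^ ((d : ℝ) / 2 - 1)))) *
      (ENNReal.ofReal (Real.exp Real.pi) ^ m * (P * Q)) := by ring
    _ = _ := by rw [h2, one_mul]

lemma lpNormE_mono_exponent {d : ℕ} {r₀ r : ℝ} (h0 : 0 < r₀) (hr : r₀ ≤ r)
    (F : (Fin d → ℤ) → ℝ≥0∞) : lpNormE d r F ≤ lpNormE d r₀ F := by
  have hr0 : 0 < r := by linarith
  set A := ∑' x, F x ^ r₀ with hA
  have hs : 0 ≤ (r - r₀) / r₀ := div_nonneg (by linarith) h0.le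
  have h1 : ∀ x, F x ^ r ≤ F x ^ r₀ * A ^ ((r - r₀) / r₀) := fun x =>
    calc F x ^ r = F x ^ r₀ * (F x ^ r₀) ^ ((r - r₀) / r₀) := by
          rw [← ENNReal.rpow_mul, ← ENNReal.rpow_add_of_nonneg _ _ h0.le (by positivity)]
          congr 1; field_simp; ring
      _ ≤ _ := mul_le_mul_right (ENNReal.rpow_le_rpow (ENNReal.le_tsum x) hs) _
  have h2 : ∑' x, F x ^ r ≤ A ^ (r / r₀) := by
    refine (ENNReal.tsum_le_tsum h1).trans (le_of_eq ?_)
    rw [ENNReal.tsum_mul_right, ← hA]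
    nth_rewrite 1 [← ENNReal.rpow_one A]
    rw [← ENNReal.rpow_add_of_nonneg _ _ zero_le_one hs]
    congr 1; field_simp; ring
  calc lpNormE d r F ≤ (A ^ (r / r₀)) ^ (1 / r) := ENNReal.rpow_le_rpow h2 (by positivity)
    _ = _ := by
      rw [← ENNReal.rpow_mul, lpNormE]
      congr 1; field_simp

/-- Hölder's inequality for a finite product. -/
lemma lpNormE_prod_le {d : ℕ} {ι : Type*} [Fintype ι] [Nonempty ι] {p : ι → ℝ}
    (hp : ∀ i, 0 < p i) (G : ι → (Fin d → ℤ) → ℝ≥0∞) :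
    lpNormE d (∑ i, 1 / p i)⁻¹ (fun x => ∏ i, G i x) ≤ ∏ i, lpNormE d (p i) (G i) := by
  set s := ∑ i, 1 / p i with hs
  have hs0 : 0 < s := Finset.sum_pos (fun i _ => one_div_pos.2 (hp i)) Finset.univ_nonempty
  have h1 := ENNReal.lintegral_prod_norm_pow_le (μ := (Measure.count : Measure (Fin d → ℤ)))
    Finset.univ (f := fun i x => G i x ^ p i) (fun i _ => (measurable_of_countable _).aemeasurable)
    (p := fun i => s⁻¹ * (1 / p i)) (by rw [← Finset.mul_sum, inv_mul_cancel₀ hs0.ne'])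
    fun i _ => mul_nonneg (inv_pos.2 hs0).le (one_div_pos.2 (hp i)).le
  simp only [lintegral_count] at h1
  have h2 : ∀ x, (∏ i, G i x) ^ s⁻¹ = ∏ i, (G i x ^ p i) ^ (s⁻¹ * (1 / p i)) := fun x => by
    rw [← ENNReal.prod_rpow_of_nonneg (inv_pos.2 hs0).le]
    refine Finset.prod_congr rfl fun i _ => ?_
    have := hp i
    rw [← ENNReal.rpow_mul]
    congr 1; field_simp
  calc _ = (∑' x, ∏ i, (G i x ^ p i) ^ (s⁻¹ * (1 / p i))) ^ (1 / s⁻¹) := by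
        rw [lpNormE]; simp only [h2]
    _ ≤ (∏ i, (∑' x, G i x ^ p i) ^ (s⁻¹ * (1 / p i))) ^ (1 / s⁻¹) :=
        ENNReal.rpow_le_rpow h1 (by positivity)
    _ = _ := by
        rw [← ENNReal.prod_rpow_of_nonneg (by positivity)]
        refine Finset.prod_congr rfl fun i _ => ?_
        rw [← ENNReal.rpow_mul, lpNormE]
        congr 1; field_simp

lemma lpNormE_const_mul {d : ℕ} {r : ℝ} (hr : 0 < r) (c : ℝ≥0∞) (F : (Fin d → ℤ) → ℝ≥0∞) :
    lpNormE d r (fun x => c * F x) = c * lpNormE d r F := by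
  simp only [lpNormE, ENNReal.mul_rpow_of_nonneg _ _ hr.le, ENNReal.tsum_mul_left]
  rw [ENNReal.mul_rpow_of_nonneg _ _ (by positivity), ← ENNReal.rpow_mul,
    mul_one_div_cancel hr.ne', ENNReal.rpow_one]

lemma lpNormE_mono {d : ℕ} {r : ℝ} (hr : 0 < r) {F G : (Fin d → ℤ) → ℝ≥0∞}
    (h : ∀ x, F x ≤ G x) : lpNormE d r F ≤ lpNormE d r G :=
  ENNReal.rpow_le_rpow (ENNReal.tsum_le_tsum fun x => ENNReal.rpow_le_rpow (h x) hr.le)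
    (by positivity)

end

/-- For `d ≥ 5` and `ℓ ≥ 2`, the `ℓ`-linear discrete spherical maximal operator is bounded
`ℓ^{p_1} × ⋯ × ℓ^{p_ℓ} → ℓ^r` whenever `1 < p_i` for `i ≤ ℓ-1`, `d/(d-2) < p_ℓ` and
`1/r ≤ 1/p_1 + ⋯ + 1/p_ℓ` (so in particular `r > d/(ℓd-2)`). -/
theorem discrete_multilinear_spherical_maximal_bounded
    (d l : ℕ) (hd : 5 ≤ d) (hl : 2 ≤ l) (p : Fin l → ℝ) (r : ℝ)
    (hp : ∀ i : Fin l, (i : ℕ) + 1 < l → 1 < p i)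
    (hpl : ∀ i : Fin l, (i : ℕ) + 1 = l → (d : ℝ) / ((d : ℝ) - 2) < p i)
    (hr : 0 < r) (hpr : 1 / r ≤ ∑ i, 1 / p i) :
    ∃ C : ℝ≥0, 0 < C ∧ ∀ f : Fin l → (Fin d → ℤ) → ℂ,
      lpNormE d r (multMax d l f) ≤ (C : ℝ≥0∞) * ∏ i, lpNorm d (p i) (f i) := by
  obtain ⟨m, rfl⟩ : ∃ m, l = m + 1 := ⟨l - 1, by omega⟩
  have hd' : (5 : ℝ) ≤ d := by exact_mod_cast hd
  let op : Fin (m + 1) → ((Fin d → ℤ) → ℝ≥0∞) → (Fin d → ℤ) → ℝ≥0∞ :=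
    Fin.lastCases sphMax fun _ => gaussMax
  have hop : ∀ i, 0 < p i ∧ ∃ C : ℝ≥0, ∀ g : (Fin d → ℤ) → ℝ≥0∞,
      ∑' x, op i g x ^ p i ≤ C * ∑' x, g x ^ p i := by
    refine Fin.lastCases ?_ fun i => ?_
    · have h := hpl (Fin.last m) (by simp)
      refine ⟨lt_trans (div_pos (by linarith) (by linarith)) h, ?_⟩
      simp only [op, Fin.lastCases_last]
      exact exists_tsum_sphMax_rpow_le d hd h
    · have h := hp i.castSucc (by simp)
      refine ⟨by linarith, ?_⟩
      simp only [op, Fin.lastCases_castSucc]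
      exact exists_gaussMax_strong d h
  choose hp0 C hC using hop
  have hs0 : 0 < ∑ i, 1 / p i :=
    Finset.sum_pos (fun i _ => one_div_pos.2 (hp0 i)) Finset.univ_nonempty
  have hr0 : (∑ i, 1 / p i)⁻¹ ≤ r := by
    rw [inv_le_comm₀ hs0 hr, ← one_div]; exact hpr
  have hG : ∀ (f : Fin (m + 1) → (Fin d → ℤ) → ℂ) (i : Fin (m + 1)),
      lpNormE d (p i) (op i fun y => ‖f i y‖ₑ) ≤ (C i ^ (1 / p i) : ℝ≥0) * lpNorm d (p i) (f i) :=
    fun f i => by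
      have h0 : 0 ≤ 1 / p i := (one_div_pos.2 (hp0 i)).le
      refine (ENNReal.rpow_le_rpow (hC i _) h0).trans_eq ?_
      rw [ENNReal.mul_rpow_of_nonneg _ _ h0, ← ENNReal.coe_rpow_of_nonneg _ h0]
      rfl
  set E : ℝ≥0 := (Real.exp Real.pi).toNNReal ^ m with hE
  refine ⟨E * ∏ i, C i ^ (1 / p i) + 1, by positivity, fun f => ?_⟩
  have hdom : ∀ x, multMax d (m + 1) f x ≤ E * ∏ i, op i (fun y => ‖f i y‖ₑ) x := fun x => by
    refine (multMax_le (by omega) f x).trans (le_of_eq ?_)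
    rw [Fin.prod_univ_castSucc, hE, ENNReal.coe_pow]
    simp only [op, Fin.lastCases_last, Fin.lastCases_castSucc]
    rfl
  calc lpNormE d r (multMax d (m + 1) f)
      ≤ E * lpNormE d r (fun x => ∏ i, op i (fun y => ‖f i y‖ₑ) x) :=
        (lpNormE_mono hr hdom).trans_eq (lpNormE_const_mul hr _ _)
    _ ≤ E * ∏ i, lpNormE d (p i) (op i fun y => ‖f i y‖ₑ) :=
        mul_le_mul_right ((lpNormE_mono_exponent (inv_pos.2 hs0) hr0 _).trans
          (lpNormE_prod_le hp0 _)) _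
    _ ≤ E * ∏ i, ((C i ^ (1 / p i) : ℝ≥0) * lpNorm d (p i) (f i)) :=
        mul_le_mul_right (Finset.prod_le_prod' fun i _ => hG f i) _
    _ = ((E * ∏ i, C i ^ (1 / p i) : ℝ≥0) : ℝ≥0∞) * ∏ i, lpNorm d (p i) (f i) := by
        rw [Finset.prod_mul_distrib, ← mul_assoc]; push_cast; rfl
    _ ≤ _ := mul_le_mul_left (by exact_mod_cast le_self_add) _
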